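/- arXiv:2008.04273 — 5 statements merged into one kernel-verified Lean document; each statement's English description precedes it below -/
import Mathlib

section
/- Fix d ≥ 1, E > 0, an even Schwartz function f on ℝ, and a point (x,ξ) ∈ ℝ^{2d} with H(x,ξ) > E. Then the ħ-localized Wigner–Weyl sum W_{ħ,E,f}(x,ξ) is O(ħ^∞): for every κ ∈ ℕ there exist C_κ > 0 and ħ₀ > 0 such that |W_{ħ,E,f}(x,ξ)| ≤ C_κ ħ^κ for all 0 < ħ ≤ ħ₀. (Rapid decay, in the forbidden region H > E, of Wigner–Weyl sums spectrally localized in a window of width O(ħ) around E.) -/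
open MeasureTheory Real Filter
open scoped BigOperators ENNReal

noncomputable section

/-- Physicists' Hermite polynomials `H_n`. -/
def physHermite : ℕ → Polynomial ℝ
  | 0 => 1
  | n + 1 => 2 * Polynomial.X * physHermite n - Polynomial.derivative (physHermite n)

/-- The `L²`-normalized Hermite function `φ_n`. -/
def hermiteFun (n : ℕ) (t : ℝ) : ℝ :=
  ((2 : ℝ) ^ n * (n.factorial : ℝ) * Real.sqrt π) ^ (-(1 : ℝ) / 2) *
    (physHermite n).eval t * Real.exp (-t ^ 2 / 2)

/-- The product Hermite function `φ_α` on `ℝ^d`. -/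
def hermiteProd {d : ℕ} (α : Fin d → ℕ) (x : Fin d → ℝ) : ℝ :=
  ∏ j, hermiteFun (α j) (x j)

/-- The rescaled Hermite eigenfunction `φ_{α,hb}(x) = hb^{-d/4} φ_α(hb^{-1/2} x)`. -/
def hermiteProdH {d : ℕ} (hb : ℝ) (α : Fin d → ℕ) (x : Fin d → ℝ) : ℝ :=
  hb ^ (-(d : ℝ) / 4) * hermiteProd α fun j => hb ^ (-(1 : ℝ) / 2) * x j

/-- The eigenspace projection kernel `Π_{hb,N}(x,y) = Σ_{|α|=N} φ_{α,hb}(x) φ_{α,hb}(y)`. -/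
def projKer (d : ℕ) (hb : ℝ) (N : ℕ) (x y : Fin d → ℝ) : ℝ :=
  ∑ α ∈ Finset.Nat.antidiagonalTuple d N, hermiteProdH hb α x * hermiteProdH hb α y

/-- Euclidean dot product on `ℝ^d`. -/
def dotR {d : ℕ} (v ξ : Fin d → ℝ) : ℝ := ∑ j, v j * ξ j

/-- The Wigner distribution of the `N`-th eigenspace projection,
`W_{hb,N}(x,ξ) = (2πhb)^{-d} ∫ Π_{hb,N}(x+v/2, x-v/2) e^{-i v·ξ/hb} dv`. -/
def wigner (d : ℕ) (hb : ℝ) (N : ℕ) (x ξ : Fin d → ℝ) : ℂ :=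
  ((((2 * π * hb) ^ d)⁻¹ : ℝ) : ℂ) *
    ∫ v : Fin d → ℝ,
      ((projKer d hb N (fun j => x j + v j / 2) (fun j => x j - v j / 2) : ℝ) : ℂ) *
        Complex.exp (-Complex.I * (dotR v ξ : ℂ) / (hb : ℂ))

/-- The classical Hamiltonian `H(x,ξ) = (|x|² + |ξ|²)/2`. -/
def Hfun {d : ℕ} (x ξ : Fin d → ℝ) : ℝ := ((∑ j, x j ^ 2) + ∑ j, ξ j ^ 2) / 2

/-- `hb_N(E) = E/(N + d/2)`, so that `E_N(hb) = hb(N + d/2) = E`. -/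
def hPl (d : ℕ) (E : ℝ) (N : ℕ) : ℝ := E / ((N : ℝ) + (d : ℝ) / 2)

/-- The Airy function `Ai(s) = (1/π) lim_{T→∞} ∫_0^T cos(t³/3 + s t) dt`. -/
def airy (s : ℝ) : ℝ :=
  (1 / π) * limUnder Filter.atTop fun T : ℝ => ∫ t in (0 : ℝ)..T, Real.cos (t ^ 3 / 3 + s * t)

/-- The `ħ`-localized Wigner–Weyl sum
`W_{ħ,E,f}(x,ξ) = Σ_N f(ħ^{-1}(E - E_N(ħ))) W_{ħ,N}(x,ξ)`. -/
def wignerLocH (d : ℕ) (hb E : ℝ) (f : ℝ → ℝ) (x ξ : Fin d → ℝ) : ℂ :=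
  ∑' N : ℕ,
    ((f (hb⁻¹ * (E - hb * ((N : ℝ) + (d : ℝ) / 2))) : ℝ) : ℂ) * wigner d hb N x ξ


lemma aux_sphere (n : ℕ) (hn : 0 < n) (z u : ℂ) (q R : ℝ) (hq : 0 < q) (hq1 : q ≤ 1)
    (hR : 0 < R) (hRq : R ^ 2 = n / (2 * q)) (hu : ‖u‖ = R) :
    ‖((starRingEnd ℂ) z - u) ^ n * Complex.exp (2 * z * u)‖ ≤
      R ^ n * (Real.exp (‖z‖ ^ 2) * Real.exp ((1 - q) * (n / q - ‖z‖ ^ 2 / 2))) := by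
  set y : ℝ := (2 * z * u).re with hy
  have hn' : (0 : ℝ) < n := by exact_mod_cast hn
  have hyle : y ≤ ‖z‖ ^ 2 / 2 + 2 * R ^ 2 := by
    have h1 : y ≤ ‖2 * z * u‖ := Complex.re_le_norm _
    rw [norm_mul, norm_mul, hu] at h1
    simp only [Complex.norm_ofNat] at h1
    nlinarith [sq_nonneg (‖z‖ - 2 * R)]
  have ha : ‖(starRingEnd ℂ) z - u‖ ^ 2 = ‖z‖ ^ 2 + R ^ 2 - y := by
    rw [← hu, ← Complex.normSq_eq_norm_sq, ← Complex.normSq_eq_norm_sq,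
      ← Complex.normSq_eq_norm_sq, hy]
    simp [Complex.normSq_apply]
    ring
  have hb : ‖(starRingEnd ℂ) z - u‖ ^ 2 ≤ R ^ 2 * Real.exp ((‖z‖ ^ 2 - y) / R ^ 2) := by
    have h := Real.add_one_le_exp ((‖z‖ ^ 2 - y) / R ^ 2)
    have h2 : ‖z‖ ^ 2 + R ^ 2 - y = R ^ 2 * ((‖z‖ ^ 2 - y) / R ^ 2 + 1) := by
      field_simp
      ring
    rw [ha, h2]
    gcongr
  have hc : ‖(starRingEnd ℂ) z - u‖ ≤ R * Real.exp ((‖z‖ ^ 2 - y) / R ^ 2 / 2) := by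
    apply le_of_sq_le_sq _ (by positivity)
    rw [mul_pow, ← Real.exp_nat_mul]
    have h4 : ((2 : ℕ) : ℝ) * ((‖z‖ ^ 2 - y) / R ^ 2 / 2) = (‖z‖ ^ 2 - y) / R ^ 2 := by
      push_cast
      ring
    rw [h4]
    exact hb
  have hd : ‖(starRingEnd ℂ) z - u‖ ^ n ≤ R ^ n * Real.exp (q * (‖z‖ ^ 2 - y)) := by
    calc _ ≤ (R * Real.exp ((‖z‖ ^ 2 - y) / R ^ 2 / 2)) ^ n := by gcongr
      _ = _ := by
        rw [mul_pow, ← Real.exp_nat_mul, hRq]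
        congr 2
        field_simp
  rw [norm_mul, norm_pow, Complex.norm_exp, ← hy]
  calc _ ≤ R ^ n * Real.exp (q * (‖z‖ ^ 2 - y)) * Real.exp y := by gcongr
    _ = R ^ n * Real.exp (q * ‖z‖ ^ 2 + (1 - q) * y) := by
      rw [mul_assoc, ← Real.exp_add]; congr 2; ring
    _ ≤ _ := by
      rw [← Real.exp_add]
      refine mul_le_mul_of_nonneg_left (Real.exp_le_exp.2 ?_) (by positivity)
      have h3 : (n : ℝ) / q = 2 * R ^ 2 := by rw [hRq]; field_simp
      rw [h3]
      nlinarith [mul_le_mul_of_nonneg_left hyle (sub_nonneg.2 hq1)]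

lemma aux_deriv (n : ℕ) (z : ℂ) (q : ℝ) (hq : 0 < q) (hq1 : q ≤ 1) :
    ‖iteratedDeriv n (fun u => ((starRingEnd ℂ) z - u) ^ n * Complex.exp (2 * z * u)) 0‖ ≤
      n.factorial * (Real.exp (‖z‖ ^ 2) * Real.exp ((1 - q) * (n / q - ‖z‖ ^ 2 / 2))) := by
  rcases Nat.eq_zero_or_pos n with rfl | hn
  · simp
    rw [← Real.exp_add]
    apply Real.one_le_exp
    nlinarith [sq_nonneg ‖z‖]
  · have hn' : (0 : ℝ) < n := by exact_mod_cast hn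
    have hR : 0 < Real.sqrt (n / (2 * q)) := by positivity
    refine (Complex.norm_iteratedDeriv_le_of_forall_mem_sphere_norm_le n hR
      (Differentiable.diffContOnCl (by fun_prop)) (fun u hu => aux_sphere n hn z u q _ hq hq1 hR
        (Real.sq_sqrt (by positivity)) (by simpa using hu))).trans (le_of_eq ?_)
    field_simp

/-- B(m,n) -/
def Bmn (z : ℂ) (m n : ℕ) : ℂ :=
  iteratedDeriv n (fun u => (2 * (starRingEnd ℂ) z - 2 * u) ^ m * Complex.exp (2 * z * u)) 0

lemma Bmn_zero (z : ℂ) (n : ℕ) : Bmn z 0 n = (2 * z) ^ n := by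
  simp only [Bmn, pow_zero, one_mul]
  rw [iteratedDeriv_cexp_const_mul]
  simp

lemma iteratedDeriv_u_mul (g : ℂ → ℂ) (hg : ContDiff ℂ ⊤ g) (n : ℕ) :
    iteratedDeriv n (fun u => u * g u) 0 = n * iteratedDeriv (n - 1) g 0 := by
  have hg' : ContDiffAt ℂ n g 0 := (hg.of_le le_top).contDiffAt
  rw [iteratedDeriv_fun_mul contDiffAt_fun_id hg']
  rcases n with _ | n
  · simp
  · rw [Finset.sum_eq_single 1]
    · simp [iteratedDeriv_one]
    · intro i hi hi1
      rcases i with _ | _ | i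
      · simp
      · simp at hi1
      · simp [iteratedDeriv_succ']
    · simp

lemma Bmn_succ (z : ℂ) (m n : ℕ) :
    Bmn z (m + 1) n = 2 * (starRingEnd ℂ) z * Bmn z m n - 2 * n * Bmn z m (n - 1) := by
  set g : ℂ → ℂ := fun u => (2 * (starRingEnd ℂ) z - 2 * u) ^ m * Complex.exp (2 * z * u) with hg
  have hgd : ContDiff ℂ ⊤ g := by fun_prop
  have h1 : (fun u => (2 * (starRingEnd ℂ) z - 2 * u) ^ (m + 1) * Complex.exp (2 * z * u)) =
      (fun u => (2 * (starRingEnd ℂ) z) * g u - 2 * (u * g u)) := by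
    funext u; simp only [hg]; ring
  have h2 : ContDiff ℂ ⊤ (fun u => u * g u) := by fun_prop
  simp only [Bmn]
  rw [h1, iteratedDeriv_fun_sub ((contDiff_const.mul hgd).of_le le_top).contDiffAt
    ((contDiff_const.mul h2).of_le le_top).contDiffAt]
  rw [iteratedDeriv_const_mul_field, iteratedDeriv_const_mul_field, iteratedDeriv_u_mul g hgd]
  ring

lemma Bmn_bound (n : ℕ) (z : ℂ) (q : ℝ) (hq : 0 < q) (hq1 : q ≤ 1) :
    ‖Bmn z n n‖ ≤
      2 ^ n * (n.factorial * (Real.exp (‖z‖ ^ 2) * Real.exp ((1 - q) * (n / q - ‖z‖ ^ 2 / 2)))) := by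
  have : Bmn z n n = 2 ^ n * iteratedDeriv n
      (fun u => ((starRingEnd ℂ) z - u) ^ n * Complex.exp (2 * z * u)) 0 := by
    rw [← iteratedDeriv_const_mul_field, Bmn]
    congr 1
    funext u
    rw [← mul_sub, mul_pow]; ring
  rw [this, norm_mul, norm_pow, Complex.norm_ofNat]
  gcongr
  exact aux_deriv n z q hq hq1

/-- weight -/
def wt (ξ : ℝ) (v : ℝ) : ℂ := Complex.exp (-(1 / 4 : ℂ) * (v : ℂ) ^ 2 - Complex.I * ξ * v)

lemma norm_wt (ξ v : ℝ) : ‖wt ξ v‖ = Real.exp (-(1 / 4) * v ^ 2) := by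
  rw [wt, Complex.norm_exp]
  congr 1
  have : (-(1 / 4 : ℂ) * (v : ℂ) ^ 2 - Complex.I * ξ * v) =
    ((-(1 / 4) * v ^ 2 : ℝ) : ℂ) + ((-ξ * v : ℝ) : ℂ) * Complex.I := by
    push_cast; ring
  rw [this]
  simp only [Complex.add_re, Complex.ofReal_re, Complex.re_ofReal_mul, Complex.I_re]
  simp

lemma wt_cont (ξ : ℝ) : Continuous (wt ξ) := by
  unfold wt; fun_prop

lemma integrable_wt (ξ : ℝ) (P : Polynomial ℂ) :
    Integrable (fun v : ℝ => P.eval (v : ℂ) * wt ξ v) := by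
  induction P using Polynomial.induction_on' with
  | add p q hp hq => 
    simp only [Polynomial.eval_add, add_mul]
    exact hp.add hq
  | monomial n a =>
    have h := (integrable_rpow_mul_exp_neg_mul_sq (b := 1 / 4) (by norm_num) (s := (n : ℝ))
      (by have : (0 : ℝ) ≤ n := by positivity
          linarith)).norm
    have h2 := (h.const_mul ‖a‖)
    refine h2.mono' ?_ ?_
    · exact ((Polynomial.continuous _).comp Complex.continuous_ofReal).mul (wt_cont ξ) |>.aestronglyMeasurable
    · refine Filter.Eventually.of_forall fun v => ?_
      simp only [Polynomial.eval_monomial, norm_mul, norm_pow, norm_wt, Real.rpow_natCast,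
        Complex.norm_real, Real.norm_eq_abs, Real.abs_exp]
      rw [mul_assoc]

/-- J -/
def Jf (ξ : ℝ) (P : Polynomial ℂ) : ℂ := ∫ v : ℝ, P.eval (v : ℂ) * wt ξ v

lemma Jf_add (ξ : ℝ) (P Q : Polynomial ℂ) : Jf ξ (P + Q) = Jf ξ P + Jf ξ Q := by
  simp only [Jf, Polynomial.eval_add, add_mul]
  exact integral_add (integrable_wt ξ P) (integrable_wt ξ Q)

lemma Jf_smul (ξ : ℝ) (c : ℂ) (P : Polynomial ℂ) : Jf ξ (Polynomial.C c * P) = c * Jf ξ P := by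
  simp only [Jf, Polynomial.eval_mul, Polynomial.eval_C, mul_assoc]
  exact integral_const_mul _ _

lemma hasDerivAt_wt (ξ v : ℝ) :
    HasDerivAt (wt ξ) (-((v : ℂ) / 2 + Complex.I * ξ) * wt ξ v) v := by
  unfold wt
  have h1 : HasDerivAt (fun v : ℂ => -(1 / 4 : ℂ) * v ^ 2 - Complex.I * ξ * v)
      (-((v : ℂ) / 2 + Complex.I * ξ)) (v : ℂ) := by
    have := ((hasDerivAt_pow 2 (v : ℂ)).const_mul (-(1 / 4 : ℂ))).sub
      ((hasDerivAt_id (v : ℂ)).const_mul (Complex.I * ξ))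
    refine this.congr_deriv ?_
    simp
    ring
  exact (h1.cexp.comp_ofReal).congr_deriv (by ring)

lemma Jf_deriv (ξ : ℝ) (P : Polynomial ℂ) :
    Jf ξ (Polynomial.derivative P) =
      (1 / 2) * Jf ξ (Polynomial.X * P) + Complex.I * ξ * Jf ξ P := by
  set Q : Polynomial ℂ := Polynomial.derivative P +
    (Polynomial.C (-(1 / 2)) * (Polynomial.X * P) + Polynomial.C (-(Complex.I * ξ)) * P) with hQ
  have h0 : Jf ξ Q = 0 := by
    refine integral_eq_zero_of_hasDerivAt_of_integrable
      (f := fun v : ℝ => P.eval (v : ℂ) * wt ξ v) (fun v => ?_) (integrable_wt ξ Q)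
      (integrable_wt ξ P)
    refine (((P.hasDerivAt (v : ℂ)).comp_ofReal).mul (hasDerivAt_wt ξ v)).congr_deriv ?_
    simp only [hQ, Polynomial.eval_add, Polynomial.eval_mul, Polynomial.eval_C, Polynomial.eval_X]
    ring
  rw [hQ, Jf_add, Jf_add, Jf_smul, Jf_smul] at h0
  linear_combination h0

lemma Jf_one (ξ : ℝ) : Jf ξ 1 = 2 * (Real.sqrt π : ℂ) * Complex.exp (-(ξ : ℂ) ^ 2) := by
  have h := fourierIntegral_gaussian (b := 1 / 4) (by norm_num) (-(ξ : ℂ))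
  simp only [Jf, Polynomial.eval_one, one_mul]
  have h2 : ∀ v : ℝ, wt ξ v = Complex.exp (Complex.I * -(ξ : ℂ) * v) *
      Complex.exp (-(1 / 4) * (v : ℂ) ^ 2) := by
    intro v
    rw [wt, ← Complex.exp_add]
    congr 1
    ring
  simp_rw [h2]
  rw [h]
  have h3 : ((π : ℂ) / (1 / 4)) ^ (1 / 2 : ℂ) = 2 * (Real.sqrt π : ℂ) := by
    have : (π : ℂ) / (1 / 4) = ((4 * π : ℝ) : ℂ) := by push_cast; ring
    have h5 : (1 / 2 : ℂ) = ((1 / 2 : ℝ) : ℂ) := by norm_num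
    rw [this, h5, ← Complex.ofReal_cpow (by positivity), ← Real.sqrt_eq_rpow,
      Real.sqrt_mul (by norm_num)]
    rw [show (4 : ℝ) = 2 ^ 2 by norm_num, Real.sqrt_sq (by norm_num)]
    push_cast
    rfl
  rw [h3]
  congr 2
  ring

lemma deriv_physHermite (n : ℕ) :
    Polynomial.derivative (physHermite (n + 1)) =
      Polynomial.C (2 * ((n : ℝ) + 1)) * physHermite n := by
  induction n with
  | zero => simp [physHermite, Polynomial.C_ofNat]
  | succ n ih =>
    rw [physHermite, Polynomial.derivative_sub, Polynomial.derivative_mul, ih,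
      Polynomial.derivative_mul]
    have h := congrArg id (physHermite.eq_2 n)
    simp only [id] at h
    have h2 : Polynomial.derivative (physHermite n) =
      2 * Polynomial.X * physHermite n - physHermite (n + 1) := by rw [h]; ring
    simp only [Polynomial.derivative_mul, Polynomial.derivative_ofNat, Polynomial.derivative_X,
      Polynomial.derivative_C, h2]
    push_cast
    simp only [map_add, map_mul, map_natCast, map_one, Polynomial.C_ofNat]
    ring

/-- a -/
def aP (x : ℝ) (n : ℕ) : Polynomial ℂ :=
  ((physHermite n).map Complex.ofRealHom).comp
    (Polynomial.C (x : ℂ) + Polynomial.C (1 / 2) * Polynomial.X)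

/-- b -/
def bP (x : ℝ) (n : ℕ) : Polynomial ℂ :=
  ((physHermite n).map Complex.ofRealHom).comp
    (Polynomial.C (x : ℂ) + Polynomial.C (-(1 / 2)) * Polynomial.X)

lemma C_half : (2 : Polynomial ℂ) * Polynomial.C (1 / 2) = 1 := by
  rw [← Polynomial.C_ofNat, ← Polynomial.C_mul]; norm_num

lemma aP_succ (x : ℝ) (n : ℕ) : aP x (n + 1) =
    Polynomial.C (2 * (x : ℂ)) * aP x n + Polynomial.X * aP x n
      + Polynomial.C (-2) * Polynomial.derivative (aP x n) := by
  have h := C_half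
  simp only [aP, physHermite, Polynomial.derivative_comp, Polynomial.map_sub, Polynomial.map_mul,
    Polynomial.sub_comp, Polynomial.mul_comp, Polynomial.derivative_map, Polynomial.map_X,
    Polynomial.X_comp, Polynomial.map_ofNat, Polynomial.derivative_add, Polynomial.derivative_C,
    Polynomial.derivative_mul, Polynomial.derivative_X, Polynomial.C_mul, Polynomial.C_neg,
    Polynomial.C_ofNat, Polynomial.ofNat_comp]
  generalize ((physHermite n).map Complex.ofRealHom).comp _ = A
  generalize (Polynomial.map Complex.ofRealHom (Polynomial.derivative (physHermite n))).comp _ = B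
  linear_combination (Polynomial.X * A + B) * h

lemma bP_succ (x : ℝ) (n : ℕ) : bP x (n + 1) =
    Polynomial.C (2 * (x : ℂ)) * bP x n + Polynomial.C (-1) * (Polynomial.X * bP x n)
      + Polynomial.C 2 * Polynomial.derivative (bP x n) := by
  have h := C_half
  simp only [bP, physHermite, Polynomial.derivative_comp, Polynomial.map_sub, Polynomial.map_mul,
    Polynomial.sub_comp, Polynomial.mul_comp, Polynomial.derivative_map, Polynomial.map_X,
    Polynomial.X_comp, Polynomial.map_ofNat, Polynomial.derivative_add, Polynomial.derivative_C,
    Polynomial.derivative_mul, Polynomial.derivative_X, Polynomial.C_mul, Polynomial.C_neg,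
    Polynomial.C_ofNat, Polynomial.ofNat_comp, Polynomial.C_1, Polynomial.derivative_neg]
  generalize ((physHermite n).map Complex.ofRealHom).comp _ = A
  generalize (Polynomial.map Complex.ofRealHom (Polynomial.derivative (physHermite n))).comp _ = B
  linear_combination (-Polynomial.X * A + B) * h

lemma bP_deriv (x : ℝ) (n : ℕ) : Polynomial.derivative (bP x n) =
    Polynomial.C (-(n : ℂ)) * bP x (n - 1) := by
  rcases n with _ | n
  · simp [bP, physHermite]
  · have h := C_half
    have h2 := deriv_physHermite n
    simp only [bP, Polynomial.derivative_comp, Polynomial.derivative_map, h2, Polynomial.map_mul,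
      Polynomial.mul_comp, Polynomial.map_C, Polynomial.C_comp, Polynomial.derivative_add,
      Polynomial.derivative_C, Polynomial.derivative_mul, Polynomial.derivative_X,
      Nat.add_sub_cancel]
    generalize ((physHermite n).map Complex.ofRealHom).comp _ = A
    simp only [Complex.ofRealHom_eq_coe]
    push_cast
    simp only [Polynomial.C_mul, Polynomial.C_neg, Polynomial.C_ofNat, Polynomial.C_add,
      Polynomial.C_1]
    linear_combination (- (Polynomial.C (n : ℂ) + 1) * A) * h

lemma J_succ_left (x ξ : ℝ) (m n : ℕ) :
    Jf ξ (aP x (m + 1) * bP x n) =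
      2 * (x - Complex.I * ξ) * Jf ξ (aP x m * bP x n)
        - 2 * n * Jf ξ (aP x m * bP x (n - 1)) := by
  have h := Jf_deriv ξ (aP x m * bP x n)
  rw [Polynomial.derivative_mul, Jf_add, bP_deriv x n] at h
  rw [aP_succ]
  have e1 : (Polynomial.C (2 * (x : ℂ)) * aP x m + Polynomial.X * aP x m
      + Polynomial.C (-2) * Polynomial.derivative (aP x m)) * bP x n =
      Polynomial.C (2 * (x : ℂ)) * (aP x m * bP x n) + Polynomial.X * (aP x m * bP x n)
      + Polynomial.C (-2) * (Polynomial.derivative (aP x m) * bP x n) := by ring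
  rw [e1, Jf_add, Jf_add, Jf_smul, Jf_smul]
  have e2 : aP x m * (Polynomial.C (-(n : ℂ)) * bP x (n - 1)) =
    Polynomial.C (-(n : ℂ)) * (aP x m * bP x (n - 1)) := by ring
  rw [e2, Jf_smul] at h
  linear_combination (-2) * h

lemma J_zero (x ξ : ℝ) (n : ℕ) :
    Jf ξ (bP x n) = (2 * (x + Complex.I * ξ)) ^ n * Jf ξ 1 := by
  induction n with
  | zero => simp [bP, physHermite]
  | succ n ih =>
    have h := Jf_deriv ξ (bP x n)
    rw [bP_succ, Jf_add, Jf_add, Jf_smul, Jf_smul, Jf_smul, pow_succ]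
    linear_combination 2 * h + (2 * (x + Complex.I * ξ)) * ih

lemma J_eq (x ξ : ℝ) (m n : ℕ) :
    Jf ξ (aP x m * bP x n) = Bmn (x + Complex.I * ξ) m n * Jf ξ 1 := by
  induction m generalizing n with
  | zero =>
    have : aP x 0 = 1 := by simp [aP, physHermite]
    rw [this, one_mul, J_zero, Bmn_zero]
  | succ m ih =>
    rw [J_succ_left, Bmn_succ, ih, ih]
    have : (starRingEnd ℂ) ((x : ℂ) + Complex.I * ξ) = x - Complex.I * ξ := by
      simp [sub_eq_add_neg]
    rw [this]
    ring

/-- one-dimensional integrand -/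
def Fn (n : ℕ) (X Ξ w : ℝ) : ℂ :=
  ((hermiteFun n (X + w / 2) * hermiteFun n (X - w / 2) : ℝ) : ℂ) *
    Complex.exp (-Complex.I * Ξ * w)

lemma Fn_eq (n : ℕ) (X Ξ w : ℝ) :
    Fn n X Ξ w = ((((2 : ℝ) ^ n * (n.factorial : ℝ) * Real.sqrt π)⁻¹ * Real.exp (-X ^ 2) : ℝ) : ℂ) *
      ((aP X n * bP X n).eval (w : ℂ) * wt Ξ w) := by
  have ha : (aP X n).eval (w : ℂ) = (((physHermite n).eval (X + w / 2) : ℝ) : ℂ) := by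
    rw [aP, Polynomial.eval_comp]
    simp only [Polynomial.eval_add, Polynomial.eval_mul, Polynomial.eval_C, Polynomial.eval_X]
    rw [show (X : ℂ) + 1 / 2 * w = Complex.ofRealHom (X + w / 2) by simp; ring,
      Polynomial.eval_map_apply]
    simp
  have hb : (bP X n).eval (w : ℂ) = (((physHermite n).eval (X - w / 2) : ℝ) : ℂ) := by
    rw [bP, Polynomial.eval_comp]
    simp only [Polynomial.eval_add, Polynomial.eval_mul, Polynomial.eval_C, Polynomial.eval_X]
    rw [show (X : ℂ) + -(1 / 2) * w = Complex.ofRealHom (X - w / 2) by simp; ring,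
      Polynomial.eval_map_apply]
    simp
  have hc : ((2 : ℝ) ^ n * (n.factorial : ℝ) * Real.sqrt π)⁻¹ =
      ((2 : ℝ) ^ n * (n.factorial : ℝ) * Real.sqrt π) ^ (-(1 : ℝ) / 2) *
      ((2 : ℝ) ^ n * (n.factorial : ℝ) * Real.sqrt π) ^ (-(1 : ℝ) / 2) := by
    rw [← Real.rpow_add (by positivity), ← Real.rpow_neg_one]
    norm_num
  have hw : wt Ξ w = ((Real.exp (-(w ^ 2) / 4) : ℝ) : ℂ) * Complex.exp (-Complex.I * Ξ * w) := by
    rw [wt, Complex.ofReal_exp, ← Complex.exp_add]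
    congr 1
    push_cast
    ring
  have he : Real.exp (-(X + w / 2) ^ 2 / 2) * Real.exp (-(X - w / 2) ^ 2 / 2) =
      Real.exp (-X ^ 2) * Real.exp (-(w ^ 2) / 4) := by
    rw [← Real.exp_add, ← Real.exp_add]
    congr 1
    ring
  have he' := congrArg (fun t : ℝ => (t : ℂ)) he
  simp only [Complex.ofReal_mul] at he'
  rw [Polynomial.eval_mul, ha, hb, hw, Fn, hermiteFun, hermiteFun, hc]
  generalize ((2 : ℝ) ^ n * (n.factorial : ℝ) * Real.sqrt π) ^ (-(1 : ℝ) / 2) = c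
  simp only [Complex.ofReal_mul]
  linear_combination (c : ℂ) * c * (((physHermite n).eval (X + w / 2) : ℝ) : ℂ) *
    (((physHermite n).eval (X - w / 2) : ℝ) : ℂ) * Complex.exp (-Complex.I * Ξ * w) * he'

lemma Fn_integrable (n : ℕ) (X Ξ : ℝ) : Integrable (Fn n X Ξ) := by
  have : Fn n X Ξ = fun w : ℝ => ((((2 : ℝ) ^ n * (n.factorial : ℝ) * Real.sqrt π)⁻¹ * Real.exp (-X ^ 2) : ℝ) : ℂ) *
      ((aP X n * bP X n).eval (w : ℂ) * wt Ξ w) := funext (Fn_eq n X Ξ)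
  rw [this]
  exact (integrable_wt Ξ _).const_mul _

lemma Fn_bound (n : ℕ) (X Ξ : ℝ) (q : ℝ) (hq : 0 < q) (hq1 : q ≤ 1) :
    ‖∫ w, Fn n X Ξ w‖ ≤ 2 * Real.exp ((1 - q) * (n / q - (X ^ 2 + Ξ ^ 2) / 2)) := by
  have h1 : ∫ w, Fn n X Ξ w = ((((2 : ℝ) ^ n * (n.factorial : ℝ) * Real.sqrt π)⁻¹ * Real.exp (-X ^ 2) : ℝ) : ℂ) *
      Jf Ξ (aP X n * bP X n) := by
    simp_rw [Fn_eq]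
    rw [integral_const_mul, Jf]
  have hz : ‖(X : ℂ) + Complex.I * Ξ‖ ^ 2 = X ^ 2 + Ξ ^ 2 := by
    rw [← Complex.normSq_eq_norm_sq, mul_comm, Complex.normSq_add_mul_I]
  have hB := Bmn_bound n ((X : ℂ) + Complex.I * Ξ) q hq hq1
  rw [hz] at hB
  have hJ : ‖Jf Ξ 1‖ = 2 * Real.sqrt π * Real.exp (-Ξ ^ 2) := by
    rw [Jf_one, norm_mul, norm_mul, Complex.norm_exp]
    congr 2
    · simp
    · simp [abs_of_nonneg (Real.sqrt_nonneg π)]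
    · rw [show (-(Ξ : ℂ) ^ 2) = ((-Ξ ^ 2 : ℝ) : ℂ) by push_cast; ring, Complex.ofReal_re]
  rw [h1, J_eq, norm_mul, norm_mul, hJ, Complex.norm_real, Real.norm_of_nonneg (by positivity)]
  have hs : 0 < Real.sqrt π := by positivity
  calc _ ≤ ((2 : ℝ) ^ n * (n.factorial : ℝ) * Real.sqrt π)⁻¹ * Real.exp (-X ^ 2) *
        ((2 ^ n * (n.factorial * (Real.exp (X ^ 2 + Ξ ^ 2) *
          Real.exp ((1 - q) * (n / q - (X ^ 2 + Ξ ^ 2) / 2))))) *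
        (2 * Real.sqrt π * Real.exp (-Ξ ^ 2))) := by gcongr
    _ = 2 * Real.exp ((1 - q) * (n / q - (X ^ 2 + Ξ ^ 2) / 2)) := by
      rw [Real.exp_add, Real.exp_neg, Real.exp_neg]
      have := (Real.exp_pos (X ^ 2)).ne'
      have := (Real.exp_pos (Ξ ^ 2)).ne'
      field_simp

lemma card_aux (d N : ℕ) : ((Finset.Nat.antidiagonalTuple d N).card : ℝ) ≤ ((N : ℝ) + 1) ^ d := by
  have : (Finset.Nat.antidiagonalTuple d N) ⊆
      Fintype.piFinset (fun _ : Fin d => Finset.range (N + 1)) := by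
    intro α hα
    rw [Finset.Nat.mem_antidiagonalTuple] at hα
    simp only [Fintype.mem_piFinset, Finset.mem_range]
    intro j
    have := Finset.single_le_sum (f := α) (fun i _ => Nat.zero_le _) (Finset.mem_univ j)
    omega
  have h := Finset.card_le_card this
  simp at h
  exact_mod_cast h

lemma wigner_bound (d : ℕ) (hb : ℝ) (hhb : 0 < hb) (N : ℕ) (x ξ : Fin d → ℝ)
    (q : ℝ) (hq : 0 < q) (hq1 : q ≤ 1) :
    ‖wigner d hb N x ξ‖ ≤ ((π * hb) ^ d)⁻¹ * ((N : ℝ) + 1) ^ d *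
      Real.exp ((1 - q) * (N / q - Hfun x ξ / hb)) := by
  set s : ℝ := hb ^ (-(1 : ℝ) / 2) with hs
  have hs0 : 0 < s := by positivity
  have hs2 : s * s = hb⁻¹ := by
    rw [hs, ← Real.rpow_add hhb, ← Real.rpow_neg_one]; norm_num
  have hK : hb ^ (-(d : ℝ) / 4) * hb ^ (-(d : ℝ) / 4) = s ^ d := by
    rw [hs, ← Real.rpow_add hhb, ← Real.rpow_natCast, ← Real.rpow_mul hhb.le]
    congr 1
    ring
  have hint : ∀ v : Fin d → ℝ,
      ((projKer d hb N (fun j => x j + v j / 2) (fun j => x j - v j / 2) : ℝ) : ℂ) *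
        Complex.exp (-Complex.I * (dotR v ξ : ℂ) / (hb : ℂ)) =
      ∑ α ∈ Finset.Nat.antidiagonalTuple d N,
        ((s ^ d : ℝ) : ℂ) * ∏ j, Fn (α j) (s * x j) (s * ξ j) (s * v j) := by
    intro v
    have hexp : Complex.exp (-Complex.I * (dotR v ξ : ℂ) / (hb : ℂ)) =
        ∏ j, Complex.exp (-Complex.I * ((s * ξ j : ℝ) : ℂ) * ((s * v j : ℝ) : ℂ)) := by
      rw [← Complex.exp_sum]
      congr 1
      have h1 : (s : ℂ) * s = (hb : ℂ)⁻¹ := by exact_mod_cast hs2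
      rw [dotR, div_eq_mul_inv, ← h1]
      push_cast
      rw [Finset.mul_sum, Finset.sum_mul]
      refine Finset.sum_congr rfl fun j _ => ?_
      ring
    rw [projKer, Complex.ofReal_sum, Finset.sum_mul]
    refine Finset.sum_congr rfl fun α _ => ?_
    simp only [Fn, Finset.prod_mul_distrib]
    rw [hexp, ← hK]
    simp only [hermiteProdH, hermiteProd, ← hs]
    have e1 : ∀ j, s * (x j + v j / 2) = s * x j + s * v j / 2 := fun j => by ring
    have e2 : ∀ j, s * (x j - v j / 2) = s * x j - s * v j / 2 := fun j => by ring
    simp only [e1, e2]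
    push_cast
    rw [Finset.prod_mul_distrib]
    ring
  have hFi : ∀ (n : ℕ) (a b : ℝ), Integrable (fun w => Fn n a b (s * w)) := fun n a b =>
    (Fn_integrable n a b).comp_mul_left' hs0.ne'
  have hFint : ∀ (n : ℕ) (a b : ℝ), ∫ w, Fn n a b (s * w) = (s⁻¹ : ℂ) * ∫ w, Fn n a b w := by
    intro n a b
    rw [Measure.integral_comp_mul_left, abs_of_pos (by positivity), Complex.real_smul]
    push_cast
    rfl
  have hW : wigner d hb N x ξ = ((((2 * π * hb) ^ d)⁻¹ : ℝ) : ℂ) *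
      ∑ α ∈ Finset.Nat.antidiagonalTuple d N, ∏ j, ∫ w, Fn (α j) (s * x j) (s * ξ j) w := by
    rw [wigner]
    congr 1
    simp_rw [hint]
    rw [integral_finsetSum]
    · refine Finset.sum_congr rfl fun α _ => ?_
      rw [integral_const_mul,
        integral_fintype_prod_volume_eq_prod (fun j w => Fn (α j) (s * x j) (s * ξ j) (s * w))]
      simp_rw [hFint]
      rw [Finset.prod_mul_distrib, Finset.prod_const, Finset.card_univ, Fintype.card_fin,
        ← mul_assoc]
      have : (s : ℂ) ≠ 0 := by exact_mod_cast hs0.ne'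
      rw [Complex.ofReal_pow, ← mul_pow, mul_inv_cancel₀ this, one_pow, one_mul]
    · intro α _
      refine Integrable.const_mul ?_ _
      exact Integrable.fintype_prod_dep
        (f := fun j w => Fn (α j) (s * x j) (s * ξ j) (s * w)) (fun j => hFi _ _ _)
  have hsum : ‖∑ α ∈ Finset.Nat.antidiagonalTuple d N,
      ∏ j, ∫ w, Fn (α j) (s * x j) (s * ξ j) w‖ ≤
      ((N : ℝ) + 1) ^ d * (2 ^ d * Real.exp ((1 - q) * (N / q - Hfun x ξ / hb))) := by
    refine (norm_sum_le_of_le (n := fun _ => 2 ^ d * Real.exp ((1 - q) * (N / q - Hfun x ξ / hb)))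
      _ fun α hα => ?_).trans ?_
    · rw [Finset.Nat.mem_antidiagonalTuple] at hα
      rw [norm_prod]
      refine (Finset.prod_le_prod (fun _ _ => norm_nonneg _)
        (fun j _ => Fn_bound (α j) (s * x j) (s * ξ j) q hq hq1)).trans (le_of_eq ?_)
      rw [Finset.prod_mul_distrib, Finset.prod_const, Finset.card_univ, Fintype.card_fin,
        ← Real.exp_sum]
      congr 2
      rw [← Finset.mul_sum, Finset.sum_sub_distrib, ← Finset.sum_div, ← Finset.sum_div]
      congr 2
      · rw [← hα]; push_cast; rfl
      · rw [Hfun, div_eq_mul_inv _ hb, ← hs2, ← Finset.sum_add_distrib, Finset.sum_div,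
          Finset.sum_div, Finset.sum_mul]
        refine Finset.sum_congr rfl fun j _ => ?_
        ring
    · rw [Finset.sum_const, nsmul_eq_mul]
      gcongr
      exact card_aux d N
  rw [hW, norm_mul, Complex.norm_real, Real.norm_of_nonneg (by positivity)]
  calc _ ≤ ((2 * π * hb) ^ d)⁻¹ *
      (((N : ℝ) + 1) ^ d * (2 ^ d * Real.exp ((1 - q) * (N / q - Hfun x ξ / hb)))) := by gcongr
    _ = _ := by
      rw [mul_assoc 2 π hb, mul_pow 2 (π * hb)]
      have : (π * hb) ^ d ≠ 0 := by positivity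
      field_simp

lemma case1 (κ d : ℕ) (hb n1 L c : ℝ) (hhb : 0 < hb) (hn1 : 0 < n1) (hc : 0 < c)
    (hL : n1 ≤ L / hb) :
    (hb ^ d)⁻¹ * n1 ^ d * Real.exp (-(c / hb)) ≤
      (L ^ (d + 2) * ((κ + d + (d + 2)).factorial : ℝ) / c ^ (κ + d + (d + 2))) * hb ^ κ *
        (1 / n1 ^ 2) := by
  set K := κ + d + (d + 2) with hK
  have hLp : 0 < L := by
    have := hn1.trans_le hL
    by_contra h
    have := div_nonpos_of_nonpos_of_nonneg (not_lt.1 h) hhb.le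
    linarith
  have he : Real.exp (-(c / hb)) ≤ K.factorial * hb ^ K / c ^ K := by
    have h := Real.pow_div_factorial_le_exp (x := c / hb) (by positivity) K
    rw [Real.exp_neg]
    have h2 : ((K.factorial : ℝ) * hb ^ K / c ^ K) = ((c / hb) ^ K / K.factorial)⁻¹ := by
      rw [div_pow]; field_simp
    rw [h2]
    exact inv_anti₀ (by positivity) h
  have h3 : n1 ^ (d + 2) ≤ (L / hb) ^ (d + 2) := by gcongr
  rw [mul_one_div, le_div_iff₀ (by positivity)]
  calc (hb ^ d)⁻¹ * n1 ^ d * Real.exp (-(c / hb)) * n1 ^ 2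
      = (hb ^ d)⁻¹ * n1 ^ (d + 2) * Real.exp (-(c / hb)) := by ring
    _ ≤ (hb ^ d)⁻¹ * (L / hb) ^ (d + 2) * (K.factorial * hb ^ K / c ^ K) := by gcongr
    _ = _ := by
      have : hb ^ K = hb ^ κ * hb ^ d * hb ^ (d + 2) := by rw [hK, pow_add, pow_add]
      rw [this, div_pow]
      field_simp

lemma case2 (κ d : ℕ) (hb n1 M E' δ F C : ℝ) (hhb : 0 < hb) (hn1 : 0 < n1) (hδ : 0 < δ)
    (hE' : 0 < E') (hM : E' ≤ hb * M) (hn : n1 ≤ 2 * M) (hC : 0 < C)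
    (hF : (δ * M) ^ (κ + d + (d + 2)) * F ≤ C) :
    F * ((hb ^ d)⁻¹ * n1 ^ d) ≤
      (C * 2 ^ (d + 2) / (δ ^ (κ + d + (d + 2)) * E' ^ (κ + d))) * hb ^ κ * (1 / n1 ^ 2) := by
  set K := κ + d + (d + 2) with hK
  have hMp : 0 < M := by linarith
  have h1 : F ≤ C / (δ * M) ^ K := by
    rw [le_div_iff₀ (by positivity)]; linarith
  have h3 : n1 ^ (d + 2) ≤ (2 * M) ^ (d + 2) := by gcongr
  have h4 : (M ^ (κ + d))⁻¹ ≤ (hb / E') ^ (κ + d) := by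
    rw [← inv_pow]
    gcongr
    rw [le_div_iff₀ hE', inv_mul_le_iff₀ hMp]
    linarith
  rw [mul_one_div, le_div_iff₀ (by positivity)]
  calc F * ((hb ^ d)⁻¹ * n1 ^ d) * n1 ^ 2
      = F * ((hb ^ d)⁻¹ * n1 ^ (d + 2)) := by ring
    _ ≤ C / (δ * M) ^ K * ((hb ^ d)⁻¹ * (2 * M) ^ (d + 2)) := by gcongr
    _ = C * 2 ^ (d + 2) / δ ^ K * (hb ^ d)⁻¹ * (M ^ (κ + d))⁻¹ := by
      have : M ^ K = M ^ (κ + d) * M ^ (d + 2) := by rw [hK, pow_add]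
      rw [mul_pow, mul_pow, this]
      field_simp
    _ ≤ C * 2 ^ (d + 2) / δ ^ K * (hb ^ d)⁻¹ * (hb / E') ^ (κ + d) := by gcongr
    _ = _ := by
      rw [div_pow, pow_add hb]
      field_simp

/-- In the forbidden region `H(x,ξ) > E`, the `ħ`-localized Wigner–Weyl sum with an even
Schwartz weight is `O(ħ^∞)`. -/
theorem wigner_locH_forbidden_decay (d : ℕ) (hd : 1 ≤ d) (E : ℝ) (hE : 0 < E)
    (f : SchwartzMap ℝ ℝ) (hfeven : ∀ t : ℝ, f (-t) = f t)
    (x ξ : Fin d → ℝ) (hH : E < Hfun x ξ) :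
    ∀ κ : ℕ, ∃ C : ℝ, 0 < C ∧ ∃ hb₀ : ℝ, 0 < hb₀ ∧ ∀ hb : ℝ, 0 < hb → hb ≤ hb₀ →
      ‖wignerLocH d hb E (fun t => f t) x ξ‖ ≤ C * hb ^ κ := by
  intro κ
  set H := Hfun x ξ with hHdef
  set E' := (E + H) / 2 with hE'
  have hEE' : E < E' := by rw [hE']; linarith
  have hE'H : E' < H := by rw [hE']; linarith
  have hE'0 : 0 < E' := by linarith
  have hH0 : 0 < H := by linarith
  set q := (E' + H) / (2 * H) with hqdef
  have hq : 0 < q := by positivity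
  have hq1 : q < 1 := by rw [hqdef, div_lt_one (by positivity)]; linarith
  have hqH : E' / q < H := by
    rw [div_lt_iff₀ hq, hqdef]
    have : H * ((E' + H) / (2 * H)) = (E' + H) / 2 := by field_simp
    rw [this]; linarith
  set c := (1 - q) * (H - E' / q) with hc
  have hc0 : 0 < c := mul_pos (by linarith) (by linarith)
  set δ := 1 - E / E' with hδ
  have hδ0 : 0 < δ := by
    have : E / E' < 1 := by rw [div_lt_one hE'0]; exact hEE'
    rw [hδ]; linarith
  set K := κ + d + (d + 2) with hK
  obtain ⟨C0, hC0, hf0⟩ := f.decay 0 0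
  obtain ⟨CK, hCK, hfK⟩ := f.decay K 0
  simp only [pow_zero, one_mul, norm_iteratedFDeriv_zero] at hf0
  simp only [norm_iteratedFDeriv_zero] at hfK
  set A1 := C0 * ((E' + 1) ^ (d + 2) * (K.factorial : ℝ) / c ^ K) with hA1
  set A2 := CK * 2 ^ (d + 2) / (δ ^ K * E' ^ (κ + d)) with hA2
  have hA1p : 0 < A1 := by positivity
  have hA2p : 0 < A2 := by positivity
  have hsumm : Summable (fun N : ℕ => 1 / ((N : ℝ) + 1) ^ 2) := by
    have h := (summable_nat_add_iff 1).2 (Real.summable_one_div_nat_pow.2 (one_lt_two))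
    simpa using h
  set S := ∑' N : ℕ, 1 / ((N : ℝ) + 1) ^ 2 with hS
  have hSp : 0 ≤ S := tsum_nonneg fun N => by positivity
  refine ⟨(A1 + A2) * (S + 1), by positivity, 1, one_pos, fun hb hhb hb1 => ?_⟩
  have key : ∀ N : ℕ,
      ‖((f (hb⁻¹ * (E - hb * ((N : ℝ) + (d : ℝ) / 2))) : ℝ) : ℂ) * wigner d hb N x ξ‖ ≤
        (A1 + A2) * hb ^ κ * (1 / ((N : ℝ) + 1) ^ 2) := by
    intro N
    set M : ℝ := (N : ℝ) + (d : ℝ) / 2 with hM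
    have hd' : (1 : ℝ) ≤ d := by exact_mod_cast hd
    have hN0 : (0 : ℝ) ≤ N := by positivity
    have hM0 : 0 < M := by rw [hM]; linarith
    have hpi : ((π * hb) ^ d)⁻¹ ≤ (hb ^ d)⁻¹ := by
      apply inv_anti₀ (by positivity)
      gcongr
      nlinarith [Real.pi_gt_three]
    rw [norm_mul, Complex.norm_real]
    rcases le_or_gt (hb * M) E' with h | h
    · have hw := wigner_bound d hb hhb N x ξ q hq hq1.le
      have hNE : (N : ℝ) ≤ E' / hb := by
        rw [le_div_iff₀ hhb]
        nlinarith
      have hexp : (1 - q) * (N / q - Hfun x ξ / hb) ≤ -(c / hb) := by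
        rw [← hHdef]
        have e : -(c / hb) = (1 - q) * (E' / hb / q - H / hb) := by
          rw [hc]; field_simp; ring
        rw [e]
        have : 0 ≤ 1 - q := by linarith
        gcongr
      have hL : (N : ℝ) + 1 ≤ (E' + 1) / hb := by
        rw [add_div]
        have : 1 ≤ 1 / hb := by rw [le_div_iff₀ hhb]; linarith
        linarith
      have h1 := case1 κ d hb ((N : ℝ) + 1) (E' + 1) c hhb (by positivity) hc0 hL
      rw [← hK] at h1
      calc _ ≤ C0 * ((hb ^ d)⁻¹ * ((N : ℝ) + 1) ^ d * Real.exp (-(c / hb))) := by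
            refine mul_le_mul (hf0 _) (hw.trans ?_) (norm_nonneg _) hC0.le
            gcongr
        _ ≤ C0 * (((E' + 1) ^ (d + 2) * (K.factorial : ℝ) / c ^ K) * hb ^ κ *
            (1 / ((N : ℝ) + 1) ^ 2)) := by gcongr
        _ = A1 * hb ^ κ * (1 / ((N : ℝ) + 1) ^ 2) := by rw [hA1]; ring
        _ ≤ _ := by gcongr; linarith
    · have hw := wigner_bound d hb hhb N x ξ 1 one_pos le_rfl
      simp only [sub_self, zero_mul, Real.exp_zero, mul_one] at hw
      have hs : δ * M ≤ ‖hb⁻¹ * (E - hb * M)‖ := by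
        rw [Real.norm_eq_abs]
        refine le_trans ?_ (neg_le_abs _)
        have e : -(hb⁻¹ * (E - hb * M)) = M - E / hb := by field_simp; ring
        rw [e, hδ]
        have : E / hb ≤ E / E' * M := by
          rw [div_mul_eq_mul_div, div_le_div_iff₀ hhb hE'0]
          nlinarith
        linarith
      have hF : (δ * M) ^ K * ‖f (hb⁻¹ * (E - hb * M))‖ ≤ CK := by
        refine le_trans ?_ (hfK (hb⁻¹ * (E - hb * M)))
        gcongr
      have h2 := case2 κ d hb ((N : ℝ) + 1) M E' δ _ CK hhb (by positivity) hδ0 hE'0 h.le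
        (by rw [hM]; linarith) hCK hF
      rw [← hK] at h2
      calc _ ≤ ‖f (hb⁻¹ * (E - hb * M))‖ * ((hb ^ d)⁻¹ * ((N : ℝ) + 1) ^ d) := by
            gcongr
            exact hw.trans (by gcongr)
        _ ≤ A2 * hb ^ κ * (1 / ((N : ℝ) + 1) ^ 2) := h2
        _ ≤ _ := by gcongr; linarith
  have hfin := tsum_of_norm_bounded (hsumm.hasSum.mul_left ((A1 + A2) * hb ^ κ)) key
  rw [wignerLocH]
  refine hfin.trans ?_
  rw [← hS]
  have : 0 < (A1 + A2) * hb ^ κ := by positivity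
  nlinarith
end
end

section
/- Fix d ≥ 1, 0 < E₁ < E₂, and a point (x,ξ) ∈ ℝ^{2d}, and define the bulk Wigner–Weyl sum W_{ħ,[E₁,E₂]}(x,ξ) = Σ_{N : E₁ ≤ ħ(N+d/2) ≤ E₂} W_{ħ,N}(x,ξ). Then: (i) if E₁ < H(x,ξ) < E₂, there exist C, ħ₀ > 0 with |W_{ħ,[E₁,E₂]}(x,ξ) − (2πħ)^{−d}| ≤ C ħ^{−d+1/2} for all 0 < ħ ≤ ħ₀; (ii) if 0 < H(x,ξ) < E₁, there exist C, ħ₀ > 0 with |W_{ħ,[E₁,E₂]}(x,ξ)| ≤ C ħ^{−d+1/2} for all 0 < ħ ≤ ħ₀; (iii) if H(x,ξ) > E₂, then for every κ ∈ ℕ there exist C_κ, ħ₀ > 0 with |W_{ħ,[E₁,E₂]}(x,ξ)| ≤ C_κ ħ^κ for all 0 < ħ ≤ ħ₀. -/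
open MeasureTheory Real Filter
open scoped BigOperators ENNReal

noncomputable section

/-- The bulk Wigner–Weyl sum `W_{ħ,[E₁,E₂]}(x,ξ) = Σ_{E₁ ≤ ħ(N+d/2) ≤ E₂} W_{ħ,N}(x,ξ)`. -/
def wignerBulk (d : ℕ) (hb E₁ E₂ : ℝ) (x ξ : Fin d → ℝ) : ℂ :=
  ∑' N : ℕ,
    if E₁ ≤ hb * ((N : ℝ) + (d : ℝ) / 2) ∧ hb * ((N : ℝ) + (d : ℝ) / 2) ≤ E₂ then
      wigner d hb N x ξ else 0

def lag (n : ℕ) (x : ℝ) : ℝ :=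
  ∑ j ∈ Finset.range (n + 1), (n.choose j : ℝ) * ((-x) ^ j / (j.factorial : ℝ))

theorem lag_zero_left (x : ℝ) : lag 0 x = 1 := by simp [lag]

theorem lag_at_zero (n : ℕ) : lag n 0 = 1 := by
  unfold lag
  rw [Finset.sum_range_succ']
  simp

theorem lag_succ (n : ℕ) (x : ℝ) : lag (n + 1) x = lag n x +
    ∑ j ∈ Finset.range (n + 1), (n.choose j : ℝ) * ((-x) ^ (j + 1) / ((j + 1).factorial : ℝ)) := by
  unfold lag
  rw [Finset.sum_range_succ' _ (n + 1)]
  have h : ∑ j ∈ Finset.range (n + 1), ((n.choose (j + 1) : ℕ) : ℝ) * ((-x) ^ (j + 1) / ((j + 1).factorial : ℝ))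
      = ∑ j ∈ Finset.range n, ((n.choose (j + 1) : ℕ) : ℝ) * ((-x) ^ (j + 1) / ((j + 1).factorial : ℝ)) := by
    rw [Finset.sum_range_succ]; simp
  rw [Finset.sum_range_succ' (fun j => (n.choose j : ℝ) * ((-x) ^ j / (j.factorial : ℝ))) n, ← h]
  simp only [Nat.choose_succ_succ, Nat.cast_add, add_mul, Finset.sum_add_distrib]
  simp
  ring

theorem hasDerivAt_lag_aux (n : ℕ) (x : ℝ) :
    HasDerivAt (fun x => ∑ j ∈ Finset.range (n + 1),
      (n.choose j : ℝ) * ((-x) ^ (j + 1) / ((j + 1).factorial : ℝ))) (-lag n x) x := by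
  unfold lag
  rw [← Finset.sum_neg_distrib]
  apply HasDerivAt.fun_sum
  intro j _
  have h := ((((hasDerivAt_id x).neg).pow (j + 1)).div_const ((j + 1).factorial : ℝ)).const_mul (n.choose j : ℝ)
  refine h.congr_deriv ?_
  have : (j.factorial : ℝ) ≠ 0 := by positivity
  simp [Nat.factorial_succ]
  field_simp

/-- partial sums -/
def slag (n : ℕ) (x : ℝ) : ℝ := ∑ m ∈ Finset.range n, lag m x

theorem hasDerivAt_lag (n : ℕ) (x : ℝ) : HasDerivAt (lag n) (-slag n x) x := by
  induction n with
  | zero =>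
    have : lag 0 = fun _ => 1 := by ext x; simp [lag]
    rw [this]; simpa [slag] using hasDerivAt_const x (1:ℝ)
  | succ n ih =>
    have h := ih.add (hasDerivAt_lag_aux n x)
    have e : lag (n + 1) = lag n + fun x => ∑ j ∈ Finset.range (n + 1),
      (n.choose j : ℝ) * ((-x) ^ (j + 1) / ((j + 1).factorial : ℝ)) := by
      ext x; exact lag_succ n x
    rw [e]
    refine h.congr_deriv ?_
    unfold slag
    rw [Finset.sum_range_succ]; ring

theorem slag_eq (n : ℕ) (x : ℝ) : slag n x = ∑ j ∈ Finset.range n,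
    (n.choose (j + 1) : ℝ) * ((-x) ^ j / (j.factorial : ℝ)) := by
  induction n with
  | zero => simp [slag]
  | succ n ih =>
    have : slag (n + 1) x = slag n x + lag n x := by simp [slag, Finset.sum_range_succ]
    rw [this, ih, lag]
    simp only [Nat.choose_succ_succ, Nat.cast_add, add_mul, Finset.sum_add_distrib]
    rw [add_comm]
    congr 1
    rw [Finset.sum_range_succ _ n]; simp

theorem mul_slag (n : ℕ) (x : ℝ) :
    x * slag (n + 1) x = (n + 1) * (lag n x - lag (n + 1) x) := by
  rw [slag_eq, lag_succ, Finset.mul_sum]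
  rw [sub_add_cancel_left, mul_neg, Finset.mul_sum, ← Finset.sum_neg_distrib]
  apply Finset.sum_congr rfl
  intro j _
  have h : ((n:ℝ) + 1) * (n.choose j : ℝ) = ((n+1).choose (j+1) : ℝ) * (j + 1) := by
    exact_mod_cast Nat.add_one_mul_choose_eq n j
  have : (j.factorial : ℝ) ≠ 0 := by positivity
  rw [← mul_assoc ((n:ℝ)+1), h]
  simp only [Nat.factorial_succ]
  push_cast
  field_simp
  ring

/-- generalized Laguerre -/
def Lag : ℕ → ℕ → ℝ → ℝ
  | 0, n, x => lag n x
  | k + 1, n, x => ∑ m ∈ Finset.range (n + 1), Lag k m x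

theorem Lag_succ_succ (k n : ℕ) (x : ℝ) : Lag (k+1) (n+1) x = Lag (k+1) n x + Lag k (n+1) x := by
  simp only [Lag]; rw [Finset.sum_range_succ _ (n+1)]

theorem mul_Lag (k n : ℕ) (x : ℝ) :
    x * Lag (k+1) n x = (n + k + 1) * Lag k n x - (n + 1) * Lag k (n+1) x := by
  induction k generalizing n with
  | zero => 
    have := mul_slag n x
    simp only [Lag]; simp only [slag] at this; rw [this]; push_cast; ring
  | succ k ih =>
    have h : ∀ n : ℕ, x * Lag (k+2) n x = (k+1) * Lag (k+1) n x - (n+1) * Lag k (n+1) x := by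
      intro n
      induction n with
      | zero => 
        have h1 := ih 0
        have e1 : Lag (k+2) 0 x = Lag (k+1) 0 x := by simp [Lag]
        have e2 : Lag (k+1) 0 x = Lag k 0 x := by simp [Lag]
        rw [e1, h1, e2]; push_cast; ring
      | succ n ihn =>
        rw [Lag_succ_succ, mul_add, ihn, ih, Lag_succ_succ k n]; push_cast; ring
    rw [h, Lag_succ_succ k n]; push_cast; ring

/-- Laguerre functions -/
def lf (n : ℕ) (x : ℝ) : ℝ := exp (-x/2) * lag n x

def lg : ℕ → ℝ → ℝ
  | 0, x => lf 0 x
  | n+1, x => lf (n+1) x - lf n x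

theorem hasDerivAt_e (x : ℝ) : HasDerivAt (fun x => exp (-x/2)) (-(1/2) * exp (-x/2)) x := by
  have h := (((hasDerivAt_id x).neg).div_const 2).exp
  refine h.congr_deriv ?_
  simp; ring

theorem hasDerivAt_lf (n : ℕ) (x : ℝ) :
    HasDerivAt (lf n) (exp (-x/2) * (-slag n x - lag n x / 2)) x := by
  refine ((hasDerivAt_e x).mul (hasDerivAt_lag n x)).congr_deriv ?_
  ring

theorem hasDerivAt_lg_succ (n : ℕ) (x : ℝ) :
    HasDerivAt (lg (n+1)) (-(1/2) * (lf (n+1) x + lf n x)) x := by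
  refine ((hasDerivAt_lf (n+1) x).sub (hasDerivAt_lf n x)).congr_deriv ?_
  simp only [slag, Finset.sum_range_succ, lf]; ring

theorem hasDerivAt_lg_zero (x : ℝ) :
    HasDerivAt (lg 0) (-(1/2) * lf 0 x) x := by
  refine ((hasDerivAt_lf 0 x)).congr_deriv ?_
  simp [slag, lf]; ring

theorem mono_aux {F F' : ℝ → ℝ} {X : ℝ} (hX : 0 ≤ X)
    (h : ∀ x, 0 ≤ x → x ≤ X → HasDerivAt F (F' x) x)
    (h' : ∀ x, 0 ≤ x → x ≤ X → 0 ≤ F' x) : F 0 ≤ F X := by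
  have : MonotoneOn F (Set.Icc 0 X) := by
    apply monotoneOn_of_deriv_nonneg (convex_Icc 0 X)
    · intro x hx; exact (h x hx.1 hx.2).continuousAt.continuousWithinAt
    · intro x hx; rw [interior_Icc] at hx
      exact (h x hx.1.le hx.2.le).differentiableAt.differentiableWithinAt
    · intro x hx; rw [interior_Icc] at hx
      rw [(h x hx.1.le hx.2.le).deriv]; exact h' x hx.1.le hx.2.le
  exact this ⟨le_rfl, hX⟩ ⟨hX, le_rfl⟩ hX

theorem lf_at_zero (n : ℕ) : lf n 0 = 1 := by simp [lf, lag_at_zero]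

/-- `I_n(x) = ∫_0^x f_n^2`. -/
def lI (n : ℕ) (x : ℝ) : ℝ := 1 - ∑ m ∈ Finset.range (n+1), lg m x ^ 2

theorem lI_le (n : ℕ) (x : ℝ) : lI n x ≤ 1 := by
  unfold lI
  have : 0 ≤ ∑ m ∈ Finset.range (n+1), lg m x ^ 2 := Finset.sum_nonneg fun i _ => sq_nonneg _
  linarith

theorem lI_zero (n : ℕ) : lI n 0 = 0 := by
  unfold lI
  rw [Finset.sum_range_succ']
  simp [lg, lf_at_zero]

theorem hasDerivAt_lI (n : ℕ) (x : ℝ) : HasDerivAt (lI n) (lf n x ^ 2) x := by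
  induction n with
  | zero =>
    have e : lI 0 = fun x => 1 - lg 0 x ^ 2 := by ext x; simp [lI]
    rw [e]
    refine (((hasDerivAt_lg_zero x).pow 2).const_sub 1).congr_deriv ?_
    simp [lg]; ring
  | succ n ih =>
    have e : lI (n+1) = fun x => lI n x - lg (n+1) x ^ 2 := by
      ext x; simp only [lI]; rw [Finset.sum_range_succ _ (n+1)]; ring
    rw [e]
    refine (ih.sub ((hasDerivAt_lg_succ n x).pow 2)).congr_deriv ?_
    simp [lg]; ring

/-- `p = x f'` for `f = f_{n+1}`. -/
def lpf (n : ℕ) (x : ℝ) : ℝ :=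
  exp (-x/2) * ((n+1) * (lag (n+1) x - lag n x) - x/2 * lag (n+1) x)

theorem lp_eq (n : ℕ) (x : ℝ) :
    x * (exp (-x/2) * (-slag (n+1) x - lag (n+1) x / 2)) = lpf n x := by
  have := mul_slag n x
  unfold lpf
  linear_combination (-exp (-x/2)) * this

theorem lp_zero (n : ℕ) : lpf n 0 = 0 := by simp [lpf, lag_at_zero]

theorem hasDerivAt_lp (n : ℕ) (x : ℝ) :
    HasDerivAt (lpf n) (-(n + 3/2 - x/4) * lf (n+1) x) x := by
  have h := (hasDerivAt_e x).mul ((((hasDerivAt_lag (n+1) x).sub (hasDerivAt_lag n x)).const_mul ((n:ℝ)+1)).sub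
    (((hasDerivAt_id x).div_const 2).mul (hasDerivAt_lag (n+1) x)))
  refine h.congr_deriv ?_
  have := mul_slag n x
  have e : slag (n+1) x = slag n x + lag n x := by simp [slag, Finset.sum_range_succ]
  simp only [lf, id]
  simp
  rw [e] at this ⊢
  linear_combination (exp (-x/2)/2) * this

/-- energy bound -/
theorem energy (n : ℕ) (X : ℝ) (hX : 0 ≤ X) :
    X * (n + 3/2 - X/4) * lf (n+1) X ^ 2 + lpf n X ^ 2 ≤ n + 3/2 := by
  have h := mono_aux (F := fun x => (n + 3/2) * lI (n+1) x -
      (x * (n + 3/2 - x/4) * lf (n+1) x ^ 2 + lpf n x ^ 2))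
      (F' := fun x => x/2 * lf (n+1) x ^ 2) hX ?_ ?_
  · simp only [lI_zero, lp_zero] at h
    have := lI_le (n+1) X
    have h3 : (0:ℝ) ≤ n + 3/2 := by positivity
    nlinarith
  · intro x _ _
    have hq : HasDerivAt (fun x : ℝ => x * (n + 3/2 - x/4)) (n + 3/2 - x/2) x := by
      refine ((hasDerivAt_id x).mul (((hasDerivAt_id x).div_const 4).const_sub ((n:ℝ)+3/2))).congr_deriv ?_
      simp; ring
    refine (((hasDerivAt_lI (n+1) x).const_mul ((n:ℝ)+3/2)).sub
      ((hq.mul ((hasDerivAt_lf (n+1) x).pow 2)).add ((hasDerivAt_lp n x).pow 2))).congr_deriv ?_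
    have := lp_eq n x
    simp
    linear_combination (-2 * (n + 3/2 - x/4) * lf (n+1) x) * this
  · intro x h0 _; positivity

def lT (n : ℕ) (x : ℝ) : ℝ := 2 * ∑ m ∈ Finset.range n, (-1)^m * lf m x + (-1)^n * lf n x

theorem lT_zero (n : ℕ) : lT n 0 = 1 := by
  induction n with
  | zero => simp [lT, lf_at_zero]
  | succ n ih =>
    simp only [lT, lf_at_zero, Finset.sum_range_succ] at ih ⊢
    rw [pow_succ]; linarith

theorem hasDerivAt_lT (n : ℕ) (x : ℝ) : HasDerivAt (lT n) (-(1/2) * ((-1)^n * lf n x)) x := by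
  induction n with
  | zero =>
    have e : lT 0 = lf 0 := by ext x; simp [lT]
    rw [e]
    have h := hasDerivAt_lg_zero x
    have e2 : lg 0 = lf 0 := rfl
    rw [e2] at h
    simpa using h
  | succ n ih =>
    have e : lT (n+1) = fun x => lT n x - (-1)^n * lg (n+1) x := by
      ext x; simp only [lT, lg, Finset.sum_range_succ]; ring
    rw [e]
    refine (ih.sub ((hasDerivAt_lg_succ n x).const_mul ((-1)^n))).congr_deriv ?_
    ring

theorem lT_bound (n : ℕ) (X q : ℝ) (hX : 0 ≤ X) (hqe : q = n + 3/2 - X/4) (hq : 0 < q) :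
    |lT (n+1) X - 1| ≤ 1/2 * (|lpf n X| / q + X * |lf (n+1) X| / (4 * q^2)) +
      1/4 * (1/(4*q^2) + X/(8*q^3)) * (X + 1) := by
  set Q : ℝ → ℝ := fun x => n + 3/2 - x/4 with hQ
  have hQX : Q X = q := hqe.symm
  set ρ := 1/(4*q^2) + X/(8*q^3) with hρ
  set Y : ℝ → ℝ := fun x => lT (n+1) x - (-1)^(n+1) * (1/2) *
    (lpf n x / Q x - (x / (4 * Q x ^ 2)) * lf (n+1) x) with hY
  set r : ℝ → ℝ := fun x => 1/(4*Q x^2) + x/(8*Q x^3) with hr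
  have hQpos : ∀ x, x ≤ X → q ≤ Q x := by
    intro x hx; rw [hqe]; simp only [hQ]; linarith
  have hdY : ∀ x, 0 ≤ x → x ≤ X →
      HasDerivAt Y ((-1)^(n+1) * (1/2) * (lf (n+1) x * r x)) x := by
    intro x _ hx
    have hq0 : Q x ≠ 0 := (lt_of_lt_of_le hq (hQpos x hx)).ne'
    have hdQ : HasDerivAt Q (-(1/4)) x := by
      refine (((hasDerivAt_id x).div_const 4).const_sub ((n:ℝ)+3/2)).congr_deriv ?_
      simp
    have h1 := (hasDerivAt_lp n x).div hdQ hq0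
    have h2 := ((hasDerivAt_id x).div ((hdQ.pow 2).const_mul 4) (by simp [hq0])).mul (hasDerivAt_lf (n+1) x)
    refine ((hasDerivAt_lT (n+1) x).sub ((h1.sub h2).const_mul ((-1)^(n+1) * (1/2)))).congr_deriv ?_
    have h3 := lp_eq n x
    have h4 : (n + 3/2 - x/4 : ℝ) = Q x := rfl
    have h5 : (n:ℝ) = Q x - 3/2 + x/4 := by rw [← h4]; ring
    simp only [id, hr]
    rw [h4, ← h3]
    simp
    field_simp
    ring
  have hr_le : ∀ x, 0 ≤ x → x ≤ X → 0 ≤ r x ∧ r x ≤ ρ := by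
    intro x h0 hx
    have := hQpos x hx
    have h' : 0 < Q x := lt_of_lt_of_le hq this
    simp only [hr, hρ]
    constructor
    · positivity
    · gcongr
  have hf : ∀ x, |lf (n+1) x| ≤ (1 + lf (n+1) x ^2)/2 := by
    intro x
    have := sq_nonneg (|lf (n+1) x| - 1)
    rw [sub_sq, sq_abs] at this; linarith
  have habs : ∀ x, 0 ≤ x → x ≤ X → |(-1)^(n+1) * (1/2) * (lf (n+1) x * r x)| ≤
      1/4 * ρ * (1 + lf (n+1) x ^ 2) := by
    intro x h0 hx
    rw [abs_mul, abs_mul, abs_mul, abs_pow, abs_of_nonneg (hr_le x h0 hx).1]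
    simp
    have := mul_le_mul (hf x) (hr_le x h0 hx).2 (hr_le x h0 hx).1 (by positivity)
    linarith
  have hd2 : ∀ x, HasDerivAt (fun x => 1/4 * ρ * (x + lI (n+1) x)) (1/4 * ρ * (1 + lf (n+1) x ^ 2)) x :=
    fun x => ((hasDerivAt_id x).add (hasDerivAt_lI (n+1) x)).const_mul _
  have hY0 : Y 0 = 1 := by simp [hY, lT_zero, lp_zero]
  have m1 := mono_aux (F := fun x => 1/4 * ρ * (x + lI (n+1) x) + Y x) hX
    (fun x h0 hx => (hd2 x).add (hdY x h0 hx))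
    (fun x h0 hx => by have := abs_le.mp (habs x h0 hx); linarith [this.1])
  have m2 := mono_aux (F := fun x => 1/4 * ρ * (x + lI (n+1) x) - Y x) hX
    (fun x h0 hx => (hd2 x).sub (hdY x h0 hx))
    (fun x h0 hx => by have := abs_le.mp (habs x h0 hx); linarith [this.2])
  simp only [lI_zero, hY0] at m1 m2
  have hρ0 : 0 ≤ ρ := by positivity
  have hI := mul_le_mul_of_nonneg_left (lI_le (n+1) X) hρ0
  have hYX : |Y X - 1| ≤ 1/4 * ρ * (X + 1) := by
    rw [abs_le]; constructor <;> linarith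
  have e : lT (n+1) X - 1 = (Y X - 1) + (-1)^(n+1) * (1/2) *
    (lpf n X / q - (X / (4 * q ^ 2)) * lf (n+1) X) := by
    simp only [hY, hQX]; ring
  rw [e]
  have h6 : |(-1)^(n+1) * (1/2) * (lpf n X / q - (X / (4 * q ^ 2)) * lf (n+1) X)| ≤
      1/2 * (|lpf n X| / q + X * |lf (n+1) X| / (4 * q^2)) := by
    rw [abs_mul, abs_mul, abs_pow]
    simp
    refine (abs_sub _ _).trans ?_
    rw [abs_div, abs_mul, abs_div, abs_of_pos hq, abs_of_nonneg hX, abs_of_pos (by positivity : 0 < 4 * q^2)]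
    apply le_of_eq; ring
  refine (abs_add_le _ _).trans ?_
  linarith

/-- bulk bounds for the basic Laguerre functions -/
theorem bulk_base (a b : ℝ) (ha : 0 < a) (hb : b < 4) : ∃ C : ℝ, 0 ≤ C ∧ ∀ n : ℕ, 1 ≤ n →
    ∀ X : ℝ, a * n ≤ X → X ≤ b * n → |lf n X| ≤ C / √n ∧ |lT n X - 1| ≤ C / √n := by
  by_cases hb0 : b ≤ 0
  · refine ⟨0, le_rfl, fun n hn X h1 h2 => ?_⟩
    exfalso
    have : (1:ℝ) ≤ n := by exact_mod_cast hn
    nlinarith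
  push Not at hb0
  set δ := 1 - b/4 with hδ
  have hδ0 : 0 < δ := by rw [hδ]; linarith
  set Cf := √(2/(a*δ)) with hCf
  have hCf0 : 0 ≤ Cf := Real.sqrt_nonneg _
  set C2 := 1/2 * (2/δ + b * Cf/(4*δ^2)) + 1/4 * (1/(4*δ^2) + b/(8*δ^3)) * (b+1) with hC2
  have hC20 : 0 ≤ C2 := by positivity
  refine ⟨Cf + C2, by positivity, fun n hn X h1 h2 => ?_⟩
  obtain ⟨n, rfl⟩ : ∃ m, n = m + 1 := ⟨n - 1, by omega⟩
  set s := √((n+1 : ℕ) : ℝ) with hs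
  have hs2 : s^2 = n + 1 := by rw [hs, Real.sq_sqrt (by positivity)]; push_cast; ring
  have hs1 : 1 ≤ s := by rw [hs]; rw [Real.one_le_sqrt]; exact_mod_cast hn
  have hs0 : 0 < s := by linarith
  have hX0 : 0 ≤ X := le_trans (by positivity) h1
  have hs3 : s ≤ s^2 := by nlinarith
  have hs4 : s ≤ s^3 := by nlinarith
  push_cast at h1 h2
  rw [← hs2] at h1 h2
  have hE := energy n X hX0
  have hqq : δ * s^2 ≤ n + 3/2 - X/4 := by rw [hδ]; nlinarith
  obtain ⟨q, hq⟩ : ∃ q : ℝ, q = n + 3/2 - X/4 := ⟨_, rfl⟩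
  rw [← hq] at hE hqq
  have hq0 : 0 < q := lt_of_lt_of_le (by positivity) hqq
  have hp : |lpf n X| ≤ 2 * s := by
    apply abs_le_of_sq_le_sq _ (by positivity)
    have : 0 ≤ X * q * lf (n+1) X ^ 2 := by positivity
    nlinarith
  have hf : |lf (n+1) X| ≤ Cf / s := by
    apply abs_le_of_sq_le_sq _ (by positivity)
    rw [div_pow, hCf, Real.sq_sqrt (by positivity), div_div, le_div_iff₀ (by positivity)]
    have h3 : a * s^2 * (δ * s^2) ≤ X * q := mul_le_mul h1 hqq (by positivity) hX0
    have h4 := mul_le_mul_of_nonneg_right h3 (sq_nonneg (lf (n+1) X))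
    have h5 : a * s^2 * (δ * s^2) * lf (n+1) X ^ 2 ≤ 2 * s^2 := by nlinarith [sq_nonneg (lpf n X)]
    have : (lf (n+1) X ^ 2 * (a * δ * s^2)) * s^2 ≤ 2 * s^2 := by linarith
    exact le_of_mul_le_mul_right this (by positivity)
  refine ⟨hf.trans (by gcongr; linarith), (lT_bound n X q hX0 hq hq0).trans ?_⟩
  have t1 : |lpf n X| / q ≤ (2/δ) / s := by
    calc |lpf n X| / q ≤ (2*s) / (δ * s^2) := by gcongr
      _ = _ := by field_simp
  have t2 : X * |lf (n+1) X| / (4 * q^2) ≤ b * Cf/(4*δ^2) / s := by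
    calc X * |lf (n+1) X| / (4 * q^2) ≤ (b * s^2) * (Cf/s) / (4 * (δ * s^2)^2) := by gcongr
      _ = b * Cf/(4*δ^2) / (s^3) := by field_simp
      _ ≤ _ := by exact div_le_div_of_nonneg_left (by positivity) hs0 hs4
  have t3 : (1/(4*q^2) + X/(8*q^3)) * (X + 1) ≤ (1/(4*δ^2) + b/(8*δ^3)) * (b+1) / s := by
    calc (1/(4*q^2) + X/(8*q^3)) * (X + 1) 
        ≤ (1/(4*(δ * s^2)^2) + (b * s^2)/(8*(δ * s^2)^3)) * (b * s^2 + s^2) := by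
          gcongr; linarith
      _ = (1/(4*δ^2) + b/(8*δ^3)) * (b+1) / s^2 := by field_simp
      _ ≤ _ := div_le_div_of_nonneg_left (by positivity) hs0 hs3
  calc _ ≤ 1/2 * ((2/δ) / s + b * Cf/(4*δ^2) / s) + 1/4 * ((1/(4*δ^2) + b/(8*δ^3)) * (b+1) / s) := by
        rw [mul_assoc (1/4)]; gcongr
    _ = C2 / s := by rw [hC2]; ring
    _ ≤ _ := by gcongr; linarith

def bk (k n : ℕ) (X : ℝ) : ℝ := (-1)^n * (exp (-X/2) * Lag k n X)

theorem bulk_bk (k : ℕ) : ∀ (a b : ℝ) (_ : 0 < a) (_ : b < 4), ∃ C : ℝ, 0 ≤ C ∧ ∀ n : ℕ, 1 ≤ n →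
    ∀ X : ℝ, a * n ≤ X → X ≤ b * n → |bk k n X| ≤ C / √n := by
  induction k with
  | zero =>
    intro a b ha hb
    obtain ⟨C, h0, h⟩ := bulk_base a b ha hb
    refine ⟨C, h0, fun n hn X h1 h2 => ?_⟩
    have := (h n hn X h1 h2).1
    simpa [bk, Lag, lf, abs_mul] using this
  | succ k ih =>
    intro a b ha hb
    by_cases hb0 : b ≤ 0
    · refine ⟨0, le_rfl, fun n hn X h1 h2 => ?_⟩
      exfalso
      have : (1:ℝ) ≤ n := by exact_mod_cast hn
      nlinarith
    push Not at hb0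
    obtain ⟨C, h0, h⟩ := ih (a/2) b (by linarith) hb
    refine ⟨(k+4) * C / a, by positivity, fun n hn X h1 h2 => ?_⟩
    have hn1 : (1:ℝ) ≤ n := by exact_mod_cast hn
    have r1 := h n hn X (by nlinarith) h2
    have r2 := h (n+1) (by omega) X (by push_cast; nlinarith) (by push_cast; nlinarith)
    have r3 : C / √((n+1:ℕ):ℝ) ≤ C / √n := by gcongr; simp
    have hX : 0 < X := lt_of_lt_of_le (by positivity) h1
    have e : X * bk (k+1) n X = (n+k+1) * bk k n X + (n+1) * bk k (n+1) X := by
      have := mul_Lag k n X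
      unfold bk
      rw [pow_succ]
      linear_combination ((-1)^n * exp (-X/2)) * this
    have h3 : X * |bk (k+1) n X| ≤ (n+k+1) * (C/√n) + (n+1) * (C / √n) := by
      calc X * |bk (k+1) n X| = |X * bk (k+1) n X| := by rw [abs_mul, abs_of_pos hX]
        _ ≤ |(n+k+1) * bk k n X| + |(n+1) * bk k (n+1) X| := by rw [e]; exact abs_add_le _ _
        _ = (n+k+1) * |bk k n X| + (n+1) * |bk k (n+1) X| := by
          rw [abs_mul, abs_mul, abs_of_nonneg (by positivity : (0:ℝ) ≤ n+k+1), abs_of_nonneg (by positivity : (0:ℝ) ≤ n+1)]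
        _ ≤ _ := by gcongr; exact r2.trans r3
    have hD : 0 ≤ C / √n := by positivity
    have h4 : (a * n) * |bk (k+1) n X| ≤ n * ((k+4) * (C/√n)) := by
      calc (a * n) * |bk (k+1) n X| ≤ X * |bk (k+1) n X| := by gcongr
        _ ≤ _ := h3
        _ = (2 * n + k + 2) * (C/√n) := by ring
        _ ≤ (n * (k+4)) * (C/√n) := by
          gcongr
          have : (0:ℝ) ≤ k := by positivity
          nlinarith
        _ = _ := by ring
    have h5 : a * |bk (k+1) n X| ≤ (k+4) * (C/√n) := by
      have : n * (a * |bk (k+1) n X|) ≤ n * ((k+4) * (C/√n)) := by linarith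
      exact le_of_mul_le_mul_left this (by positivity)
    have : (k+4) * C / a / √n = ((k+4) * (C/√n)) / a := by ring
    rw [this, le_div_iff₀ ha]; linarith

def Sk (k n : ℕ) (X : ℝ) : ℝ := ∑ m ∈ Finset.range n, bk k m X

theorem bk_rec (k n : ℕ) (X : ℝ) : bk (k+1) (n+1) X + bk (k+1) n X = bk k (n+1) X := by
  simp only [bk, Lag_succ_succ]; ring

theorem Sk_rec (k n : ℕ) (X : ℝ) : 2 * Sk (k+1) n X + bk (k+1) n X = Sk k n X + bk k n X := by
  induction n with
  | zero => simp [Sk, bk, Lag]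
  | succ n ih =>
    have := bk_rec k n X
    simp only [Sk, Finset.sum_range_succ] at ih ⊢
    linarith

theorem bulk_Sk (k : ℕ) : ∀ (a b : ℝ) (_ : 0 < a) (_ : b < 4), ∃ C : ℝ, 0 ≤ C ∧ ∀ n : ℕ, 1 ≤ n →
    ∀ X : ℝ, a * n ≤ X → X ≤ b * n → |2^(k+1) * Sk k n X - 1| ≤ C / √n := by
  intro a b ha hb
  induction k with
  | zero =>
    obtain ⟨C, h0, h⟩ := bulk_base a b ha hb
    refine ⟨C+C, by positivity, fun n hn X h1 h2 => ?_⟩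
    obtain ⟨h3, h4⟩ := h n hn X h1 h2
    have e : 2^(0+1) * Sk 0 n X - 1 = (lT n X - 1) - (-1)^n * lf n X := by
      simp [Sk, bk, Lag, lT, lf]; ring
    rw [e, add_div]
    refine (abs_sub _ _).trans (add_le_add h4 ?_)
    simpa [abs_mul] using h3
  | succ k ih =>
    obtain ⟨C, h0, h⟩ := ih
    obtain ⟨C1, h01, hh1⟩ := bulk_bk k a b ha hb
    obtain ⟨C2, h02, hh2⟩ := bulk_bk (k+1) a b ha hb
    refine ⟨C + 2^(k+1) * (C1 + C2), by positivity, fun n hn X h1 h2 => ?_⟩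
    have i1 := h n hn X h1 h2
    have i2 := hh1 n hn X h1 h2
    have i3 := hh2 n hn X h1 h2
    have e : 2^(k+1+1) * Sk (k+1) n X - 1 = (2^(k+1) * Sk k n X - 1) + 2^(k+1) * (bk k n X - bk (k+1) n X) := by
      have := Sk_rec k n X
      rw [pow_succ]; linear_combination 2^(k+1) * this
    rw [e]
    refine (abs_add_le _ _).trans ?_
    have i4 : |bk k n X - bk (k+1) n X| ≤ C1/√n + C2/√n := (abs_sub _ _).trans (add_le_add i2 i3)
    rw [abs_mul, abs_of_pos (by positivity : (0:ℝ) < 2^(k+1))]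
    have i5 := mul_le_mul_of_nonneg_left i4 (by positivity : (0:ℝ) ≤ 2^(k+1))
    have i6 : (C + 2^(k+1) * (C1 + C2)) / √n = C / √n + 2^(k+1) * (C1/√n + C2/√n) := by ring
    rw [i6]; linarith

def lK (r : ℝ) (M : ℕ) (x : ℝ) : ℝ := ∑ n ∈ Finset.range (M+1), r^n * lg n x ^ 2
def lF (r : ℝ) (M : ℕ) (x : ℝ) : ℝ := ∑ n ∈ Finset.range (M+1), r^n * lf n x ^ 2

theorem hasDerivAt_lK (r : ℝ) (M : ℕ) (x : ℝ) :
    HasDerivAt (lK r M) (-((1-r) * lF r M x + r^(M+1) * lf M x ^ 2)) x := by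
  induction M with
  | zero =>
    have e : lK r 0 = fun x => lg 0 x ^ 2 := by ext x; simp [lK]
    rw [e]
    refine ((hasDerivAt_lg_zero x).pow 2).congr_deriv ?_
    simp [lg, lF]; ring
  | succ n ih =>
    have e : lK r (n+1) = fun x => lK r n x + r^(n+1) * lg (n+1) x ^ 2 := by
      ext x; simp only [lK]; rw [Finset.sum_range_succ _ (n+1)]
    have e2 : lF r (n+1) x = lF r n x + r^(n+1) * lf (n+1) x ^ 2 := by
      simp only [lF]; rw [Finset.sum_range_succ _ (n+1)]
    rw [e, e2]
    refine (ih.add (((hasDerivAt_lg_succ n x).pow 2).const_mul (r^(n+1)))).congr_deriv ?_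
    simp [lg]; ring

theorem lK_le (r : ℝ) (hr : 0 < r) (M : ℕ) (x : ℝ) :
    lK r M x + 2 * r^(M+1) * lf M x ^ 2 ≤ 2 * (1+r) * lF r M x := by
  induction M with
  | zero =>
    simp [lK, lF, lg]; nlinarith [sq_nonneg (lf 0 x)]
  | succ n ih =>
    have e : lK r (n+1) x = lK r n x + r^(n+1) * lg (n+1) x ^ 2 := by
      simp only [lK]; rw [Finset.sum_range_succ _ (n+1)]
    have e2 : lF r (n+1) x = lF r n x + r^(n+1) * lf (n+1) x ^ 2 := by
      simp only [lF]; rw [Finset.sum_range_succ _ (n+1)]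
    rw [e, e2]
    have h1 : lg (n+1) x ^ 2 ≤ 2 * lf (n+1) x ^ 2 + 2 * lf n x ^ 2 := by
      simp only [lg]; nlinarith [sq_nonneg (lf (n+1) x + lf n x)]
    have h2 := mul_le_mul_of_nonneg_left h1 (by positivity : 0 ≤ r^(n+1))
    rw [pow_succ r (n+1)]
    nlinarith

theorem lK_exp (r : ℝ) (hr : 0 < r) (hr1 : r < 1) (M : ℕ) (X : ℝ) (hX : 0 ≤ X) :
    exp ((1-r)/(2*(1+r)) * X) * lK r M X ≤ 1 := by
  set l := (1-r)/(2*(1+r)) with hl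
  have h := mono_aux (F := fun x => -(exp (l * x) * lK r M x))
    (F' := fun x => exp (l*x) * ((1-r) * lF r M x + r^(M+1) * lf M x ^ 2 - l * lK r M x)) hX ?_ ?_
  · have e : lK r M 0 = 1 := by
      simp only [lK]; rw [Finset.sum_range_succ']; simp [lg, lf_at_zero]
    simp [e] at h; linarith
  · intro x _ _
    have h1 : HasDerivAt (fun x => exp (l * x)) (exp (l*x) * (l * 1)) x :=
      ((hasDerivAt_id x).const_mul l).exp
    refine (h1.mul (hasDerivAt_lK r M x)).neg.congr_deriv ?_
    ring
  · intro x _ _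
    apply mul_nonneg (exp_pos _).le
    have h1 := lK_le r hr M x
    have h2 : 0 ≤ r^(M+1) * lf M x ^ 2 := by positivity
    have hl0 : 0 ≤ l := by rw [hl]; apply div_nonneg <;> linarith
    have h3 : l * lK r M x ≤ l * (2 * (1+r) * lF r M x) := by
      apply mul_le_mul_of_nonneg_left _ hl0; linarith
    have h4 : l * (2 * (1+r) * lF r M x) = (1-r) * lF r M x := by
      rw [hl]; field_simp
    linarith

theorem lg_tail (θ : ℝ) (h0 : 0 < θ) (h1 : θ < 1) : ∃ c : ℝ, 0 < c ∧ ∀ (n : ℕ) (X : ℝ), 0 ≤ X →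
    4 * n ≤ θ * X → |lg n X| ≤ exp (-c * X) := by
  obtain ⟨ρ, hρ⟩ : ∃ ρ, ρ = (1+θ)/2 := ⟨_, rfl⟩
  have hρ0 : 0 < ρ := by linarith
  have hρ1 : ρ < 1 := by linarith
  have hθρ : θ < ρ := by linarith
  refine ⟨(1-ρ)/4 * (1 - θ/ρ), ?_, fun n X hX hn => ?_⟩
  · apply mul_pos; linarith
    rw [sub_pos, div_lt_one hρ0]; exact hθρ
  have hr : 0 < ρ^2 := by positivity
  have hr1 : ρ^2 < 1 := by nlinarith
  have hK := lK_exp (ρ^2) hr hr1 n X hX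
  set l := (1-ρ^2)/(2*(1+ρ^2)) with hl
  have h2 : (ρ^2)^n * lg n X ^ 2 ≤ lK (ρ^2) n X :=
    Finset.single_le_sum (f := fun n => (ρ^2)^n * lg n X ^ 2) (fun i _ => by positivity) (by simp)
  have h3 : (ρ^2)^n * lg n X ^ 2 ≤ exp (-(l*X)) := by
    rw [exp_neg, ← one_div, le_div_iff₀ (exp_pos _)]
    nlinarith [exp_pos (l*X)]
  have h4 : |ρ^n * lg n X| ≤ exp (-(l*X)/2) := by
    apply abs_le_of_sq_le_sq _ (exp_pos _).le
    rw [← exp_nat_mul, mul_pow]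
    have e1 : ((2:ℕ):ℝ) * (-(l*X)/2) = -(l*X) := by push_cast; ring
    have e2 : (ρ^n)^2 = (ρ^2)^n := by rw [← pow_mul, ← pow_mul, mul_comm]
    rw [e1, e2]; exact h3
  rw [abs_mul, abs_of_pos (by positivity : 0 < ρ^n)] at h4
  have h5 : 1 ≤ exp (n * ((1-ρ)/ρ)) * ρ^n := by
    rw [exp_nat_mul, ← mul_pow]
    apply one_le_pow₀
    have := add_one_le_exp ((1-ρ)/ρ)
    have h6 : (1-ρ)/ρ + 1 = 1/ρ := by field_simp; ring
    rw [h6, div_le_iff₀ hρ0] at this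
    exact this
  have h7 : |lg n X| ≤ exp (n * ((1-ρ)/ρ)) * exp (-(l*X)/2) := by
    calc |lg n X| ≤ (exp (n * ((1-ρ)/ρ)) * ρ^n) * |lg n X| := le_mul_of_one_le_left (abs_nonneg _) h5
      _ = exp (n * ((1-ρ)/ρ)) * (ρ^n * |lg n X|) := by ring
      _ ≤ _ := by gcongr
  refine h7.trans ?_
  rw [← exp_add, exp_le_exp]
  have h8 : (1-ρ)/2 ≤ l := by
    rw [hl, le_div_iff₀ (by positivity)]
    nlinarith [mul_nonneg hρ0.le (sq_nonneg (1-ρ))]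
  have h9 : n * ((1-ρ)/ρ) ≤ θ * X / 4 * ((1-ρ)/ρ) := by
    apply mul_le_mul_of_nonneg_right _ (div_nonneg (by linarith) hρ0.le); linarith
  have h10 : θ * X / 4 * ((1-ρ)/ρ) = (1-ρ)/4 * (θ/ρ) * X := by ring
  have h11 := mul_le_mul_of_nonneg_right h8 hX
  linarith

theorem lf_eq_sum (n : ℕ) (X : ℝ) : lf n X = ∑ m ∈ Finset.range (n+1), lg m X := by
  induction n with
  | zero => simp [lg]
  | succ n ih => rw [Finset.sum_range_succ, ← ih]; simp [lg]

theorem sum_aux {f : ℕ → ℝ} {n k : ℕ} {e : ℝ} (he : 0 ≤ e)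
    (h : ∀ m, m ≤ n → |f m| ≤ (m+1)^k * e) :
    |∑ m ∈ Finset.range (n+1), f m| ≤ (n+1)^(k+1) * e := by
  calc _ ≤ ∑ m ∈ Finset.range (n+1), |f m| := Finset.abs_sum_le_sum_abs _ _
    _ ≤ ∑ m ∈ Finset.range (n+1), ((n:ℝ)+1)^k * e := by
      apply Finset.sum_le_sum
      intro m hm
      have hmn : m ≤ n := by simp at hm; omega
      refine (h m hmn).trans ?_
      gcongr
    _ = _ := by simp; ring

theorem bk_tail (θ : ℝ) (h0 : 0 < θ) (h1 : θ < 1) : ∃ c : ℝ, 0 < c ∧ ∀ (k n : ℕ) (X : ℝ), 0 ≤ X →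
    4 * n ≤ θ * X → |bk k n X| ≤ (n+1)^(k+1) * exp (-c * X) := by
  obtain ⟨c, hc, h⟩ := lg_tail θ h0 h1
  refine ⟨c, hc, fun k => ?_⟩
  have e : ∀ k n X, |bk k n X| = |exp (-X/2) * Lag k n X| := by
    intro k n X; simp [bk, abs_mul]
  induction k with
  | zero =>
    intro n X hX hn
    rw [e]
    have : exp (-X/2) * Lag 0 n X = lf n X := rfl
    rw [this, lf_eq_sum]
    apply sum_aux (exp_pos _).le
    intro m hm
    have hm' : (m:ℝ) ≤ n := by exact_mod_cast hm
    simpa using h m X hX (by linarith)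
  | succ k ih =>
    intro n X hX hn
    rw [e]
    simp only [Lag]
    rw [Finset.mul_sum]
    apply sum_aux (exp_pos _).le
    intro m hm
    have hm' : (m:ℝ) ≤ n := by exact_mod_cast hm
    rw [← e]
    exact ih m X hX (by linarith)

theorem Sk_tail (θ : ℝ) (h0 : 0 < θ) (h1 : θ < 1) (k κ : ℕ) : ∃ C : ℝ, 0 < C ∧ ∀ (n : ℕ) (X : ℝ), 1 ≤ X →
    4 * n ≤ θ * X → |Sk k n X| ≤ C / X^κ := by
  obtain ⟨c, hc, h⟩ := bk_tail θ h0 h1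
  refine ⟨2^(k+2) * ((k+2+κ).factorial / c^(k+2+κ)), by positivity, fun n X hX hn => ?_⟩
  have hX0 : 0 < X := by linarith
  have hS : |Sk k n X| ≤ (n+1)^(k+2) * exp (-c * X) := by
    cases n with
    | zero => simp [Sk]; positivity
    | succ n =>
      have := sum_aux (f := fun m => bk k m X) (n := n) (k := k+1) (exp_pos (-c*X)).le (by
        intro m hm
        have hm' : (m:ℝ) ≤ n := by exact_mod_cast hm
        push_cast at hn
        exact h k m X hX0.le (by linarith))
      unfold Sk
      refine this.trans ?_
      push_cast
      gcongr
      linarith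
  have hn2 : (n:ℝ) + 1 ≤ 2 * X := by nlinarith
  have hexp : exp (-c * X) ≤ (k+2+κ).factorial / (c*X)^(k+2+κ) := by
    have := Real.pow_div_factorial_le_exp (c*X) (by positivity) (k+2+κ)
    rw [neg_mul, exp_neg, ← one_div, div_le_div_iff₀ (exp_pos _) (by positivity), one_mul]
    rw [div_le_iff₀ (by positivity)] at this
    linarith
  calc |Sk k n X| ≤ (n+1)^(k+2) * exp (-c * X) := hS
    _ ≤ (2*X)^(k+2) * ((k+2+κ).factorial / (c*X)^(k+2+κ)) := by gcongr
    _ = _ := by rw [mul_pow, mul_pow, pow_add X (k+2) κ]; field_simp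

def psP (x : ℝ) : PowerSeries ℝ := PowerSeries.mk fun n => lag n x
def psE (x : ℝ) : PowerSeries ℝ := (1 - PowerSeries.X) * psP x

theorem hasDerivAt_psE (n : ℕ) (x : ℝ) :
    HasDerivAt (fun x => PowerSeries.coeff n (psE x)) (- PowerSeries.coeff n (PowerSeries.X * psP x)) x := by
  cases n with
  | zero =>
    have : (fun x => PowerSeries.coeff 0 (psE x)) = fun _ => 1 := by
      ext x; simp [psE, psP, lag_zero_left]
    rw [this]
    simpa using hasDerivAt_const x (1:ℝ)
  | succ n =>
    have : (fun x => PowerSeries.coeff (n+1) (psE x)) = fun x => lag (n+1) x - lag n x := by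
      ext x; simp [psE, psP, sub_mul, PowerSeries.coeff_succ_X_mul]
    rw [this]
    refine ((hasDerivAt_lag (n+1) x).sub (hasDerivAt_lag n x)).congr_deriv ?_
    simp [psP, PowerSeries.coeff_succ_X_mul, slag, Finset.sum_range_succ]

theorem psE_zero : psE 0 = 1 := by
  ext n
  cases n with
  | zero => simp [psE, psP, lag_at_zero]
  | succ n => simp [psE, psP, sub_mul, PowerSeries.coeff_succ_X_mul, lag_at_zero, PowerSeries.coeff_one]

theorem psE_add (x y : ℝ) : psE x * psE y = psE (x + y) := by
  ext n
  have hd : ∀ t, HasDerivAt (fun t => PowerSeries.coeff n (psE t * psE (x + y - t))) 0 t := by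
    intro t
    simp only [PowerSeries.coeff_mul]
    have h : ∀ p ∈ Finset.HasAntidiagonal.antidiagonal n, HasDerivAt
      (fun t => PowerSeries.coeff p.1 (psE t) * PowerSeries.coeff p.2 (psE (x + y - t)))
      (- PowerSeries.coeff p.1 (PowerSeries.X * psP t) * PowerSeries.coeff p.2 (psE (x+y-t)) +
        PowerSeries.coeff p.1 (psE t) * PowerSeries.coeff p.2 (PowerSeries.X * psP (x+y-t))) t := by
      intro p _
      have h2 := (hasDerivAt_psE p.2 (x+y-t)).comp t ((hasDerivAt_id t).const_sub (x+y))
      refine ((hasDerivAt_psE p.1 t).mul h2).congr_deriv ?_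
      simp
    refine (HasDerivAt.fun_sum h).congr_deriv ?_
    have e : - (PowerSeries.X * psP t) * psE (x+y-t) + psE t * (PowerSeries.X * psP (x+y-t)) = 0 := by
      unfold psE; ring
    have := congrArg (PowerSeries.coeff n) e
    simp only [neg_mul] at this
    rw [map_add, map_neg, PowerSeries.coeff_mul, PowerSeries.coeff_mul, map_zero] at this
    rw [← this, ← Finset.sum_neg_distrib, ← Finset.sum_add_distrib]
    simp only [neg_mul]
  have hc := is_const_of_deriv_eq_zero (fun t => (hd t).differentiableAt) (fun t => (hd t).deriv) x 0
  simpa [psE_zero] using hc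

def psL (k : ℕ) (x : ℝ) : PowerSeries ℝ := PowerSeries.mk fun n => Lag k n x

theorem psL_succ (k : ℕ) (x : ℝ) : (1 - PowerSeries.X) * psL (k+1) x = psL k x := by
  ext n
  cases n with
  | zero => simp [psL, Lag]
  | succ n => simp [psL, sub_mul, PowerSeries.coeff_succ_X_mul, Lag_succ_succ]

theorem one_sub_X_ne : (1 - PowerSeries.X : PowerSeries ℝ) ≠ 0 := by
  intro h
  have := congrArg (PowerSeries.coeff 0) h
  simp at this

theorem psL_mul (k : ℕ) (x y : ℝ) : psP y * psL k x = psL (k+1) (y + x) := by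
  induction k with
  | zero =>
    apply mul_left_cancel₀ one_sub_X_ne
    rw [psL_succ]
    have h := psE_add y x
    unfold psE at h
    have h0 : ∀ x, psL 0 x = psP x := fun x => rfl
    rw [h0, h0]
    apply mul_left_cancel₀ one_sub_X_ne
    rw [← h]; ring
  | succ k ih =>
    apply mul_left_cancel₀ one_sub_X_ne
    rw [psL_succ, ← ih, ← psL_succ k x]; ring

theorem sum_antidiagonalTuple_succ {M : Type*} [AddCommMonoid M] (k n : ℕ) (f : (Fin (k+1) → ℕ) → M) :
    ∑ α ∈ Finset.Nat.antidiagonalTuple (k+1) n, f α =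
      ∑ p ∈ Finset.HasAntidiagonal.antidiagonal n, ∑ β ∈ Finset.Nat.antidiagonalTuple k p.2, f (Fin.cons p.1 β) := by
  rw [Finset.sum_sigma']
  refine Finset.sum_bij' (fun α _ => ⟨(α 0, ∑ i, Fin.tail α i), Fin.tail α⟩) (fun q _ => Fin.cons q.1.1 q.2) ?_ ?_ ?_ ?_ ?_
  · intro α hα
    rw [Finset.Nat.mem_antidiagonalTuple, Fin.sum_univ_succ] at hα
    simp [Finset.Nat.mem_antidiagonalTuple, Fin.tail, hα]
  · rintro ⟨⟨i, j⟩, β⟩ h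
    simp [Finset.Nat.mem_antidiagonalTuple] at h ⊢
    omega
  · intro α _; simp
  · rintro ⟨⟨i, j⟩, β⟩ h
    simp [Finset.Nat.mem_antidiagonalTuple] at h ⊢
    simp [h]
  · intro α _; simp

theorem sum_prod_lag (k : ℕ) : ∀ (n : ℕ) (Y : Fin (k+1) → ℝ),
    ∑ α ∈ Finset.Nat.antidiagonalTuple (k+1) n, ∏ j, lag (α j) (Y j) = Lag k n (∑ j, Y j) := by
  induction k with
  | zero => intro n Y; simp [Lag]
  | succ k ih =>
    intro n Y
    rw [sum_antidiagonalTuple_succ]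
    have h := congrArg (PowerSeries.coeff n) (psL_mul k (∑ j : Fin (k+1), Y j.succ) (Y 0))
    rw [← Fin.sum_univ_succ] at h
    simp only [psL, psP, PowerSeries.coeff_mul, PowerSeries.coeff_mk] at h
    rw [← h]
    apply Finset.sum_congr rfl
    intro p _
    rw [← ih, Finset.mul_sum]
    apply Finset.sum_congr rfl
    intro β _
    rw [Fin.prod_univ_succ]; simp

theorem sum_prod_lf (k n : ℕ) (Y : Fin (k+1) → ℝ) :
    ∑ α ∈ Finset.Nat.antidiagonalTuple (k+1) n, ∏ j, ((-1)^(α j) * lf (α j) (Y j)) =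
      bk k n (∑ j, Y j) := by
  unfold bk
  rw [← sum_prod_lag, Finset.mul_sum, Finset.mul_sum]
  apply Finset.sum_congr rfl
  intro α hα
  rw [Finset.Nat.mem_antidiagonalTuple] at hα
  simp only [lf, Finset.prod_mul_distrib]
  rw [Finset.prod_pow_eq_pow_sum, hα, ← Real.exp_sum]
  congr 3
  rw [← Finset.sum_div, Finset.sum_neg_distrib]

def wE (ξ v : ℝ) : ℂ := Complex.exp (-(1/4) * (v:ℂ)^2 - Complex.I * v * ξ)
def wM (ξ : ℝ) (p : Polynomial ℂ) : ℂ := ∫ v : ℝ, p.eval ((v:ℂ)/2 + Complex.I * ξ) * wE ξ v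

theorem norm_wE (ξ v : ℝ) : ‖wE ξ v‖ = exp (-(1/4) * v^2) := by
  unfold wE
  rw [Complex.norm_exp]
  congr 1
  simp [← Complex.ofReal_pow]

theorem continuous_wE (ξ : ℝ) : Continuous (wE ξ) := by unfold wE; fun_prop

theorem integrable_pow_wE (ξ : ℝ) (n : ℕ) : Integrable fun v : ℝ => (v:ℂ)^n * wE ξ v := by
  have h := (integrable_rpow_mul_exp_neg_mul_sq (b := 1/4) (by norm_num) (s := n)
    (by have : (0:ℝ) ≤ n := by positivity
        linarith)).norm
  refine h.mono' (by have := continuous_wE ξ; fun_prop) (Eventually.of_forall fun v => ?_)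
  rw [norm_mul, norm_mul, norm_wE, norm_pow, Complex.norm_real, Real.rpow_natCast, norm_pow,
    Real.norm_of_nonneg (exp_pos _).le]

theorem integrable_poly0 (ξ : ℝ) (p : Polynomial ℂ) : Integrable fun v : ℝ => p.eval (v:ℂ) * wE ξ v := by
  induction p using Polynomial.induction_on' with
  | add p q hp hq => 
    refine (hp.add hq).congr (Eventually.of_forall fun v => ?_)
    simp [add_mul]
  | monomial n a => simpa [mul_assoc] using (integrable_pow_wE ξ n).const_mul a

theorem integrable_poly (ξ : ℝ) (p : Polynomial ℂ) :
    Integrable fun v : ℝ => p.eval ((v:ℂ)/2 + Complex.I * ξ) * wE ξ v := by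
  have h := integrable_poly0 ξ (p.comp (Polynomial.C (1/2) * Polynomial.X + Polynomial.C (Complex.I * ξ)))
  refine h.congr (Eventually.of_forall fun v => ?_)
  simp only [Polynomial.eval_comp]
  simp; left; congr 1; ring

theorem wM_add (ξ : ℝ) (p q : Polynomial ℂ) : wM ξ (p + q) = wM ξ p + wM ξ q := by
  unfold wM
  rw [← integral_add (integrable_poly ξ p) (integrable_poly ξ q)]
  simp [add_mul]

theorem wM_sub (ξ : ℝ) (p q : Polynomial ℂ) : wM ξ (p - q) = wM ξ p - wM ξ q := by
  unfold wM
  rw [← integral_sub (integrable_poly ξ p) (integrable_poly ξ q)]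
  simp [sub_mul]

theorem wM_C_mul (ξ : ℝ) (a : ℂ) (p : Polynomial ℂ) : wM ξ (Polynomial.C a * p) = a * wM ξ p := by
  unfold wM
  rw [← integral_const_mul]
  simp [mul_assoc]

theorem wM_X_mul (ξ : ℝ) (p : Polynomial ℂ) :
    2 * wM ξ (Polynomial.X * p) = wM ξ (Polynomial.derivative p) := by
  have hd : ∀ v : ℝ, HasDerivAt (fun v : ℝ => p.eval ((v:ℂ)/2 + Complex.I * ξ) * wE ξ v)
      ((Polynomial.C (1/2) * Polynomial.derivative p - Polynomial.X * p).eval ((v:ℂ)/2 + Complex.I * ξ) * wE ξ v) v := by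
    intro v
    have h0 : HasDerivAt (fun v : ℝ => (v:ℂ)) 1 v := Complex.ofRealCLM.hasDerivAt
    have h1 : HasDerivAt (fun v : ℝ => (v:ℂ)/2 + Complex.I * ξ) (1/2) v := (h0.div_const 2).add_const _
    have h2 := (p.hasDerivAt ((v:ℂ)/2 + Complex.I * ξ)).comp v h1
    have h3 : HasDerivAt (wE ξ) (wE ξ v * (-(1/4) * (2 * v) - Complex.I * ξ)) v := by
      have h4 := ((((h0.pow 2).const_mul (-(1/4) : ℂ))).sub ((h0.const_mul Complex.I).mul_const (ξ:ℂ))).cexp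
      refine h4.congr_deriv ?_
      unfold wE; simp
    refine (h2.mul h3).congr_deriv ?_
    simp; ring
  have h := integral_eq_zero_of_hasDerivAt_of_integrable hd (integrable_poly ξ _) (integrable_poly ξ p)
  change wM ξ _ = 0 at h
  rw [wM_sub, wM_C_mul] at h
  linear_combination -2 * h

theorem wM_one (ξ : ℝ) : wM ξ 1 = ((2 * √π * exp (-ξ^2) : ℝ) : ℂ) := by
  have h := fourierIntegral_gaussian (b := 1/4) (by norm_num) (-(ξ:ℂ))
  have e : wM ξ 1 = ∫ x : ℝ, Complex.exp (Complex.I * -(ξ:ℂ) * x) * Complex.exp (-(1/4) * (x:ℂ)^2) := by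
    unfold wM wE
    congr 1; ext v
    rw [← Complex.exp_add]; simp; congr 1; ring
  rw [e, h]
  have h1 : (π:ℂ) / (1/4) = ((4 * π : ℝ) : ℂ) := by push_cast; ring
  have h2 : ((1/2 : ℂ)) = ((1/2 : ℝ) : ℂ) := by push_cast; ring
  rw [h1, h2, ← Complex.ofReal_cpow (by positivity), ← Real.sqrt_eq_rpow, Real.sqrt_mul (by norm_num)]
  have h3 : √(4:ℝ) = 2 := by rw [show (4:ℝ) = 2^2 by norm_num]; simp
  rw [h3]; push_cast; congr 2; ring

theorem physHermite_deriv (n : ℕ) : Polynomial.derivative (physHermite (n+1)) = Polynomial.C (2 * ((n:ℝ)+1)) * physHermite n := by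
  induction n with
  | zero => simp [physHermite]; rfl
  | succ n ih =>
    have e : physHermite (n+2) = 2 * Polynomial.X * physHermite (n+1) - Polynomial.derivative (physHermite (n+1)) := rfl
    have e1 : physHermite (n+1) = 2 * Polynomial.X * physHermite n - Polynomial.derivative (physHermite n) := rfl
    have h2 : Polynomial.derivative (2 : Polynomial ℝ) = 0 := Polynomial.derivative_ofNat 2
    rw [e, map_sub, ih]
    simp only [Polynomial.derivative_mul, Polynomial.derivative_C, Polynomial.derivative_X, ih, h2]
    push_cast
    simp only [map_mul, map_add, map_one, map_natCast, Polynomial.C_ofNat]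
    linear_combination (-2 * ((n:Polynomial ℝ) + 1)) * e1

theorem physHermite_parity (n : ℕ) : (physHermite n).comp (-Polynomial.X) = (-1)^n * physHermite n := by
  induction n with
  | zero => simp [physHermite]
  | succ n ih =>
    have h := congrArg Polynomial.derivative ih
    rw [Polynomial.derivative_comp] at h
    have h2 : Polynomial.derivative ((-1)^n : Polynomial ℝ) = 0 := by
      rw [show ((-1)^n : Polynomial ℝ) = Polynomial.C ((-1)^n) by simp]; exact Polynomial.derivative_C
    simp only [Polynomial.derivative_mul, h2, Polynomial.derivative_neg, Polynomial.derivative_X] at h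
    simp only [physHermite, Polynomial.sub_comp, Polynomial.mul_comp, Polynomial.X_comp, ih, Polynomial.ofNat_comp]
    rw [pow_succ]
    linear_combination h

theorem physHermite_eval_neg (n : ℕ) (t : ℝ) : (physHermite n).eval (-t) = (-1)^n * (physHermite n).eval t := by
  have := congrArg (Polynomial.eval t) (physHermite_parity n)
  simpa [Polynomial.eval_comp] using this

def cH (n : ℕ) (z : ℂ) : Polynomial ℂ :=
  ((physHermite n).map (algebraMap ℝ ℂ)).comp (Polynomial.X + Polynomial.C z)

theorem cH_zero (z : ℂ) : cH 0 z = 1 := by simp [cH, physHermite]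

theorem cH_succ (n : ℕ) (z : ℂ) : cH (n+1) z =
    2 * (Polynomial.X + Polynomial.C z) * cH n z - Polynomial.derivative (cH n z) := by
  unfold cH
  rw [Polynomial.derivative_comp]
  simp [physHermite]

theorem cH_deriv (n : ℕ) (z : ℂ) :
    Polynomial.derivative (cH n z) = Polynomial.C (2 * (n:ℂ)) * cH (n-1) z := by
  cases n with
  | zero => simp [cH_zero]
  | succ n =>
    unfold cH
    rw [Polynomial.derivative_comp, Polynomial.derivative_map, physHermite_deriv]
    simp

theorem wM_cH (ξ : ℝ) (n : ℕ) (z : ℂ) (q : Polynomial ℂ) :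
    wM ξ (cH (n+1) z * q) = wM ξ (cH n z * Polynomial.derivative q) + 2 * z * wM ξ (cH n z * q) := by
  have h := wM_X_mul ξ (cH n z * q)
  rw [Polynomial.derivative_mul, wM_add] at h
  have e : cH (n+1) z * q = Polynomial.C 2 * (Polynomial.X * (cH n z * q)) +
      (Polynomial.C (2*z) * (cH n z * q) - Polynomial.derivative (cH n z) * q) := by
    rw [cH_succ]; simp only [map_mul, Polynomial.C_ofNat]; ring
  rw [e, wM_add, wM_sub, wM_C_mul, wM_C_mul, h]; ring

theorem pascal_sum (m : ℕ) (y : ℂ) (u : ℕ → ℂ) :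
    ∑ k ∈ Finset.range (m+2), ((m+1).choose k : ℂ) * y^(m+1-k) * u k =
      ∑ k ∈ Finset.range (m+1), (m.choose k : ℂ) * y^(m-k) * u (k+1) +
      y * ∑ k ∈ Finset.range (m+1), (m.choose k : ℂ) * y^(m-k) * u k := by
  rw [Finset.sum_range_succ']
  simp only [Nat.choose_succ_succ, Nat.cast_add, add_mul, Finset.sum_add_distrib, Nat.add_sub_add_right]
  rw [add_assoc]
  congr 1
  rw [Finset.sum_range_succ, Finset.sum_range_succ' _ m]
  simp only [Nat.choose_succ_self, Nat.cast_zero, zero_mul, add_zero]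
  rw [mul_add, Finset.mul_sum]
  congr 1
  · apply Finset.sum_congr rfl
    intro k hk
    have : m - k = (m - (k+1)) + 1 := by simp at hk; omega
    rw [this, pow_succ]; simp; ring
  · simp; ring

theorem wM_cH_cH (ξ : ℝ) (z w : ℂ) (m : ℕ) : ∀ n : ℕ, wM ξ (cH m z * cH n w) = wM ξ 1 *
    ∑ k ∈ Finset.range (m+1), (m.choose k : ℂ) * (2*z)^(m-k) * (2^k * (n.descFactorial k : ℂ) * (2*w)^(n-k)) := by
  induction m with
  | zero =>
    intro n
    simp only [cH_zero, one_mul]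
    induction n with
    | zero => simp [cH_zero]
    | succ n ih =>
      have := wM_cH ξ n w 1
      simp only [mul_one, Polynomial.derivative_one, mul_zero] at this
      rw [this, ih]
      have h0 : wM ξ 0 = 0 := by simp [wM]
      rw [h0]; simp [pow_succ]; ring
  | succ m ih =>
    intro n
    have e : cH m z * (Polynomial.C (2 * (n:ℂ)) * cH (n-1) w) = Polynomial.C (2 * (n:ℂ)) * (cH m z * cH (n-1) w) := by ring
    rw [wM_cH, cH_deriv, e, wM_C_mul, ih, ih, pascal_sum, mul_add]
    congr 1
    · rw [← mul_assoc, mul_comm _ (wM ξ 1), mul_assoc, Finset.mul_sum]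
      congr 1
      apply Finset.sum_congr rfl
      intro k _
      have h1 : n.descFactorial (k+1) = n * (n-1).descFactorial k := by
        cases n with
        | zero => simp
        | succ n => rw [Nat.succ_descFactorial_succ]; rfl
      have h2 : n - (k+1) = n - 1 - k := by omega
      rw [h1, h2]; push_cast; ring
    · ring

theorem wM_diag (ξ : ℝ) (z w : ℂ) (n : ℕ) (Y : ℝ) (hY : 2 * z * w = -(Y:ℂ)) :
    wM ξ (cH n z * cH n w) = wM ξ 1 * (2^n * n.factorial) * (lag n Y : ℝ) := by
  rw [wM_cH_cH, mul_assoc]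
  congr 1
  rw [← Finset.sum_range_reflect]
  unfold lag
  push_cast
  rw [Finset.mul_sum]
  apply Finset.sum_congr rfl
  intro j hj
  have hj' : j ≤ n := by simp at hj; omega
  have e1 : n + 1 - 1 - j = n - j := by omega
  have e2 : n - (n - j) = j := by omega
  rw [e2, Nat.choose_symm hj']
  have h3 : (n.descFactorial (n-j) : ℂ) * j.factorial = n.factorial := by
    have := Nat.factorial_mul_descFactorial (Nat.sub_le n j)
    rw [e2] at this
    exact_mod_cast (by rw [mul_comm]; exact this)
  have h4 : (j.factorial : ℂ) ≠ 0 := by exact_mod_cast Nat.factorial_ne_zero j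
  rw [← h3, ← hY]
  have h5 : (2:ℂ)^n = 2^(n-j) * 2^j := by rw [← pow_add]; congr 1; omega
  rw [h5, mul_pow, mul_pow, mul_pow, mul_pow]
  field_simp

def wf (n : ℕ) (x ξ v : ℝ) : ℂ :=
  ((hermiteFun n (x + v/2) * hermiteFun n (x - v/2) : ℝ) : ℂ) * Complex.exp (-Complex.I * ((v * ξ : ℝ) : ℂ))

theorem cH_eval (n : ℕ) (z u : ℂ) (t : ℝ) (h : u + z = t) : (cH n z).eval u = (((physHermite n).eval t : ℝ) : ℂ) := by
  unfold cH
  rw [Polynomial.eval_comp]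
  simp only [Polynomial.eval_add, Polynomial.eval_X, Polynomial.eval_C, h]
  rw [Polynomial.eval_map_algebraMap]
  simpa using Polynomial.aeval_algebraMap_apply ℂ t (physHermite n)

theorem wf_eq (n : ℕ) (x ξ v : ℝ) : wf n x ξ v =
    ((((2:ℝ)^n * n.factorial * √π)⁻¹ * (-1)^n * exp (-x^2) : ℝ) : ℂ) *
      ((cH n (x - Complex.I * ξ) * cH n (-x - Complex.I * ξ)).eval ((v:ℂ)/2 + Complex.I * ξ) * wE ξ v) := by
  have hN : 0 < (2:ℝ)^n * n.factorial * √π := by positivity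
  rw [Polynomial.eval_mul, cH_eval n _ _ (x + v/2) (by push_cast; ring),
    cH_eval n _ _ (-(x - v/2)) (by push_cast; ring), physHermite_eval_neg]
  unfold wf hermiteFun wE
  have e1 : ((2:ℝ)^n * n.factorial * √π) ^ (-(1:ℝ)/2) * ((2:ℝ)^n * n.factorial * √π) ^ (-(1:ℝ)/2)
      = ((2:ℝ)^n * n.factorial * √π)⁻¹ := by
    rw [← Real.rpow_add hN, ← Real.rpow_neg_one]; norm_num
  have e2 : exp (-(x+v/2)^2/2) * exp (-(x-v/2)^2/2) = exp (-x^2) * exp (-(1/4) * v^2) := by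
    rw [← exp_add, ← exp_add]; congr 1; ring
  have e3 : Complex.exp (-(1/4) * (v:ℂ)^2 - Complex.I * v * ξ) = ((exp (-(1/4) * v^2) : ℝ) : ℂ) *
      Complex.exp (-Complex.I * ((v * ξ : ℝ) : ℂ)) := by
    rw [Complex.ofReal_exp, ← Complex.exp_add]; congr 1; push_cast; ring
  have e4 : ((-1:ℝ)^n) * (-1)^n = 1 := by rw [← mul_pow]; simp
  rw [e3]
  generalize Complex.exp (-Complex.I * ((v * ξ : ℝ) : ℂ)) = T
  rw [← e1]
  generalize ((2:ℝ)^n * n.factorial * √π) ^ (-(1:ℝ)/2) = r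
  generalize Polynomial.eval (x+v/2) (physHermite n) = A
  generalize Polynomial.eval (x-v/2) (physHermite n) = B
  have key : r * A * exp (-(x+v/2)^2/2) * (r * B * exp (-(x-v/2)^2/2)) =
      r * r * (-1)^n * exp (-x^2) * (A * ((-1)^n * B) * exp (-(1/4) * v^2)) := by
    linear_combination r*A*r*B*e2 - r*r*A*B*exp (-x^2) * exp (-(1/4) * v^2) * e4
  rw [key]
  simp only [Complex.ofReal_mul]
  ring

theorem wf_integrable (n : ℕ) (x ξ : ℝ) : Integrable (wf n x ξ) := by
  rw [funext (wf_eq n x ξ)]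
  exact (integrable_poly ξ _).const_mul _

theorem wf_integral (n : ℕ) (x ξ : ℝ) :
    ∫ v, wf n x ξ v = ((2 * ((-1)^n * lf n (2*(x^2+ξ^2))) : ℝ) : ℂ) := by
  rw [funext (wf_eq n x ξ), integral_const_mul]
  have h := wM_diag ξ (x - Complex.I * ξ) (-x - Complex.I * ξ) n (2*(x^2+ξ^2))
    (by push_cast; linear_combination 2 * (ξ:ℂ)^2 * Complex.I_sq)
  unfold wM at h
  rw [h]
  change _ * (wM ξ 1 * _ * _) = _
  rw [wM_one]
  have e : ((2:ℂ)^n * n.factorial) = (((2:ℝ)^n * n.factorial : ℝ) : ℂ) := by push_cast; ring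
  rw [e]
  simp only [← Complex.ofReal_mul]
  congr 1
  unfold lf
  have e2 : exp (-(2*(x^2+ξ^2))/2) = exp (-x^2) * exp (-ξ^2) := by rw [← exp_add]; congr 1; ring
  rw [e2]
  have : √π ≠ 0 := by positivity
  have : (n.factorial : ℝ) ≠ 0 := by positivity
  field_simp

def wg (hb : ℝ) (n : ℕ) (x ξ v : ℝ) : ℂ :=
  ((hermiteFun n (hb^(-(1:ℝ)/2) * (x + v/2)) * hermiteFun n (hb^(-(1:ℝ)/2) * (x - v/2)) : ℝ) : ℂ) *
    Complex.exp (-Complex.I * ((v * ξ : ℝ) : ℂ) / hb)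

theorem cc (hb : ℝ) (h : 0 < hb) : hb^(-(1:ℝ)/2) * hb^(-(1:ℝ)/2) = hb⁻¹ := by
  rw [← Real.rpow_add h, ← Real.rpow_neg_one]; norm_num

theorem wg_eq (hb : ℝ) (h : 0 < hb) (n : ℕ) (x ξ v : ℝ) : wg hb n x ξ v =
    wf n (hb^(-(1:ℝ)/2) * x) (hb^(-(1:ℝ)/2) * ξ) (hb^(-(1:ℝ)/2) * v) := by
  have hc := cc hb h
  unfold wg wf
  have e1 : -Complex.I * ((v * ξ : ℝ) : ℂ) / hb = -Complex.I * ((hb^(-(1:ℝ)/2) * v * (hb^(-(1:ℝ)/2) * ξ) : ℝ) : ℂ) := by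
    rw [show hb^(-(1:ℝ)/2) * v * (hb^(-(1:ℝ)/2) * ξ) = v * ξ * hb⁻¹ by rw [← hc]; ring]
    push_cast; ring
  rw [e1]
  congr 5 <;> ring

theorem wg_integrable (hb : ℝ) (h : 0 < hb) (n : ℕ) (x ξ : ℝ) : Integrable (wg hb n x ξ) := by
  rw [funext (wg_eq hb h n x ξ)]
  exact (wf_integrable n _ _).comp_mul_left' (by positivity)

theorem wg_integral (hb : ℝ) (h : 0 < hb) (n : ℕ) (x ξ : ℝ) :
    ∫ v, wg hb n x ξ v = (((hb^(-(1:ℝ)/2))⁻¹ * 2 * ((-1)^n * lf n (2*(x^2+ξ^2)/hb)) : ℝ) : ℂ) := by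
  rw [funext (wg_eq hb h n x ξ)]
  rw [Measure.integral_comp_mul_left, wf_integral, abs_of_pos (by positivity)]
  have : 2 * ((hb^(-(1:ℝ)/2) * x)^2 + (hb^(-(1:ℝ)/2) * ξ)^2) = 2*(x^2+ξ^2)/hb := by
    have hc := cc hb h
    generalize hb^(-(1:ℝ)/2) = c at hc ⊢
    rw [div_eq_mul_inv, ← hc]; ring
  rw [this, Complex.real_smul]
  push_cast; ring

theorem wigner_eq (k : ℕ) (hb : ℝ) (h : 0 < hb) (N : ℕ) (x ξ : Fin (k+1) → ℝ) :
    wigner (k+1) hb N x ξ =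
      ((((2*π*hb)^(k+1))⁻¹ * (2^(k+1) * bk k N (4 * Hfun x ξ / hb)) : ℝ) : ℂ) := by
  unfold wigner
  rw [Complex.ofReal_mul]
  congr 1
  set A := (hb ^ (-((k+1 : ℕ) : ℝ) / 4)) with hA
  have hA2 : A * A = (hb^(-(1:ℝ)/2))^(k+1) := by
    rw [hA, ← Real.rpow_add h, ← Real.rpow_natCast, ← Real.rpow_mul h.le]; congr 1; ring
  have e : (fun v : Fin (k+1) → ℝ =>
      ((projKer (k+1) hb N (fun j => x j + v j / 2) (fun j => x j - v j / 2) : ℝ) : ℂ) *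
        Complex.exp (-Complex.I * (dotR v ξ : ℂ) / (hb : ℂ))) = fun v =>
      ∑ α ∈ Finset.Nat.antidiagonalTuple (k+1) N, ((A * A : ℝ) : ℂ) * ∏ j, wg hb (α j) (x j) (ξ j) (v j) := by
    ext v
    unfold projKer
    rw [Complex.ofReal_sum, Finset.sum_mul]
    apply Finset.sum_congr rfl
    intro α _
    unfold hermiteProdH hermiteProd wg dotR
    rw [Finset.prod_mul_distrib, ← Complex.exp_sum, ← Complex.ofReal_prod, Finset.prod_mul_distrib]
    have e1 : -Complex.I * ((∑ j, v j * ξ j : ℝ) : ℂ) / hb = ∑ j, (-Complex.I * ((v j * ξ j : ℝ) : ℂ) / hb) := by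
      rw [Complex.ofReal_sum, Finset.mul_sum, Finset.sum_div]
    rw [e1]
    generalize Complex.exp (∑ j, (-Complex.I * ((v j * ξ j : ℝ) : ℂ) / hb)) = T
    simp only [Complex.ofReal_mul, ← hA]
    ring
  rw [e, integral_finsetSum]
  · have e2 : 4 * Hfun x ξ / hb = ∑ j, 2*((x j)^2+(ξ j)^2)/hb := by
      unfold Hfun
      rw [← Finset.sum_div, ← Finset.mul_sum, Finset.sum_add_distrib]; ring
    rw [e2, ← sum_prod_lf, Finset.mul_sum, Complex.ofReal_sum]
    apply Finset.sum_congr rfl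
    intro α _
    rw [integral_const_mul, integral_fintype_prod_volume_eq_prod (fun j => wg hb (α j) (x j) (ξ j))]
    simp only [wg_integral hb h]
    rw [← Complex.ofReal_prod, ← Complex.ofReal_mul, hA2]
    congr 1
    rw [Finset.prod_mul_distrib]
    simp only [Finset.prod_const, Finset.card_univ, Fintype.card_fin]
    rw [← mul_assoc, ← mul_pow, ← mul_assoc, mul_inv_cancel₀ (by positivity), one_mul]
  · intro α _
    apply Integrable.const_mul
    exact Integrable.fintype_prod fun j => wg_integrable hb h _ _ _

theorem wignerBulk_eq (k : ℕ) (hb E₁ E₂ : ℝ) (h : 0 < hb) (h12 : E₁ < E₂)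
    (hs : hb * (k+1) ≤ E₁) (x ξ : Fin (k+1) → ℝ) :
    ∃ n₁ n₂ : ℕ, |n₁ * hb - E₁| ≤ (k+3) * hb ∧ |n₂ * hb - E₂| ≤ (k+3) * hb ∧
      wignerBulk (k+1) hb E₁ E₂ x ξ = ((((2*π*hb)^(k+1))⁻¹ *
        (2^(k+1) * Sk k n₂ (4 * Hfun x ξ / hb) - 2^(k+1) * Sk k n₁ (4 * Hfun x ξ / hb)) : ℝ) : ℂ) := by
  have hk : (0:ℝ) ≤ k := by positivity
  set a₁ := E₁ / hb - (k+1)/2 with ha₁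
  set a₂ := E₂ / hb - (k+1)/2 with ha₂
  have e1 : a₁ * hb = E₁ - (k+1)/2 * hb := by rw [ha₁]; field_simp
  have e2 : a₂ * hb = E₂ - (k+1)/2 * hb := by rw [ha₂]; field_simp
  have p1 : 0 ≤ a₁ := by
    by_contra hc; push Not at hc
    nlinarith [mul_neg_of_neg_of_pos hc h, mul_nonneg hk h.le]
  have a12 : a₁ < a₂ := by rw [ha₁, ha₂]; gcongr
  have p2 : 0 ≤ a₂ := p1.trans a12.le
  have c1 := Nat.le_ceil a₁
  have c2 := Nat.ceil_lt_add_one p1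
  have f1 := Nat.floor_le p2
  have f2 := Nat.lt_floor_add_one a₂
  refine ⟨⌈a₁⌉₊, ⌊a₂⌋₊ + 1, ?_, ?_, ?_⟩
  · have := mul_le_mul_of_nonneg_right c1 h.le
    have := mul_lt_mul_of_pos_right c2 h
    have := mul_nonneg hk h.le
    rw [abs_le]; constructor <;> nlinarith
  · have := mul_le_mul_of_nonneg_right f1 h.le
    have := mul_lt_mul_of_pos_right f2 h
    have := mul_nonneg hk h.le
    push_cast
    rw [abs_le]; constructor <;> nlinarith
  · have hle : ⌈a₁⌉₊ ≤ ⌊a₂⌋₊ + 1 := by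
      have : (⌈a₁⌉₊ : ℝ) < ((⌊a₂⌋₊ + 1 + 1 : ℕ) : ℝ) := by push_cast; linarith
      have := Nat.cast_lt.mp this
      omega
    have hiff : ∀ N : ℕ, (E₁ ≤ hb * ((N:ℝ) + ((k+1 : ℕ):ℝ)/2) ∧ hb * ((N:ℝ) + ((k+1 : ℕ):ℝ)/2) ≤ E₂) ↔
        N ∈ Finset.Ico ⌈a₁⌉₊ (⌊a₂⌋₊ + 1) := by
      intro N
      rw [Finset.mem_Ico, Nat.lt_succ_iff, Nat.le_floor_iff p2, Nat.ceil_le, ha₁, ha₂]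
      rw [sub_le_iff_le_add, le_sub_iff_add_le, div_le_iff₀ h, le_div_iff₀ h]
      push_cast
      rw [mul_comm hb]
    unfold wignerBulk
    rw [tsum_eq_sum (s := Finset.Ico ⌈a₁⌉₊ (⌊a₂⌋₊ + 1))]
    · rw [← mul_sub, Sk, Sk, ← Finset.sum_Ico_eq_sub _ hle, Finset.mul_sum, Finset.mul_sum, Complex.ofReal_sum]
      apply Finset.sum_congr rfl
      intro N hN
      rw [if_pos ((hiff N).2 hN), wigner_eq k hb h]
    · intro N hN
      rw [if_neg (fun hc => hN ((hiff N).1 hc))]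

theorem case_a (k : ℕ) (H E M : ℝ) (hH : 0 < H) (hE : H < E) (hM : 0 < M) :
    ∃ C : ℝ, 0 < C ∧ ∃ h₀ : ℝ, 0 < h₀ ∧ ∀ hb : ℝ, 0 < hb → hb ≤ h₀ → ∀ n : ℕ, |n * hb - E| ≤ M * hb →
      |2^(k+1) * Sk k n (4 * H / hb) - 1| ≤ C * √hb := by
  have hE0 : 0 < E := hH.trans hE
  obtain ⟨C, hC, hb'⟩ := bulk_Sk k (2*H/E) (8*H/(E+H)) (by positivity)
    (by rw [div_lt_iff₀ (by positivity)]; linarith)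
  refine ⟨C / √(E/2) + 1, by positivity, (E-H)/(2*M), by apply div_pos <;> linarith, ?_⟩
  intro hb h0 h1 n hn
  rw [le_div_iff₀ (by positivity)] at h1
  rw [abs_le] at hn
  have l1 : (E+H)/2 ≤ n * hb := by linarith
  have l2 : n * hb ≤ 2 * E := by linarith
  have hnpos : 1 ≤ n := by
    rcases Nat.eq_zero_or_pos n with rfl | h
    · simp at l1; linarith
    · exact h
  have hn0 : (0:ℝ) < n := by exact_mod_cast hnpos
  have key := hb' n hnpos (4*H/hb) (by
      rw [le_div_iff₀ h0, mul_assoc, div_mul_eq_mul_div, div_le_iff₀ hE0]; nlinarith) (by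
      rw [div_le_iff₀ h0, mul_assoc, div_mul_eq_mul_div, le_div_iff₀ (by positivity)]; nlinarith)
  refine key.trans ?_
  have s : √(E/2) ≤ √n * √hb := by
    rw [← Real.sqrt_mul hn0.le]; apply Real.sqrt_le_sqrt; linarith
  have s1 : 0 < √(E/2) := by positivity
  have s2 : 0 < √(n:ℝ) := by positivity
  have s3 : 0 < √hb := by positivity
  have : C / √n ≤ C / √(E/2) * √hb := by
    rw [div_mul_eq_mul_div, div_le_div_iff₀ s2 s1]
    nlinarith
  nlinarith

theorem case_b (k κ : ℕ) (H E M : ℝ) (hE0 : 0 < E) (hE : E < H) (hM : 0 < M) :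
    ∃ C : ℝ, 0 < C ∧ ∃ h₀ : ℝ, 0 < h₀ ∧ ∀ hb : ℝ, 0 < hb → hb ≤ h₀ → ∀ n : ℕ, |n * hb - E| ≤ M * hb →
      |2^(k+1) * Sk k n (4 * H / hb)| ≤ C * hb^κ := by
  have hH : 0 < H := hE0.trans hE
  obtain ⟨C, hC, hb'⟩ := Sk_tail ((E+H)/(2*H)) (by positivity)
    (by rw [div_lt_iff₀ (by positivity)]; linarith) k κ
  refine ⟨2^(k+1) * (C / (4*H)^κ), by positivity, min ((H-E)/(2*M)) (4*H),
    lt_min (by apply div_pos <;> linarith) (by positivity), ?_⟩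
  intro hb h0 h1 n hn
  obtain ⟨h1, h2⟩ := le_min_iff.1 h1
  rw [le_div_iff₀ (by positivity)] at h1
  rw [abs_le] at hn
  have l2 : n * hb ≤ (E+H)/2 := by linarith
  have key := hb' n (4*H/hb) (by rw [le_div_iff₀ h0]; linarith) (by
      rw [← mul_div_assoc, le_div_iff₀ h0, div_mul_eq_mul_div, le_div_iff₀ (by positivity)]; nlinarith)
  rw [abs_mul, abs_of_pos (by positivity), mul_assoc]
  refine mul_le_mul_of_nonneg_left (key.trans (le_of_eq ?_)) (by positivity)
  rw [div_pow]; field_simp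

theorem pref (d : ℕ) (hb : ℝ) (h : 0 < hb) : ((2*π*hb)^d)⁻¹ ≤ (hb^d)⁻¹ := by
  apply inv_anti₀ (by positivity)
  apply pow_le_pow_left₀ h.le
  nlinarith [Real.pi_gt_three]

theorem rpow_aux (d : ℕ) (hb : ℝ) (h : 0 < hb) : hb ^ (-(d:ℝ) + 1/2) = (hb^d)⁻¹ * √hb := by
  rw [Real.rpow_add h, Real.rpow_neg h.le, Real.rpow_natCast, Real.sqrt_eq_rpow]

theorem sqrt_aux (hb : ℝ) (h : 0 < hb) (h1 : hb ≤ 1) : hb ≤ √hb := by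
  apply Real.le_sqrt_of_sq_le; nlinarith

theorem norm_aux (P D : ℝ) (hP : 0 ≤ P) : ‖((P * D : ℝ) : ℂ)‖ = P * |D| := by
  rw [Complex.norm_real, norm_mul, Real.norm_of_nonneg hP]; rfl

/-- **Interior/exterior asymptotics for bulk Wigner–Weyl sums**: the bulk sum is
`(2πħ)^{-d}(1 + O(ħ^{1/2}))` inside the shell, `O(ħ^{-d+1/2})` below it, and `O(ħ^∞)`
above it. -/
theorem wigner_bulk_leading (d : ℕ) (hd : 1 ≤ d) (E₁ E₂ : ℝ) (hE₁ : 0 < E₁)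
    (hE₁₂ : E₁ < E₂) (x ξ : Fin d → ℝ) :
    (E₁ < Hfun x ξ → Hfun x ξ < E₂ →
      ∃ C : ℝ, 0 < C ∧ ∃ hb₀ : ℝ, 0 < hb₀ ∧ ∀ hb : ℝ, 0 < hb → hb ≤ hb₀ →
        ‖wignerBulk d hb E₁ E₂ x ξ - ((((2 * π * hb) ^ d)⁻¹ : ℝ) : ℂ)‖ ≤
          C * hb ^ (-(d : ℝ) + 1 / 2)) ∧
    (0 < Hfun x ξ → Hfun x ξ < E₁ →
      ∃ C : ℝ, 0 < C ∧ ∃ hb₀ : ℝ, 0 < hb₀ ∧ ∀ hb : ℝ, 0 < hb → hb ≤ hb₀ →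
        ‖wignerBulk d hb E₁ E₂ x ξ‖ ≤ C * hb ^ (-(d : ℝ) + 1 / 2)) ∧
    (E₂ < Hfun x ξ →
      ∀ κ : ℕ, ∃ C : ℝ, 0 < C ∧ ∃ hb₀ : ℝ, 0 < hb₀ ∧ ∀ hb : ℝ, 0 < hb → hb ≤ hb₀ →
        ‖wignerBulk d hb E₁ E₂ x ξ‖ ≤ C * hb ^ κ) := by
  obtain ⟨k, rfl⟩ : ∃ k, d = k + 1 := ⟨d - 1, by omega⟩
  have hM : (0:ℝ) < k + 3 := by positivity
  have hk1 : (0:ℝ) < k + 1 := by positivity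
  have hE₂ : 0 < E₂ := hE₁.trans hE₁₂
  refine ⟨?_, ?_, ?_⟩
  · intro h1 h2
    have hH : 0 < Hfun x ξ := hE₁.trans h1
    obtain ⟨C₂, hC₂, a₂, ha₂, H₂⟩ := case_a k (Hfun x ξ) E₂ (k+3) hH h2 hM
    obtain ⟨C₁, hC₁, a₁, ha₁, H₁⟩ := case_b k 1 (Hfun x ξ) E₁ (k+3) hE₁ h1 hM
    refine ⟨C₁ + C₂, by positivity, min (min a₁ a₂) (min 1 (E₁/(k+1))), by positivity, ?_⟩
    intro hb h0 hle
    simp only [le_min_iff] at hle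
    obtain ⟨⟨l1, l2⟩, l3, l4⟩ := hle
    rw [le_div_iff₀ hk1] at l4
    obtain ⟨n₁, n₂, m₁, m₂, hW⟩ := wignerBulk_eq k hb E₁ E₂ h0 hE₁₂ l4 x ξ
    have q1 := H₁ hb h0 l1 n₁ m₁
    have q2 := H₂ hb h0 l2 n₂ m₂
    rw [hW, ← Complex.ofReal_sub]
    set P := ((2*π*hb)^(k+1))⁻¹ with hP
    have hP0 : 0 ≤ P := by positivity
    have e : ∀ A B : ℝ, P * (A - B) - P = P * ((A - 1) - B) := by intros; ring
    rw [e, norm_aux _ _ hP0, rpow_aux _ _ h0]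
    rw [pow_one] at q1
    have q3 := sqrt_aux hb h0 l3
    calc P * _ ≤ (hb^(k+1))⁻¹ * ((C₁+C₂) * √hb) := by
          apply mul_le_mul (pref _ _ h0) _ (abs_nonneg _) (by positivity)
          refine (abs_sub _ _).trans ?_
          nlinarith
      _ = _ := by ring
  · intro h1 h2
    obtain ⟨C₂, hC₂, a₂, ha₂, H₂⟩ := case_a k (Hfun x ξ) E₂ (k+3) h1 (h2.trans hE₁₂) hM
    obtain ⟨C₁, hC₁, a₁, ha₁, H₁⟩ := case_a k (Hfun x ξ) E₁ (k+3) h1 h2 hM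
    refine ⟨C₁ + C₂, by positivity, min (min a₁ a₂) (E₁/(k+1)), by positivity, ?_⟩
    intro hb h0 hle
    simp only [le_min_iff] at hle
    obtain ⟨⟨l1, l2⟩, l4⟩ := hle
    rw [le_div_iff₀ hk1] at l4
    obtain ⟨n₁, n₂, m₁, m₂, hW⟩ := wignerBulk_eq k hb E₁ E₂ h0 hE₁₂ l4 x ξ
    have q1 := H₁ hb h0 l1 n₁ m₁
    have q2 := H₂ hb h0 l2 n₂ m₂
    rw [hW]
    set P := ((2*π*hb)^(k+1))⁻¹ with hP
    have hP0 : 0 ≤ P := by positivity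
    have e : ∀ A B : ℝ, P * (A - B) = P * ((A - 1) - (B - 1)) := by intros; ring
    rw [e, norm_aux _ _ hP0, rpow_aux _ _ h0]
    calc P * _ ≤ (hb^(k+1))⁻¹ * ((C₁+C₂) * √hb) := by
          apply mul_le_mul (pref _ _ h0) _ (abs_nonneg _) (by positivity)
          refine (abs_sub _ _).trans ?_
          nlinarith
      _ = _ := by ring
  · intro h1 κ
    obtain ⟨C₂, hC₂, a₂, ha₂, H₂⟩ := case_b k (κ+(k+1)) (Hfun x ξ) E₂ (k+3) hE₂ h1 hM
    obtain ⟨C₁, hC₁, a₁, ha₁, H₁⟩ := case_b k (κ+(k+1)) (Hfun x ξ) E₁ (k+3) hE₁ (hE₁₂.trans h1) hM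
    refine ⟨C₁ + C₂, by positivity, min (min a₁ a₂) (E₁/(k+1)), by positivity, ?_⟩
    intro hb h0 hle
    simp only [le_min_iff] at hle
    obtain ⟨⟨l1, l2⟩, l4⟩ := hle
    rw [le_div_iff₀ hk1] at l4
    obtain ⟨n₁, n₂, m₁, m₂, hW⟩ := wignerBulk_eq k hb E₁ E₂ h0 hE₁₂ l4 x ξ
    have q1 := H₁ hb h0 l1 n₁ m₁
    have q2 := H₂ hb h0 l2 n₂ m₂
    rw [hW]
    set P := ((2*π*hb)^(k+1))⁻¹ with hP
    have hP0 : 0 ≤ P := by positivity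
    rw [norm_aux _ _ hP0]
    calc P * _ ≤ (hb^(k+1))⁻¹ * ((C₁+C₂) * hb^(κ+(k+1))) := by
          apply mul_le_mul (pref _ _ h0) _ (abs_nonneg _) (by positivity)
          refine (abs_sub _ _).trans ?_
          nlinarith
      _ = _ := by rw [pow_add]; field_simp; ring
end
end

section
/- For every real x > 0 and every y ∈ ℝ, lim_{k→∞} e^{−kx} Σ_{N=0}^{⌊kx + y√k⌋} (kx)^N / N! = Φ(y/√x), the limit being over positive integers k large enough that kx + y√k ≥ 0. (Central-limit asymptotics of partial exponential sums: a Poisson random variable of mean kx, centered at kx and scaled by √k, is asymptotically Gaussian; this is the lemma underlying the Erf interface asymptotics for partial Bergman kernels on Bargmann–Fock space.) -/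
open MeasureTheory Real Filter
open scoped BigOperators ENNReal

noncomputable section

/-- The cumulative distribution function of the standard Gaussian,
`Φ(s) = (2π)^{-1/2} ∫_{-∞}^s e^{-t²/2} dt`. -/
def gaussCDF (s : ℝ) : ℝ :=
  (Real.sqrt (2 * π))⁻¹ * ∫ t in Set.Iic s, Real.exp (-t ^ 2 / 2)

lemma aux_bound (u : ℂ) (hu : ‖u‖ ≤ 1) : ‖Complex.exp u - 1 - u - u ^ 2 / 2‖ ≤ ‖u‖ ^ 3 := by
  have h := Complex.exp_bound (x := u) hu (n := 3) (by norm_num)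
  simp only [Finset.sum_range_succ, Finset.sum_range_zero] at h
  norm_num [Nat.factorial] at h
  have e : Complex.exp u - 1 - u - u ^ 2 / 2 = Complex.exp u - (1 + u + u ^ 2 / 2) := by ring
  rw [e]
  refine h.trans ?_
  nlinarith [pow_nonneg (norm_nonneg u) 3]

lemma aux_lim (t : ℝ) (s : ℕ → ℝ) (hs : Tendsto s atTop atTop) :
    Tendsto (fun k => ((s k : ℂ) ^ 2 * (Complex.exp (((s k)⁻¹ * t : ℝ) * Complex.I) - 1)
      + ((-(s k) * t : ℝ) : ℂ) * Complex.I)) atTop (nhds (-(t : ℂ) ^ 2 / 2)) := by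
  rw [tendsto_iff_norm_sub_tendsto_zero]
  have hi : Tendsto (fun k => (s k)⁻¹) atTop (nhds 0) := hs.inv_tendsto_atTop
  have hb : Tendsto (fun k => |t| ^ 3 * (s k)⁻¹) atTop (nhds 0) := by
    simpa using hi.const_mul (|t| ^ 3)
  refine squeeze_zero' (Eventually.of_forall fun k => norm_nonneg _) ?_ hb
  filter_upwards [hs.eventually_ge_atTop (|t| + 1)] with k hk
  have hpos : 0 < s k := by have := abs_nonneg t; linarith
  have hne : (s k : ℂ) ≠ 0 := by exact_mod_cast hpos.ne'
  set u : ℂ := (((s k)⁻¹ * t : ℝ) : ℂ) * Complex.I with hu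
  have hnu : ‖u‖ = (s k)⁻¹ * |t| := by
    rw [hu, norm_mul, Complex.norm_I, mul_one, Complex.norm_real, Real.norm_eq_abs, abs_mul,
      abs_of_pos (inv_pos.2 hpos)]
  have hle : ‖u‖ ≤ 1 := by
    rw [hnu, inv_mul_le_iff₀ hpos]; linarith
  have hB := aux_bound u hle
  have e : ((s k : ℂ) ^ 2 * (Complex.exp u - 1)
      + ((-(s k) * t : ℝ) : ℂ) * Complex.I) - (-(t : ℂ) ^ 2 / 2)
      = (s k : ℂ) ^ 2 * (Complex.exp u - 1 - u - u ^ 2 / 2) := by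
    have h1 : (s k : ℂ) * u = t * Complex.I := by
      rw [hu]; push_cast; field_simp
    have h2 : (s k : ℂ) ^ 2 * u ^ 2 = - (t : ℂ) ^ 2 := by
      rw [← mul_pow, h1, mul_pow, Complex.I_sq]; ring
    push_cast
    linear_combination (s k : ℂ) * h1 + h2 / 2
  rw [e, norm_mul, norm_pow, Complex.norm_real, Real.norm_eq_abs, abs_of_pos hpos]
  calc s k ^ 2 * _ ≤ s k ^ 2 * ‖u‖ ^ 3 := by gcongr
    _ = _ := by rw [hnu]; field_simp

def poisR (k : ℕ) (x : ℝ) : NNReal := Real.toNNReal ((k : ℝ) * x)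

def poisM (k : ℕ) (x : ℝ) : Measure ℝ :=
  (((ProbabilityTheory.poissonMeasure (poisR k x)).map (Nat.cast : ℕ → ℝ)).map
    ((Real.sqrt (k * x))⁻¹ * ·)).map (· + (-Real.sqrt (k * x)))

instance (k : ℕ) (x : ℝ) : IsProbabilityMeasure (poisM k x) := by
  unfold poisM
  have h1 := Measure.isProbabilityMeasure_map (μ := ProbabilityTheory.poissonMeasure (poisR k x))
    (f := (Nat.cast : ℕ → ℝ)) (by fun_prop)
  have h2 := Measure.isProbabilityMeasure_map
    (μ := (ProbabilityTheory.poissonMeasure (poisR k x)).map (Nat.cast : ℕ → ℝ))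
    (f := ((Real.sqrt (k * x))⁻¹ * ·)) (by fun_prop)
  exact Measure.isProbabilityMeasure_map (by fun_prop)

lemma charFun_poisM (k : ℕ) (x : ℝ) (hx : 0 < x) (t : ℝ) :
    charFun (poisM k x) t = Complex.exp (((Real.sqrt (k * x) : ℂ) ^ 2 *
      (Complex.exp ((((Real.sqrt (k * x))⁻¹ * t : ℝ) : ℂ) * Complex.I) - 1)
      + ((-(Real.sqrt (k * x)) * t : ℝ) : ℂ) * Complex.I)) := by
  unfold poisM
  have h : (((poisR k x : NNReal) : ℝ) : ℂ) = (Real.sqrt (k * x) : ℂ) ^ 2 := by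
    have h0 : 0 ≤ (k : ℝ) * x := by positivity
    rw [← Complex.ofReal_pow, Real.sq_sqrt h0, poisR, Real.coe_toNNReal _ h0]
  rw [charFun_map_add_const, charFun_map_mul, ProbabilityTheory.charFun_map_cast_poissonMeasure,
    Complex.exp_add, h]
  simp [mul_comm]

lemma poisM_Iic (k : ℕ) (x y : ℝ) (hx : 0 < x) (hk : 0 < k)
    (h : 0 ≤ (k : ℝ) * x + y * Real.sqrt (k : ℝ)) :
    (poisM k x).real (Set.Iic (y / Real.sqrt x)) =
        Real.exp (-((k : ℝ) * x)) *
          ∑ N ∈ Finset.range (Nat.floor ((k : ℝ) * x + y * Real.sqrt (k : ℝ)) + 1),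
            ((k : ℝ) * x) ^ N / (N.factorial : ℝ) := by
  have hk' : (0 : ℝ) < k := by exact_mod_cast hk
  have h0 : 0 ≤ (k : ℝ) * x := by positivity
  have hset : (fun n : ℕ => (Real.sqrt (k * x))⁻¹ * (n : ℝ) + (-Real.sqrt (k * x))) ⁻¹'
      (Set.Iic (y / Real.sqrt x)) =
      (Finset.range (Nat.floor ((k : ℝ) * x + y * Real.sqrt (k : ℝ)) + 1) : Set ℕ) := by
    ext n
    simp only [Set.mem_preimage, Set.mem_Iic, Finset.coe_range, Set.mem_Iio, Nat.lt_succ_iff,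
      Nat.le_floor_iff h]
    have hsx : 0 < Real.sqrt x := Real.sqrt_pos.2 hx
    have hsk : 0 < Real.sqrt (k : ℝ) := Real.sqrt_pos.2 hk'
    rw [Real.sqrt_mul hk'.le, ← sub_eq_add_neg, sub_le_iff_le_add, inv_mul_le_iff₀ (by positivity)]
    have e : Real.sqrt k * Real.sqrt x * (y / Real.sqrt x + Real.sqrt k * Real.sqrt x)
        = k * x + y * Real.sqrt k := by
      have h1 := Real.sq_sqrt hx.le
      have h2 := Real.sq_sqrt hk'.le
      have h3 : Real.sqrt x * (y / Real.sqrt x) = y := by field_simp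
      calc _ = Real.sqrt k * (Real.sqrt x * (y / Real.sqrt x))
            + Real.sqrt k ^ 2 * Real.sqrt x ^ 2 := by ring
        _ = _ := by rw [h1, h2, h3]; ring
    rw [e]
  unfold poisM
  rw [Measure.map_map (by fun_prop) (by fun_prop), Measure.map_map (by fun_prop) (by fun_prop),
    map_measureReal_apply (by fun_prop) measurableSet_Iic]
  have : (((fun z : ℝ => z + (-Real.sqrt (k * x))) ∘ ((Real.sqrt (k * x))⁻¹ * ·)) ∘
      (Nat.cast : ℕ → ℝ)) =
      (fun n : ℕ => (Real.sqrt (k * x))⁻¹ * (n : ℝ) + (-Real.sqrt (k * x))) := rfl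
  rw [this, hset, ← sum_measureReal_singleton, Finset.mul_sum]
  refine Finset.sum_congr rfl fun n _ => ?_
  rw [ProbabilityTheory.poissonMeasure_real_singleton, poisR, Real.coe_toNNReal _ h0, mul_div_assoc]

lemma gauss_Iic (s : ℝ) : (ProbabilityTheory.gaussianReal 0 1).real (Set.Iic s) = gaussCDF s := by
  rw [measureReal_def, ProbabilityTheory.gaussianReal_apply_eq_integral _ one_ne_zero,
    ENNReal.toReal_ofReal
      (integral_nonneg fun _ => ProbabilityTheory.gaussianPDFReal_nonneg _ _ _), gaussCDF,
    ← integral_const_mul]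
  simp [ProbabilityTheory.gaussianPDFReal_def]

/-- **Central-limit asymptotics of partial exponential sums**: for `x > 0` and `y ∈ ℝ`,
`e^{-kx} Σ_{N=0}^{⌊kx + y√k⌋} (kx)^N/N! → Φ(y/√x)` as `k → ∞`. -/
theorem poisson_partial_sum_clt (x : ℝ) (hx : 0 < x) (y : ℝ) :
    Filter.Tendsto (fun k : ℕ =>
        Real.exp (-((k : ℝ) * x)) *
          ∑ N ∈ Finset.range (Nat.floor ((k : ℝ) * x + y * Real.sqrt (k : ℝ)) + 1),
            ((k : ℝ) * x) ^ N / (N.factorial : ℝ))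
      Filter.atTop (nhds (gaussCDF (y / Real.sqrt x))) := by
  let P : ℕ → ProbabilityMeasure ℝ := fun k => ⟨poisM k x, inferInstance⟩
  let G : ProbabilityMeasure ℝ := ⟨ProbabilityTheory.gaussianReal 0 1, inferInstance⟩
  have hconv : Tendsto P atTop (nhds G) := by
    apply ProbabilityMeasure.tendsto_of_tendsto_charFun
    intro t
    simp only [P, G, ProbabilityMeasure.coe_mk, charFun_poisM _ x hx,
      ProbabilityTheory.charFun_gaussianReal]
    have hs : Tendsto (fun k : ℕ => Real.sqrt (k * x)) atTop atTop :=
      Real.tendsto_sqrt_atTop.comp (tendsto_natCast_atTop_atTop.atTop_mul_const hx)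
    have := (Complex.continuous_exp.tendsto _).comp (aux_lim t _ hs)
    refine this.congr' (Eventually.of_forall fun _ => rfl) |>.trans (le_of_eq ?_)
    congr 2
    simp
    ring
  have hP := ProbabilityMeasure.tendsto_measure_of_null_frontier_of_tendsto' hconv
    (E := Set.Iic (y / Real.sqrt x)) (by
      rw [frontier_Iic]
      exact ProbabilityTheory.gaussianReal_absolutelyContinuous 0 one_ne_zero
        (Real.volume_singleton))
  have hR := (ENNReal.tendsto_toReal (measure_ne_top _ _)).comp hP
  rw [← gauss_Iic]
  refine hR.congr' ?_
  have hlim : Tendsto (fun k : ℕ => Real.sqrt (k : ℝ)) atTop atTop :=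
    Real.tendsto_sqrt_atTop.comp tendsto_natCast_atTop_atTop
  filter_upwards [eventually_gt_atTop 0, hlim.eventually_ge_atTop (-y / x)] with k hk hy
  refine poisM_Iic k x y hx hk ?_
  have h1 : Real.sqrt (k : ℝ) ^ 2 = k := Real.sq_sqrt (Nat.cast_nonneg k)
  have h2 : 0 ≤ Real.sqrt (k : ℝ) := Real.sqrt_nonneg _
  rw [div_le_iff₀ hx] at hy
  have h3 : 0 ≤ Real.sqrt (k : ℝ) * (Real.sqrt (k : ℝ) * x + y) :=
    mul_nonneg h2 (by linarith)
  calc (0 : ℝ) ≤ _ := h3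
    _ = Real.sqrt (k : ℝ) ^ 2 * x + y * Real.sqrt k := by ring
    _ = _ := by rw [h1]
end
end

section
/- For every integer m ≥ 0, every real x > 0 and every y ∈ ℝ, lim_{k→∞} e^{−kx} Σ_{N=0}^{⌊kx + y√k⌋} (kx)^N N^m / (N+m)! = Φ(y/√x), the limit being over positive integers k large enough that kx + y√k ≥ 0. (This weighted central-limit asymptotic, with weights N^m/(N+m)! replacing 1/N!, is the analytic content of the paper's interface theorem for the Bargmann–Fock space of a line bundle: the partial density of states of the degree operator exhibits Gaussian-error-function interface behavior across the boundary of a disc bundle.) -/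
open MeasureTheory Real Filter
open scoped BigOperators ENNReal

noncomputable section

open ProbabilityTheory Topology

lemma aux_exp_tendsto (t : ℝ) :
    Tendsto (fun l : ℝ => (l : ℂ) * (Complex.exp (((√l)⁻¹ * t : ℝ) * Complex.I) - 1)
      - ((t * (√l) : ℝ) : ℂ) * Complex.I) atTop (𝓝 (-(t : ℂ) ^ 2 / 2)) := by
  have hs : Tendsto (fun l : ℝ => (√l)⁻¹) atTop (𝓝 0) :=
    tendsto_inv_atTop_zero.comp Real.tendsto_sqrt_atTop
  have hb : Tendsto (fun l : ℝ => (√l)⁻¹ * (|t| ^ 3 * Real.exp ((√l)⁻¹ * |t|))) atTop (𝓝 0) := by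
    have h2 : Tendsto (fun l : ℝ => |t| ^ 3 * Real.exp ((√l)⁻¹ * |t|)) atTop
        (𝓝 (|t| ^ 3 * Real.exp (0 * |t|))) :=
      ((Real.continuous_exp.tendsto _).comp (hs.mul_const _)).const_mul _
    simpa using hs.mul h2
  rw [tendsto_iff_norm_sub_tendsto_zero]
  refine squeeze_zero' (.of_forall fun _ => norm_nonneg _) ?_ hb
  filter_upwards [eventually_gt_atTop 0] with l hl
  have hq : 0 < √l := Real.sqrt_pos.2 hl
  have hll : l = √l * √l := (Real.mul_self_sqrt hl.le).symm
  generalize √l = q at *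
  subst hll
  have h := Complex.norm_exp_sub_sum_le_norm_mul_exp (((q⁻¹ * t : ℝ) : ℂ) * Complex.I) 3
  have hn : ‖((q⁻¹ * t : ℝ) : ℂ) * Complex.I‖ = q⁻¹ * |t| := by
    rw [norm_mul, Complex.norm_I, mul_one, Complex.norm_real, Real.norm_eq_abs, abs_mul,
      abs_of_pos (inv_pos.2 hq)]
  rw [hn] at h
  have hqc : (q : ℂ) ≠ 0 := by exact_mod_cast hq.ne'
  have e : (((q * q : ℝ)) : ℂ) * (Complex.exp (((q⁻¹ * t : ℝ) : ℂ) * Complex.I) - 1)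
      - ((t * q : ℝ) : ℂ) * Complex.I - (-(t : ℂ) ^ 2 / 2)
      = ((q * q : ℝ) : ℂ) * (Complex.exp (((q⁻¹ * t : ℝ) : ℂ) * Complex.I)
        - ∑ m ∈ Finset.range 3, (((q⁻¹ * t : ℝ) : ℂ) * Complex.I) ^ m / (m.factorial : ℂ)) := by
    generalize Complex.exp (((q⁻¹ * t : ℝ) : ℂ) * Complex.I) = E
    simp only [Finset.sum_range_succ, Finset.sum_range_zero]
    push_cast
    simp only [mul_pow, Complex.I_sq, Nat.factorial]
    field_simp
    push_cast
    ring_nf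
    try simp only [Complex.I_sq]
    try ring
  rw [e, norm_mul, Complex.norm_real, Real.norm_eq_abs, abs_of_pos hl]
  calc q * q * _ ≤ q * q * ((q⁻¹ * |t|) ^ 3 * Real.exp (q⁻¹ * |t|)) := by gcongr
    _ = _ := by field_simp

lemma aux_poisson_clt (x : ℝ) (hx : 0 < x) (s : ℝ) :
    Tendsto (fun k : ℕ => (poissonMeasure (Real.toNNReal (k * x))).real
      {n : ℕ | (√(k * x))⁻¹ * (n : ℝ) + -√(k * x) ≤ s}) atTop (𝓝 (gaussCDF s)) := by
  let f : ℕ → ℝ → ℝ := fun k u => (√(k * x))⁻¹ * u + -√(k * x)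
  have hf : ∀ k, Measurable (f k) := fun k => by fun_prop
  let P : ℕ → Measure ℝ := fun k =>
    (((poissonMeasure (Real.toNNReal (k * x))).map (Nat.cast : ℕ → ℝ)).map
      ((√(k * x))⁻¹ * ·)).map (· + -√(k * x))
  have hP : ∀ k, IsProbabilityMeasure (P k) := fun k => by
    have : IsProbabilityMeasure (((poissonMeasure (Real.toNNReal (k * x))).map (Nat.cast : ℕ → ℝ)).map
      ((√(k * x))⁻¹ * ·)) := Measure.isProbabilityMeasure_map (by fun_prop)
    exact Measure.isProbabilityMeasure_map (by fun_prop)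
  let μ : ℕ → ProbabilityMeasure ℝ := fun k => ⟨P k, hP k⟩
  let μ₀ : ProbabilityMeasure ℝ := ⟨gaussianReal 0 1, inferInstance⟩
  have hlim : Tendsto μ atTop (𝓝 μ₀) := by
    rw [ProbabilityMeasure.tendsto_iff_tendsto_charFun]
    intro t
    have hk : Tendsto (fun k : ℕ => (k : ℝ) * x) atTop atTop :=
      tendsto_natCast_atTop_atTop.atTop_mul_const hx
    have h := (Complex.continuous_exp.tendsto _).comp ((aux_exp_tendsto t).comp hk)
    have h0 : charFun (μ₀ : Measure ℝ) t = Complex.exp (-(t : ℂ) ^ 2 / 2) := by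
      change charFun (gaussianReal 0 1) t = _
      rw [charFun_gaussianReal]
      congr 1
      simp
      ring
    rw [h0]
    refine h.congr fun k => ?_
    change _ = charFun (P k) t
    have hkx : 0 ≤ (k : ℝ) * x := by positivity
    simp only [P]
    rw [charFun_map_add_const, charFun_map_mul, charFun_map_cast_poissonMeasure,
      ← Complex.exp_add]
    simp only [Function.comp]
    congr 1
    rw [Real.coe_toNNReal _ hkx]
    simp [Real.inner_apply]
    ring
  have hfr : (μ₀ : Measure ℝ) (frontier (Set.Iic s)) = 0 := by
    rw [frontier_Iic]
    change gaussianReal 0 1 {s} = 0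
    have := noAtoms_gaussianReal (μ := 0) (v := 1) (by simp)
    simp
  have key := ProbabilityMeasure.tendsto_measure_of_null_frontier_of_tendsto' hlim hfr
  have key2 := (ENNReal.tendsto_toReal (measure_ne_top (μ₀ : Measure ℝ) (Set.Iic s))).comp key
  have hg : ((μ₀ : Measure ℝ) (Set.Iic s)).toReal = gaussCDF s := by
    change ((gaussianReal 0 1) (Set.Iic s)).toReal = _
    rw [gaussianReal_apply_eq_integral 0 (by simp),
      ENNReal.toReal_ofReal (integral_nonneg fun _ => gaussianPDFReal_nonneg _ _ _), gaussCDF,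
      ← integral_const_mul]
    simp [gaussianPDFReal]
  rw [hg] at key2
  refine key2.congr fun k => ?_
  change ((P k) (Set.Iic s)).toReal = _
  simp only [P]
  rw [Measure.map_apply (by fun_prop) measurableSet_Iic, Measure.map_apply (by fun_prop)
    (measurableSet_Iic.preimage (by fun_prop)), Measure.map_apply (by fun_prop)
    ((measurableSet_Iic.preimage (by fun_prop)).preimage (by fun_prop))]
  rfl

lemma aux_weight (m : ℕ) : Tendsto (fun N : ℕ => (N : ℝ) ^ m * (N.factorial : ℝ) /
    ((N + m).factorial : ℝ)) atTop (𝓝 1) := by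
  induction m with
  | zero =>
    refine tendsto_const_nhds.congr fun N => ?_
    have : (N.factorial : ℝ) ≠ 0 := by positivity
    simp [this]
  | succ m ih =>
    have h := ih.mul (tendsto_natCast_div_add_atTop ((m : ℝ) + 1))
    rw [one_mul] at h
    refine h.congr fun N => ?_
    rw [← add_assoc N m 1, Nat.factorial_succ]
    have : ((N + m).factorial : ℝ) ≠ 0 := by positivity
    have : (N : ℝ) + (m + 1) ≠ 0 := by positivity
    have : (N : ℝ) + m + 1 ≠ 0 := by positivity
    push_cast
    field_simp
    try ring

lemma aux_weight_le (m N : ℕ) : (N : ℝ) ^ m * (N.factorial : ℝ) /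
    ((N + m).factorial : ℝ) ≤ 1 := by
  rw [div_le_one (by positivity)]
  have h := Nat.factorial_mul_pow_le_factorial (m := N) (n := m)
  have h2 : N ^ m * N.factorial ≤ (N + m).factorial := by
    refine le_trans ?_ h
    rw [mul_comm]
    gcongr
    omega
  exact_mod_cast h2

lemma aux_partial (x : ℝ) (hx : 0 < x) (M : ℕ) :
    Tendsto (fun k : ℕ => ∑ N ∈ Finset.range M,
      Real.exp (-((k : ℝ) * x)) * ((k : ℝ) * x) ^ N / (N.factorial : ℝ)) atTop (𝓝 0) := by
  have hk : Tendsto (fun k : ℕ => (k : ℝ) * x) atTop atTop :=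
    tendsto_natCast_atTop_atTop.atTop_mul_const hx
  have : ∀ N ∈ Finset.range M, Tendsto (fun k : ℕ =>
      Real.exp (-((k : ℝ) * x)) * ((k : ℝ) * x) ^ N / (N.factorial : ℝ)) atTop (𝓝 0) := by
    intro N _
    have h := ((Real.tendsto_pow_mul_exp_neg_atTop_nhds_zero N).comp hk).div_const (N.factorial : ℝ)
    rw [zero_div] at h
    refine h.congr fun k => ?_
    simp [mul_comm]
  simpa using tendsto_finsetSum _ this

lemma aux_diff (m : ℕ) (x : ℝ) (hx : 0 < x) (R : ℕ → ℕ) :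
    Tendsto (fun k : ℕ => ∑ N ∈ Finset.range (R k),
      Real.exp (-((k : ℝ) * x)) * ((k : ℝ) * x) ^ N / (N.factorial : ℝ) *
        (1 - (N : ℝ) ^ m * (N.factorial : ℝ) / ((N + m).factorial : ℝ))) atTop (𝓝 0) := by
  rw [Metric.tendsto_atTop']
  intro ε hε
  obtain ⟨M, hM⟩ := (Metric.tendsto_atTop.1 (aux_weight m)) (ε / 2) (by positivity)
  obtain ⟨K, hK⟩ := (Metric.tendsto_atTop.1 (aux_partial x hx M)) (ε / 2) (by positivity)
  refine ⟨K, fun k hk => ?_⟩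
  have hK := hK k hk.le
  set p : ℕ → ℝ := fun N => Real.exp (-((k : ℝ) * x)) * ((k : ℝ) * x) ^ N / (N.factorial : ℝ)
    with hp
  have hp0 : ∀ N, 0 ≤ p N := fun N => by simp only [hp]; positivity
  set w : ℕ → ℝ := fun N => (N : ℝ) ^ m * (N.factorial : ℝ) / ((N + m).factorial : ℝ) with hw
  have hw0 : ∀ N, 0 ≤ w N := fun N => by simp only [hw]; positivity
  have hw1 : ∀ N, w N ≤ 1 := fun N => aux_weight_le m N
  have hsum : HasSum p 1 := by
    have := hasSum_one_poissonMeasure ⟨(k : ℝ) * x, by positivity⟩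
    exact this
  have hle : ∀ N, p N * (1 - w N) ≤ (if N ∈ Finset.range M then p N else 0) + ε / 2 * p N := by
    intro N
    split_ifs with h
    · nlinarith [hp0 N, hw0 N, mul_nonneg (hp0 N) (hw0 N)]
    · have := hM N (by simpa using h)
      rw [Real.dist_eq, abs_lt] at this
      have : 1 - w N ≤ ε / 2 := by have := this.1; simp only [hw]; linarith
      nlinarith [hp0 N]
  have h1 : ∑ N ∈ Finset.range (R k), p N ≤ 1 := sum_le_hasSum _ (fun N _ => hp0 N) hsum
  have h2 : ∑ N ∈ Finset.range (R k), (if N ∈ Finset.range M then p N else 0)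
      ≤ ∑ N ∈ Finset.range M, p N := by
    rw [← Finset.sum_filter]
    exact Finset.sum_le_sum_of_subset_of_nonneg (fun N hN => (Finset.mem_filter.1 hN).2)
      (fun N _ _ => hp0 N)
  have h3 : 0 ≤ ∑ N ∈ Finset.range (R k), p N * (1 - w N) :=
    Finset.sum_nonneg fun N _ => mul_nonneg (hp0 N) (by linarith [hw1 N])
  have h4 := Finset.sum_le_sum (s := Finset.range (R k)) (fun N _ => hle N)
  rw [Finset.sum_add_distrib, ← Finset.mul_sum] at h4
  rw [Real.dist_eq, sub_zero] at hK ⊢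
  rw [abs_of_nonneg h3]
  have h5 := (le_abs_self _).trans_lt hK
  nlinarith


/-- **Weighted central-limit asymptotics**: for every `m ∈ ℕ`, `x > 0` and `y ∈ ℝ`,
`e^{-kx} Σ_{N=0}^{⌊kx + y√k⌋} (kx)^N N^m/(N+m)! → Φ(y/√x)` as `k → ∞`. This is the
analytic content of the Erf interface asymptotics for the partial density of states of
the degree operator on the Bargmann–Fock space of a line bundle. -/
theorem weighted_poisson_partial_sum_clt (m : ℕ) (x : ℝ) (hx : 0 < x) (y : ℝ) :
    Filter.Tendsto (fun k : ℕ =>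
        Real.exp (-((k : ℝ) * x)) *
          ∑ N ∈ Finset.range (Nat.floor ((k : ℝ) * x + y * Real.sqrt (k : ℝ)) + 1),
            ((k : ℝ) * x) ^ N * (N : ℝ) ^ m / ((N + m).factorial : ℝ))
      Filter.atTop (nhds (gaussCDF (y / Real.sqrt x))) := by
  have h1 := (aux_poisson_clt x hx (y / √x)).sub
    (aux_diff m x hx (fun k => Nat.floor ((k : ℝ) * x + y * √(k : ℝ)) + 1))
  rw [sub_zero] at h1
  refine h1.congr' ?_
  have hev : ∀ᶠ k : ℕ in atTop, 0 ≤ (k : ℝ) * x + y * √(k : ℝ) := by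
    have : Tendsto (fun k : ℕ => √(k : ℝ) * x) atTop atTop :=
      (Real.tendsto_sqrt_atTop.comp tendsto_natCast_atTop_atTop).atTop_mul_const hx
    filter_upwards [this.eventually_ge_atTop (-y)] with k hk
    have h0 : (k : ℝ) = √(k : ℝ) * √(k : ℝ) := (Real.mul_self_sqrt (by positivity)).symm
    have h2 := mul_nonneg (Real.sqrt_nonneg (k : ℝ)) (by linarith : 0 ≤ √(k : ℝ) * x + y)
    nlinarith
  filter_upwards [hev, eventually_gt_atTop 0] with k hk hk0
  have hk0' : (0 : ℝ) < k := by exact_mod_cast hk0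
  have hset : {n : ℕ | (√(k * x))⁻¹ * (n : ℝ) + -√(k * x) ≤ y / √x} =
      ↑(Finset.range (Nat.floor ((k : ℝ) * x + y * √(k : ℝ)) + 1)) := by
    ext n
    simp only [Set.mem_setOf_eq, Finset.coe_range, Set.mem_Iio, Nat.lt_add_one_iff]
    rw [Nat.le_floor_iff hk, Real.sqrt_mul hk0'.le]
    have ha : 0 < √(k : ℝ) := Real.sqrt_pos.2 hk0'
    have hb : 0 < √x := Real.sqrt_pos.2 hx
    have ha2 : (k : ℝ) = √(k : ℝ) * √(k : ℝ) := (Real.mul_self_sqrt hk0'.le).symm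
    have hb2 : x = √x * √x := (Real.mul_self_sqrt hx.le).symm
    have e : (k : ℝ) * x + y * √(k : ℝ) = (√(k : ℝ) * √x) * (y / √x + √(k : ℝ) * √x) := by
      have : (k : ℝ) * x = √(k : ℝ) * √x * (√(k : ℝ) * √x) := by
        rw [mul_mul_mul_comm, ← ha2, ← hb2]
      rw [this]
      field_simp
      ring
    rw [e, ← inv_mul_le_iff₀ (by positivity)]
    constructor <;> intro h <;> linarith
  rw [hset, ← sum_measureReal_singleton, ← Finset.sum_sub_distrib, Finset.mul_sum]
  refine Finset.sum_congr rfl fun N _ => ?_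
  rw [poissonMeasure_real_singleton, Real.coe_toNNReal _ (by positivity)]
  have : (N.factorial : ℝ) ≠ 0 := by positivity
  have : ((N + m).factorial : ℝ) ≠ 0 := by positivity
  field_simp
  ring
end
end

section
/- Let m ≥ 1 and let P, Q be complex m×m matrices satisfying P P* − Q Q* = I and P Qᵗ = Q Pᵗ (the conditions that ((P,Q),(Q̄,P̄)) belong to the complex realization of the symplectic group; they imply P is invertible). Then for every k > 0 and all ẑ = (z, θ_z), ŵ = (w, θ_w) ∈ ℂ^m × ℝ, the integral ∫_{ℂ^m × [0,2π]} Π̂_k(ẑ, Â û) Π̂_k(û, ŵ) dVol_X(û), taken over û = (u, θ_u), converges absolutely and equals (k/(2π))^m |det P|^{−1} exp( k [ (1/2) zᵗ (Q̄ P^{−1}) z + w̄ᵗ P^{−1} z − (1/2) w̄ᵗ (P^{−1} Q) w̄ ] ) · exp( k(i θ_z − |z|²/2) ) · exp( k(−i θ_w − |w|²/2) ), where z, w are column vectors, zᵗ denotes transpose and z̄ entrywise complex conjugation. (Toeplitz realization of the metaplectic representation: composing the Bargmann–Fock Szegő kernel with the lift of the linear symplectic map Â reproduces, up to the factor (det P*)^{−1/2},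 the metaplectic propagator kernel.) -/
open MeasureTheory Real Filter
open scoped BigOperators ENNReal

noncomputable section

/-- The lifted Bargmann–Fock Szegő kernel on `X = ℂ^m × ℝ`:
`Π̂_k(ẑ, ŵ) = (k/(2π))^m exp(k[i(θ_z - θ_w) + z·w̄ - |z|²/2 - |w|²/2])`. -/
def szegoBF (m : ℕ) (k : ℝ) (p q : (Fin m → ℂ) × ℝ) : ℂ :=
  (((k / (2 * π)) ^ m : ℝ) : ℂ) *
    Complex.exp ((k : ℂ) *
      (Complex.I * ((p.2 : ℂ) - (q.2 : ℂ)) +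
        (∑ j, p.1 j * (starRingEnd ℂ) (q.1 j)) -
        ((∑ j, Complex.normSq (p.1 j) : ℝ) : ℂ) / 2 -
        ((∑ j, Complex.normSq (q.1 j) : ℝ) : ℂ) / 2))

/-- The contact lift `Â(u, θ) = (Pu + Qū, θ)` of the real-linear symplectic map
determined by the matrices `P, Q`. -/
def symplecticLift (m : ℕ) (P Q : Matrix (Fin m) (Fin m) ℂ)
    (p : (Fin m → ℂ) × ℝ) : (Fin m → ℂ) × ℝ :=
  (fun i => (∑ l, P i l * p.1 l) + ∑ l, Q i l * (starRingEnd ℂ) (p.1 l), p.2)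

section helpers
open scoped Matrix

section
open scoped MatrixOrder
lemma psd_fact {ι : Type*} [Fintype ι] [DecidableEq ι] (N : Matrix ι ι ℝ) (hN : N.PosSemidef) :
    ∃ B : Matrix ι ι ℝ, N = Bᵀ * B := by
  obtain ⟨B, hB⟩ := CStarAlgebra.nonneg_iff_eq_star_mul_self.mp hN.nonneg
  exact ⟨B, by rw [hB, Matrix.star_eq_conjTranspose, Matrix.conjTranspose_eq_transpose_of_trivial]⟩
end

lemma gauss_std {ι : Type*} [Fintype ι] (y0 : ι → ℂ) :
    Integrable (fun y : ι → ℝ => Complex.exp (-∑ i, ((y i : ℂ) - y0 i) ^ 2)) ∧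
    ∫ y : ι → ℝ, Complex.exp (-∑ i, ((y i : ℂ) - y0 i) ^ 2) = ((√π ^ Fintype.card ι : ℝ) : ℂ) := by
  have e : ∀ y : ι → ℝ, Complex.exp (-∑ i, ((y i : ℂ) - y0 i) ^ 2) =
      Complex.exp (-∑ i, (1:ℂ) * (y i : ℂ) ^ 2 + ∑ i, (2 * y0 i) * y i) *
        Complex.exp (-∑ i, (y0 i)^2) := by
    intro y
    rw [← Complex.exp_add]
    congr 1
    simp only [← Finset.sum_neg_distrib, ← Finset.sum_add_distrib]
    exact Finset.sum_congr rfl fun i _ => by ring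
  simp_rw [e]
  refine ⟨(GaussianFourier.integrable_cexp_neg_sum_mul_add (b := fun _ => 1) (by simp) _).mul_const _, ?_⟩
  rw [integral_mul_const, GaussianFourier.integral_cexp_neg_sum_mul_add (b := fun _ => 1) (by simp)]
  rw [Finset.prod_mul_distrib, ← Complex.exp_sum, mul_assoc, ← Complex.exp_add]
  have : ∑ i, (2 * y0 i)^2 / (4 * 1) + -∑ i, (y0 i)^2 = 0 := by
    rw [← Finset.sum_neg_distrib, ← Finset.sum_add_distrib]
    exact Finset.sum_eq_zero fun i _ => by ring
  rw [this]
  have h2 : ((π:ℂ) / 1) ^ (1/2 : ℂ) = ((√π : ℝ) : ℂ) := by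
    rw [div_one, Real.sqrt_eq_rpow, Complex.ofReal_cpow pi_pos.le]; norm_num
  rw [Finset.prod_const, h2]; simp [Finset.card_univ]

lemma gauss_mat {ι : Type*} [Fintype ι] [DecidableEq ι] (B : Matrix ι ι ℝ) (hB : B.det ≠ 0)
    (x0 : ι → ℂ) :
    Integrable (fun x : ι → ℝ => Complex.exp (-∑ i,
      ((B.map Complex.ofReal) *ᵥ (fun j => (x j : ℂ) - x0 j)) i ^ 2)) ∧
    ∫ x : ι → ℝ, Complex.exp (-∑ i,
      ((B.map Complex.ofReal) *ᵥ (fun j => (x j : ℂ) - x0 j)) i ^ 2) =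
      ((√π ^ Fintype.card ι * |B.det|⁻¹ : ℝ) : ℂ) := by
  set y0 := (B.map Complex.ofReal) *ᵥ x0
  obtain ⟨g1, g2⟩ := gauss_std y0
  have e : ∀ x : ι → ℝ, Complex.exp (-∑ i,
      ((B.map Complex.ofReal) *ᵥ (fun j => (x j : ℂ) - x0 j)) i ^ 2) =
      Complex.exp (-∑ i, (((Matrix.toLin' B x) i : ℂ) - y0 i) ^ 2) := by
    intro x
    congr 2
    refine Finset.sum_congr rfl fun i _ => ?_
    congr 1
    simp [y0, Matrix.mulVec, dotProduct, mul_sub]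
  simp_rw [e]
  have hm := Real.map_matrix_volume_pi_eq_smul_volume_pi hB
  have hemb : MeasurableEmbedding (Matrix.toLin' B) := by
    have hdet : IsUnit (LinearMap.det (Matrix.toLin' B)) := by
      rw [LinearMap.det_toLin']; exact hB.isUnit
    exact ((LinearEquiv.ofIsUnitDet (f := Matrix.toLin' B) (v := Pi.basisFun ℝ ι) (v' := Pi.basisFun ℝ ι) (by simpa using hB)).toContinuousLinearEquiv.toHomeomorph.measurableEmbedding)
  constructor
  · have : Integrable (fun y : ι → ℝ => Complex.exp (-∑ i, ((y i : ℂ) - y0 i) ^ 2))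
      (Measure.map (Matrix.toLin' B) volume) := by
      rw [hm]; exact g1.smul_measure (by simp)
    exact (hemb.integrable_map_iff).1 this
  · rw [← hemb.integral_map (fun y : ι → ℝ => Complex.exp (-∑ i, ((y i : ℂ) - y0 i) ^ 2)), hm,
      integral_smul_measure, g2]
    rw [ENNReal.toReal_ofReal (abs_nonneg _), abs_inv]
    simp [mul_comm]

lemma gauss_pd {ι : Type*} [Fintype ι] [DecidableEq ι] (N : Matrix ι ι ℝ) (hN : N.PosDef)
    (x0 : ι → ℂ) :
    Integrable (fun x : ι → ℝ => Complex.exp (-((fun j => (x j : ℂ) - x0 j) ⬝ᵥ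
      ((N.map Complex.ofReal) *ᵥ (fun j => (x j : ℂ) - x0 j))))) ∧
    ∫ x : ι → ℝ, Complex.exp (-((fun j => (x j : ℂ) - x0 j) ⬝ᵥ
      ((N.map Complex.ofReal) *ᵥ (fun j => (x j : ℂ) - x0 j)))) =
      ((√π ^ Fintype.card ι * (√ N.det)⁻¹ : ℝ) : ℂ) := by
  obtain ⟨B, hB⟩ := psd_fact N hN.posSemidef
  have hd : N.det = B.det ^ 2 := by rw [hB]; simp [sq]
  have hB0 : B.det ≠ 0 := by
    intro h; have := hN.det_pos; rw [hd, h] at this; simp at this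
  have := gauss_mat B hB0 x0
  rw [hd, Real.sqrt_sq_eq_abs]
  have e : ∀ v : ι → ℂ, v ⬝ᵥ ((N.map Complex.ofReal) *ᵥ v) =
      ∑ i, ((B.map Complex.ofReal) *ᵥ v) i ^ 2 := by
    intro v
    have h : N.map Complex.ofReal = (B.map Complex.ofReal)ᵀ * B.map Complex.ofReal := by
      rw [hB]
      exact Matrix.map_mul (f := Complex.ofRealHom)
    rw [h, ← Matrix.mulVec_mulVec, Matrix.dotProduct_mulVec, Matrix.vecMul_transpose]
    simp [dotProduct, sq]
  simp_rw [e]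
  exact this

/-- complexified real-linear map -/
def Wmat (m : ℕ) (P Q : Matrix (Fin m) (Fin m) ℂ) : Matrix (Fin m ⊕ Fin m) (Fin m ⊕ Fin m) ℂ :=
  Matrix.fromBlocks P Q (Q.map (starRingEnd ℂ)) (P.map (starRingEnd ℂ))

def Winv (m : ℕ) (P Q : Matrix (Fin m) (Fin m) ℂ) : Matrix (Fin m ⊕ Fin m) (Fin m ⊕ Fin m) ℂ :=
  Matrix.fromBlocks Pᴴ (-Qᵀ) (-Qᴴ) Pᵀ

def Tmat (m : ℕ) : Matrix (Fin m ⊕ Fin m) (Fin m ⊕ Fin m) ℂ :=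
  Matrix.fromBlocks 1 (Complex.I • 1) 1 (-(Complex.I • 1))

def Amat (m : ℕ) (P Q : Matrix (Fin m) (Fin m) ℂ) : Matrix (Fin m ⊕ Fin m) (Fin m ⊕ Fin m) ℝ :=
  Matrix.fromBlocks (P.map Complex.re + Q.map Complex.re) (Q.map Complex.im - P.map Complex.im)
    (P.map Complex.im + Q.map Complex.im) (P.map Complex.re - Q.map Complex.re)

section alg
variable {m : ℕ} {P Q : Matrix (Fin m) (Fin m) ℂ}

lemma map_conj_eq (P : Matrix (Fin m) (Fin m) ℂ) : P.map (starRingEnd ℂ) = Pᴴᵀ := by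
  ext i j; simp

lemma W_mul_inv (h1 : P * Pᴴ - Q * Qᴴ = 1) (h2 : P * Qᵀ = Q * Pᵀ) :
    Wmat m P Q * Winv m P Q = 1 := by
  have h1' := congrArg Matrix.conjTranspose h1
  have h1t := congrArg Matrix.transpose h1
  have h2c := congrArg (fun M => Mᴴᵀ) h2
  simp only [Matrix.transpose_sub, Matrix.transpose_mul, Matrix.transpose_one,
    Matrix.conjTranspose_mul] at h1t h2c
  have e : ∀ M : Matrix (Fin m) (Fin m) ℂ, Mᵀᴴᵀ = Mᴴ := fun M => by ext i j; simp
  rw [e, e] at h2c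
  rw [Wmat, Winv, Matrix.fromBlocks_multiply, map_conj_eq, map_conj_eq,
    ← Matrix.fromBlocks_one]
  congr 1
  · simpa [sub_eq_add_neg] using h1
  · simp [h2]
  · rw [Matrix.mul_neg, ← sub_eq_add_neg, sub_eq_zero, h2c]
  · rw [← h1t]; simp only [Matrix.mul_neg]; abel

lemma rels (h1 : P * Pᴴ - Q * Qᴴ = 1) (h2 : P * Qᵀ = Q * Pᵀ) :
    Pᴴ * P = 1 + Qᵀ * Q.map (starRingEnd ℂ) ∧ Pᴴ * Q = Qᵀ * P.map (starRingEnd ℂ) ∧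
    Qᴴ * P = Pᵀ * Q.map (starRingEnd ℂ) ∧ Pᵀ * P.map (starRingEnd ℂ) = 1 + Qᴴ * Q := by
  have h := mul_eq_one_comm.1 (W_mul_inv h1 h2)
  rw [Wmat, Winv, Matrix.fromBlocks_multiply, ← Matrix.fromBlocks_one,
    Matrix.fromBlocks_inj] at h
  obtain ⟨a, b, c, d⟩ := h
  simp only [Matrix.neg_mul] at a b c d
  refine ⟨?_, ?_, ?_, ?_⟩
  · rw [← a]; abel
  · rwa [← sub_eq_add_neg, sub_eq_zero] at b
  · rw [add_comm, ← sub_eq_add_neg, sub_eq_zero] at c; exact c.symm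
  · rw [← d]; abel

open scoped ComplexOrder in
lemma detP_ne (h1 : P * Pᴴ - Q * Qᴴ = 1) : P.det ≠ 0 := by
  have h : (P * Pᴴ).PosDef := by
    rw [sub_eq_iff_eq_add.1 h1]
    exact Matrix.PosDef.one.add_posSemidef (Matrix.posSemidef_self_mul_conjTranspose Q)
  have := (Matrix.isUnit_iff_isUnit_det _).1 h.isUnit
  rw [Matrix.det_mul] at this
  exact (isUnit_of_mul_isUnit_left this).ne_zero

lemma norm_detW (h1 : P * Pᴴ - Q * Qᴴ = 1) (h2 : P * Qᵀ = Q * Pᵀ) :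
    ‖(Wmat m P Q).det‖ = 1 := by
  have h := congrArg Matrix.det (W_mul_inv h1 h2)
  set K : Matrix (Fin m ⊕ Fin m) (Fin m ⊕ Fin m) ℂ := Matrix.fromBlocks 1 0 0 (-1)
  have hK : K * (Wmat m P Q)ᴴ * K = Winv m P Q := by
    have e : ∀ M : Matrix (Fin m) (Fin m) ℂ, (M.map (starRingEnd ℂ))ᴴ = Mᵀ :=
      fun M => by ext i j; simp
    simp only [K, Wmat, Winv, Matrix.fromBlocks_conjTranspose, Matrix.fromBlocks_multiply, e]
    simp
  have hKK : ‖K.det‖ * ‖K.det‖ = 1 := by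
    rw [← norm_mul, ← Matrix.det_mul]
    simp [K, Matrix.fromBlocks_multiply]
  rw [← hK, Matrix.det_mul, Matrix.det_mul, Matrix.det_mul, Matrix.det_conjTranspose,
    Matrix.det_one] at h
  have h' := congrArg norm h
  simp only [norm_mul, norm_star, norm_one] at h'
  have : ‖(Wmat m P Q).det‖ * ‖(Wmat m P Q).det‖ = 1 := by
    calc _ = ‖(Wmat m P Q).det‖ * ‖(Wmat m P Q).det‖ * (‖K.det‖ * ‖K.det‖) := by rw [hKK, mul_one]
      _ = 1 := by rw [← h']; ring
  nlinarith [norm_nonneg (Wmat m P Q).det]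

lemma W_star (h1 : P * Pᴴ - Q * Qᴴ = 1) (h2 : P * Qᵀ = Q * Pᵀ) :
    (Wmat m P Q)ᴴ * Wmat m P Q + 1 = (2:ℂ) • (Matrix.fromBlocks Pᴴ 0 0 Pᵀ * Wmat m P Q) := by
  have h : (1 : Matrix (Fin m ⊕ Fin m) (Fin m ⊕ Fin m) ℂ) = Winv m P Q * Wmat m P Q :=
    (mul_eq_one_comm.1 (W_mul_inv h1 h2)).symm
  rw [h, ← Matrix.add_mul, ← Matrix.smul_mul]
  congr 1
  have e : ∀ M : Matrix (Fin m) (Fin m) ℂ, (M.map (starRingEnd ℂ))ᴴ = Mᵀ :=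
      fun M => by ext i j; simp
  simp only [Wmat, Winv, Matrix.fromBlocks_conjTranspose, e, Matrix.fromBlocks_add,
    Matrix.fromBlocks_smul]
  congr 1 <;> simp [two_smul]

lemma T_star : (Tmat m)ᴴ * Tmat m = (2:ℂ) • 1 := by
  simp only [Tmat, Matrix.fromBlocks_conjTranspose, Matrix.fromBlocks_multiply]
  rw [← Matrix.fromBlocks_one, Matrix.fromBlocks_smul]
  congr 1 <;> simp [two_smul, smul_smul]

lemma T_A : Tmat m * (Amat m P Q).map Complex.ofReal = Wmat m P Q * Tmat m := by
  simp only [Tmat, Wmat, Amat, Matrix.fromBlocks_map, Matrix.fromBlocks_multiply]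
  congr 1 <;> ext i j <;> apply Complex.ext <;> simp <;> ring

lemma det_AA (h1 : P * Pᴴ - Q * Qᴴ = 1) (h2 : P * Qᵀ = Q * Pᵀ) :
    ‖(((Amat m P Q)ᵀ * Amat m P Q + 1).det : ℂ)‖ = (2 ^ m * ‖P.det‖) ^ 2 := by
  set A := (Amat m P Q).map Complex.ofReal with hA
  have hdet : (((Amat m P Q)ᵀ * Amat m P Q + 1).det : ℂ) = (Aᴴ * A + 1).det := by
    have : Aᴴ * A + 1 = ((Amat m P Q)ᵀ * Amat m P Q + 1).map Complex.ofRealHom := by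
      rw [Matrix.map_add _ (map_add _), Matrix.map_mul, Matrix.map_one _ (map_zero _) (map_one _)]
      congr 2
      ext i j; simp [A]
    rw [this]
    exact RingHom.map_det Complex.ofRealHom _
  rw [hdet]
  have key : (2:ℂ) • (Aᴴ * A + 1) = (Tmat m)ᴴ * ((Wmat m P Q)ᴴ * Wmat m P Q + 1) * Tmat m := by
    have t : (Tmat m * A)ᴴ * (Tmat m * A) = (Wmat m P Q * Tmat m)ᴴ * (Wmat m P Q * Tmat m) := by
      rw [hA, T_A]
    have l : (Tmat m * A)ᴴ * (Tmat m * A) = (2:ℂ) • (Aᴴ * A) := by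
      rw [Matrix.conjTranspose_mul, Matrix.mul_assoc, ← Matrix.mul_assoc _ _ A, T_star]; simp
    rw [smul_add, ← l, t, ← T_star, Matrix.conjTranspose_mul]
    simp only [Matrix.mul_add, Matrix.add_mul, Matrix.mul_assoc, Matrix.mul_one]
  rw [W_star h1 h2] at key
  have hT := congrArg (fun M => ‖M.det‖) (T_star (m := m))
  have hk := congrArg (fun M => ‖M.det‖) key
  simp only [Matrix.det_mul, Matrix.det_smul, norm_mul, norm_pow, Matrix.det_one,
    Matrix.det_fromBlocks_zero₂₁, Matrix.det_conjTranspose, Matrix.det_transpose, norm_star,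
    norm_detW h1 h2, Complex.norm_ofNat, Fintype.card_sum, Fintype.card_fin,
    mul_one] at hT hk
  have p : (0:ℝ) < 2 ^ (m + m) := by positivity
  have : (2:ℝ) ^ (m+m) * ‖(Aᴴ * A + 1).det‖ = 2 ^ (m+m) * (2 ^ m * ‖P.det‖) ^ 2 := by
    rw [hk]
    calc _ = (‖(Tmat m).det‖ * ‖(Tmat m).det‖) * (2 ^ (m + m) * (‖P.det‖ * ‖P.det‖)) := by ring
      _ = _ := by rw [hT]; ring
  exact mul_left_cancel₀ p.ne' this

/-- symplectic invariance -/
lemma sympl (h1 : P * Pᴴ - Q * Qᴴ = 1) (h2 : P * Qᵀ = Q * Pᵀ) (a b u v : Fin m → ℂ) :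
    (Q.map (starRingEnd ℂ) *ᵥ a + P.map (starRingEnd ℂ) *ᵥ b) ⬝ᵥ (P *ᵥ u + Q *ᵥ v) + a ⬝ᵥ v =
    (P *ᵥ a + Q *ᵥ b) ⬝ᵥ (Q.map (starRingEnd ℂ) *ᵥ u + P.map (starRingEnd ℂ) *ᵥ v) + b ⬝ᵥ u := by
  obtain ⟨r1, r2, r3, r4⟩ := rels h1 h2
  have e : ∀ (M N : Matrix (Fin m) (Fin m) ℂ) (x y : Fin m → ℂ),
      (M *ᵥ x) ⬝ᵥ (N *ᵥ y) = x ⬝ᵥ ((Mᵀ * N) *ᵥ y) := by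
    intro M N x y
    rw [← Matrix.mulVec_mulVec, Matrix.dotProduct_mulVec x, Matrix.vecMul_transpose]
  have c : ∀ M : Matrix (Fin m) (Fin m) ℂ, (M.map (starRingEnd ℂ))ᵀ = Mᴴ :=
      fun M => by ext i j; simp
  simp only [dotProduct_add, add_dotProduct, e, c, r1, r2, r3, r4, Matrix.add_mulVec,
    Matrix.one_mulVec]
  ring

lemma const_id (h1 : P * Pᴴ - Q * Qᴴ = 1) (h2 : P * Qᵀ = Q * Pᵀ) (z b a : Fin m → ℂ)
    (ha : a = P⁻¹ *ᵥ (z - Q *ᵥ b)) :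
    P *ᵥ a + Q *ᵥ b = z ∧
    z ⬝ᵥ (Q.map (starRingEnd ℂ) *ᵥ a + P.map (starRingEnd ℂ) *ᵥ b) + a ⬝ᵥ b =
      z ⬝ᵥ ((Q.map (starRingEnd ℂ) * P⁻¹) *ᵥ z) + 2 * (b ⬝ᵥ (P⁻¹ *ᵥ z)) -
        b ⬝ᵥ ((P⁻¹ * Q) *ᵥ b) := by
  have hP : IsUnit P.det := (detP_ne h1).isUnit
  have hPP : P * P⁻¹ = 1 := Matrix.mul_nonsing_inv _ hP
  have hz : P *ᵥ a + Q *ᵥ b = z := by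
    rw [ha, Matrix.mulVec_mulVec, hPP, Matrix.one_mulVec]; simp
  refine ⟨hz, ?_⟩
  have := sympl h1 h2 a b (P⁻¹ *ᵥ z) 0
  rw [hz] at this
  simp only [Matrix.mulVec_zero, add_zero, dotProduct_zero, Matrix.mulVec_mulVec, hPP,
    Matrix.one_mulVec] at this
  rw [dotProduct_comm, this, dotProduct_comm a b, ha]
  simp only [Matrix.mulVec_sub, dotProduct_sub, Matrix.mulVec_mulVec]
  ring

end alg

def eqv (m : ℕ) : (Fin m → ℂ) ≃ᵐ (Fin m ⊕ Fin m → ℝ) :=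
  ((MeasurableEquiv.piCongrRight fun _ : Fin m => Complex.measurableEquivRealProd).trans
    (MeasurableEquiv.arrowProdEquivProdArrow ℝ ℝ (Fin m))).trans
    (MeasurableEquiv.sumPiEquivProdPi (fun _ : Fin m ⊕ Fin m => ℝ)).symm

lemma eqv_inl (m : ℕ) (u : Fin m → ℂ) (i : Fin m) : eqv m u (Sum.inl i) = (u i).re := rfl
lemma eqv_inr (m : ℕ) (u : Fin m → ℂ) (i : Fin m) : eqv m u (Sum.inr i) = (u i).im := rfl

lemma eqv_mp (m : ℕ) : MeasurePreserving (eqv m) volume volume := by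
  refine MeasurePreserving.trans (MeasurePreserving.trans (μb := volume) ?_
    (volume_measurePreserving_arrowProdEquivProdArrow ℝ ℝ (Fin m)))
    (volume_measurePreserving_sumPiEquivProdPi_symm (fun _ : Fin m ⊕ Fin m => ℝ))
  exact volume_preserving_pi (fun _ => Complex.volume_preserving_equiv_real_prod)

lemma T_apply {m : ℕ} (a b : Fin m → ℂ) :
    Tmat m *ᵥ (Sum.elim a b) = Sum.elim (a + Complex.I • b) (a - Complex.I • b) := by
  rw [Tmat, Matrix.fromBlocks_mulVec]
  simp [Matrix.smul_mulVec, Matrix.neg_mulVec, sub_eq_add_neg]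

lemma dot_T {m : ℕ} (v : Fin m ⊕ Fin m → ℂ) :
    v ⬝ᵥ v = ((Tmat m *ᵥ v) ∘ Sum.inl) ⬝ᵥ ((Tmat m *ᵥ v) ∘ Sum.inr) := by
  obtain ⟨a, b, rfl⟩ : ∃ a b, v = Sum.elim a b := ⟨v ∘ Sum.inl, v ∘ Sum.inr, by simp⟩
  rw [T_apply]
  simp only [Sum.elim_comp_inl, Sum.elim_comp_inr, dotProduct, Fintype.sum_sum_type,
    Sum.elim_inl, Sum.elim_inr, ← Finset.sum_add_distrib]
  refine Finset.sum_congr rfl fun i _ => ?_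
  simp only [Pi.add_apply, Pi.sub_apply, Pi.smul_apply, smul_eq_mul]
  linear_combination ((b i) ^ 2) * Complex.I_sq

lemma quad_id {m : ℕ} (P Q : Matrix (Fin m) (Fin m) ℂ) (k : ℝ) (v : Fin m ⊕ Fin m → ℂ)
    (p q : Fin m → ℂ) (hv : Tmat m *ᵥ v = Sum.elim p q) :
    v ⬝ᵥ ((((k / 2) • ((Amat m P Q)ᵀ * Amat m P Q + 1)).map Complex.ofReal) *ᵥ v) =
    (k / 2 : ℂ) * ((P *ᵥ p + Q *ᵥ q) ⬝ᵥ
      (Q.map (starRingEnd ℂ) *ᵥ p + P.map (starRingEnd ℂ) *ᵥ q) + p ⬝ᵥ q) := by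
  have h : ((k / 2) • ((Amat m P Q)ᵀ * Amat m P Q + 1)).map Complex.ofReal =
      (k / 2 : ℂ) • (((Amat m P Q).map Complex.ofReal)ᵀ * (Amat m P Q).map Complex.ofReal + 1) := by
    have h1 : ((Amat m P Q)ᵀ * Amat m P Q + 1).map Complex.ofRealHom =
      ((Amat m P Q).map Complex.ofReal)ᵀ * (Amat m P Q).map Complex.ofReal + 1 := by
      rw [Matrix.map_add _ (map_add _), Matrix.map_mul, Matrix.map_one _ (map_zero _) (map_one _)]
      rfl
    rw [← h1]
    ext i j; simp [mul_add]
  rw [h, Matrix.smul_mulVec, dotProduct_smul, smul_eq_mul, Matrix.add_mulVec, Matrix.one_mulVec,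
    dotProduct_add, ← Matrix.mulVec_mulVec, Matrix.dotProduct_mulVec, Matrix.vecMul_transpose,
    dot_T (_ *ᵥ _), dot_T v, Matrix.mulVec_mulVec, T_A, ← Matrix.mulVec_mulVec, hv, Wmat,
    Matrix.fromBlocks_mulVec]
  simp

lemma core (m : ℕ) (P Q : Matrix (Fin m) (Fin m) ℂ)
    (h1 : P * Pᴴ - Q * Qᴴ = 1) (h2 : P * Qᵀ = Q * Pᵀ)
    (k : ℝ) (hk : 0 < k) (z b : Fin m → ℂ) (F : (Fin m → ℂ) → ℂ)
    (hF : ∀ u, F u = Complex.exp (k * (z ⬝ᵥ star (P *ᵥ u + Q *ᵥ star u) -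
      ((P *ᵥ u + Q *ᵥ star u) ⬝ᵥ star (P *ᵥ u + Q *ᵥ star u)) / 2 + u ⬝ᵥ b -
      (u ⬝ᵥ star u) / 2))) :
    Integrable F ∧ ∫ u, F u = ((π ^ m * (k ^ m * ‖P.det‖)⁻¹ : ℝ) : ℂ) *
      Complex.exp (k * (1 / 2 * (z ⬝ᵥ ((Q.map (starRingEnd ℂ) * P⁻¹) *ᵥ z)) +
        (b ⬝ᵥ (P⁻¹ *ᵥ z)) - 1 / 2 * (b ⬝ᵥ ((P⁻¹ * Q) *ᵥ b)))) := by
  set C := Complex.exp (k * (1 / 2 * (z ⬝ᵥ ((Q.map (starRingEnd ℂ) * P⁻¹) *ᵥ z)) +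
        (b ⬝ᵥ (P⁻¹ *ᵥ z)) - 1 / 2 * (b ⬝ᵥ ((P⁻¹ * Q) *ᵥ b)))) with hC
  set N := (k / 2) • ((Amat m P Q)ᵀ * Amat m P Q + 1) with hNdef
  have hN1 : ((Amat m P Q)ᵀ * Amat m P Q + 1).PosDef := by
    have := Matrix.posSemidef_conjTranspose_mul_self (Amat m P Q)
    rw [Matrix.conjTranspose_eq_transpose_of_trivial] at this
    exact Matrix.PosDef.posSemidef_add this Matrix.PosDef.one
  have hN : N.PosDef := hN1.smul (by positivity)
  have hNdet : √ N.det = k ^ m * ‖P.det‖ := by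
    have hd := det_AA h1 h2
    rw [Complex.norm_real, Real.norm_of_nonneg hN1.det_pos.le] at hd
    rw [hNdef, Matrix.det_smul, hd, Fintype.card_sum, Fintype.card_fin]
    rw [show (k / 2) ^ (m + m) * (2 ^ m * ‖P.det‖) ^ 2 = (k ^ m * ‖P.det‖) ^ 2 by
      rw [div_pow]; field_simp; ring]
    exact Real.sqrt_sq (by positivity)
  set a := P⁻¹ *ᵥ (z - Q *ᵥ b) with ha
  obtain ⟨hz, hconst⟩ := const_id h1 h2 z b a ha
  set x0 : Fin m ⊕ Fin m → ℂ := Sum.elim ((1 / 2 : ℂ) • (a + b))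
    ((-Complex.I / 2) • (a - b)) with hx0
  obtain ⟨g1, g2⟩ := gauss_pd N hN x0
  set G : (Fin m ⊕ Fin m → ℝ) → ℂ := fun x => Complex.exp (-((fun j => (x j : ℂ) - x0 j) ⬝ᵥ
      ((N.map Complex.ofReal) *ᵥ (fun j => (x j : ℂ) - x0 j)))) with hG
  have hFG : F = fun u => C * G (eqv m u) := by
    funext u
    have hT : Tmat m *ᵥ (fun j => ((eqv m u j : ℝ) : ℂ) - x0 j) =
        Sum.elim (u - a) (star u - b) := by
      have : (fun j => ((eqv m u j : ℝ) : ℂ) - x0 j) =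
          Sum.elim (fun i => ((u i).re : ℂ) - (1 / 2 : ℂ) * (a i + b i))
            (fun i => ((u i).im : ℂ) - (-Complex.I / 2) * (a i - b i)) := by
        funext j
        rcases j with i | i
        · simp [eqv_inl, hx0, mul_add]
        · simp [eqv_inr, hx0]
      rw [this, T_apply]
      have hre : ∀ i, u i = (u i).re + (u i).im * Complex.I := fun i => (Complex.re_add_im _).symm
      have him : ∀ i, star (u i) = (u i).re - (u i).im * Complex.I := fun i => by
        apply Complex.ext <;> simp
      congr 1
      · funext i
        simp only [Pi.add_apply, Pi.sub_apply, Pi.smul_apply, smul_eq_mul]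
        linear_combination (-1 : ℂ) * hre i + ((a i - b i) / 2) * Complex.I_sq
      · funext i
        simp only [Pi.add_apply, Pi.sub_apply, Pi.smul_apply, smul_eq_mul, Pi.star_apply]
        linear_combination (-1 : ℂ) * him i - ((a i - b i) / 2) * Complex.I_sq
    rw [hF, hC, hG]
    simp only
    rw [quad_id P Q k _ _ _ hT, ← Complex.exp_add]
    congr 1
    have hs : star (P *ᵥ u + Q *ᵥ star u) =
        Q.map (starRingEnd ℂ) *ᵥ u + P.map (starRingEnd ℂ) *ᵥ star u := by
      funext i
      simp [Matrix.mulVec, dotProduct, add_comm]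
    have e1 : P *ᵥ (u - a) + Q *ᵥ (star u - b) = (P *ᵥ u + Q *ᵥ star u) - z := by
      rw [← hz, Matrix.mulVec_sub, Matrix.mulVec_sub]; abel
    set γ := Q.map (starRingEnd ℂ) *ᵥ a + P.map (starRingEnd ℂ) *ᵥ b with hγ
    have e2 : Q.map (starRingEnd ℂ) *ᵥ (u - a) + P.map (starRingEnd ℂ) *ᵥ (star u - b) =
        star (P *ᵥ u + Q *ᵥ star u) - γ := by
      rw [hs, hγ, Matrix.mulVec_sub, Matrix.mulVec_sub]; abel
    have e3 := sympl h1 h2 a b u (star u)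
    rw [← hs, hz, ← hγ] at e3
    rw [e1, e2]
    set y := P *ᵥ u + Q *ᵥ star u
    simp only [sub_dotProduct, dotProduct_sub]
    rw [dotProduct_comm y γ, dotProduct_comm u b]
    linear_combination (-(k:ℂ) / 2) * e3 + (k / 2 : ℂ) * hconst
  have hmp := eqv_mp m
  refine ⟨?_, ?_⟩
  · rw [hFG]
    exact ((hmp.integrable_comp_emb (eqv m).measurableEmbedding).2 g1).const_mul C
  · rw [hFG, integral_const_mul, hmp.integral_comp (eqv m).measurableEmbedding G, g2, hNdet,
      mul_comm, Fintype.card_sum, Fintype.card_fin, ← two_mul, pow_mul, Real.sq_sqrt pi_pos.le]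

lemma dd {m : ℕ} (M : Matrix (Fin m) (Fin m) ℂ) (x y : Fin m → ℂ) :
    ∑ i, ∑ j, x i * M i j * y j = x ⬝ᵥ (M *ᵥ y) := by
  simp [Matrix.mulVec, dotProduct, Finset.mul_sum, mul_assoc]

lemma nsq {m : ℕ} (x : Fin m → ℂ) : ((∑ j, Complex.normSq (x j) : ℝ) : ℂ) = x ⬝ᵥ star x := by
  simp [dotProduct, Complex.mul_conj]

end helpers

/-- **Toeplitz realization of the metaplectic representation.** If `P P* - Q Q* = I` and
`P Qᵗ = Q Pᵗ`, then the composition `∫_X Π̂_k(ẑ, Â û) Π̂_k(û, ŵ) dVol_X(û)`, with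
`dVol_X = (dθ/2π) ⊗ 2^m dL`, converges absolutely and equals
`(k/(2π))^m |det P|⁻¹ exp(k[(1/2) zᵗ Q̄P⁻¹ z + w̄ᵗ P⁻¹ z - (1/2) w̄ᵗ P⁻¹Q w̄])
· e^{k(iθ_z - |z|²/2)} · e^{k(-iθ_w - |w|²/2)}`. -/
theorem toeplitz_metaplectic_kernel (m : ℕ) (hm : 1 ≤ m)
    (P Q : Matrix (Fin m) (Fin m) ℂ)
    (h1 : P * P.conjTranspose - Q * Q.conjTranspose = 1)
    (h2 : P * Q.transpose = Q * P.transpose)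
    (k : ℝ) (hk : 0 < k) (z w : Fin m → ℂ) (θz θw : ℝ) :
    IntegrableOn
      (fun p : (Fin m → ℂ) × ℝ =>
        szegoBF m k (z, θz) (symplecticLift m P Q p) * szegoBF m k p (w, θw))
      (Set.univ ×ˢ Set.Icc (0 : ℝ) (2 * π)) volume ∧
    ((2 ^ m / (2 * π) : ℝ) : ℂ) *
        ∫ p in Set.univ ×ˢ Set.Icc (0 : ℝ) (2 * π),
          szegoBF m k (z, θz) (symplecticLift m P Q p) * szegoBF m k p (w, θw) =
      (((k / (2 * π)) ^ m * ‖P.det‖⁻¹ : ℝ) : ℂ) *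
        Complex.exp ((k : ℂ) *
          ((1 / 2) * (∑ i, ∑ j, z i * ((Q.map (starRingEnd ℂ)) * P⁻¹) i j * z j) +
            (∑ i, ∑ j, (starRingEnd ℂ) (w i) * P⁻¹ i j * z j) -
            (1 / 2) * ∑ i, ∑ j,
              (starRingEnd ℂ) (w i) * (P⁻¹ * Q) i j * (starRingEnd ℂ) (w j))) *
        Complex.exp ((k : ℂ) *
          (Complex.I * (θz : ℂ) - ((∑ j, Complex.normSq (z j) : ℝ) : ℂ) / 2)) *
        Complex.exp ((k : ℂ) *
          (-Complex.I * (θw : ℂ) - ((∑ j, Complex.normSq (w j) : ℝ) : ℂ) / 2)) := by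
  obtain ⟨c1, c2⟩ := core m P Q h1 h2 k hk z (star w) _ (fun u => rfl)
  set F : (Fin m → ℂ) → ℂ := fun u => Complex.exp (k * (dotProduct z (star (P.mulVec u + Q.mulVec (star u))) -
      (dotProduct (P.mulVec u + Q.mulVec (star u)) (star (P.mulVec u + Q.mulVec (star u)))) / 2 +
      dotProduct u (star w) - (dotProduct u (star u)) / 2)) with hF
  set E1 := Complex.exp ((k : ℂ) *
          (Complex.I * (θz : ℂ) - ((∑ j, Complex.normSq (z j) : ℝ) : ℂ) / 2)) with hE1
  set E2 := Complex.exp ((k : ℂ) *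
          (-Complex.I * (θw : ℂ) - ((∑ j, Complex.normSq (w j) : ℝ) : ℂ) / 2)) with hE2
  set c : ℂ := (((k / (2 * π)) ^ m : ℝ) : ℂ) with hc
  have hint : (fun p : (Fin m → ℂ) × ℝ =>
        szegoBF m k (z, θz) (symplecticLift m P Q p) * szegoBF m k p (w, θw)) =
      fun p => (c * c * E1 * E2 * F p.1) * (1 : ℂ) := by
    funext p
    obtain ⟨u, θ⟩ := p
    have hy : (symplecticLift m P Q (u, θ)).1 = P.mulVec u + Q.mulVec (star u) := by
      funext i; simp [symplecticLift, Matrix.mulVec, dotProduct]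
    have hy2 : (symplecticLift m P Q (u, θ)).2 = θ := rfl
    have ds : ∀ x y : Fin m → ℂ, ∑ j, x j * (starRingEnd ℂ) (y j) = dotProduct x (star y) :=
      fun x y => rfl
    simp only [szegoBF, hy, hy2, nsq, ds, hE1, hE2, hF, ← hc]
    rw [mul_one, mul_mul_mul_comm, mul_assoc (c * c), mul_assoc (c * c), ← Complex.exp_add,
      ← Complex.exp_add, ← Complex.exp_add]
    congr 2
    ring
  have hvol : (volume : Measure ((Fin m → ℂ) × ℝ)) = volume.prod volume := rfl
  rw [hint]
  constructor
  · rw [IntegrableOn, hvol, ← Measure.prod_restrict, Measure.restrict_univ]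
    exact (c1.const_mul (c * c * E1 * E2)).mul_prod (integrable_const (1 : ℂ))
  · rw [hvol, setIntegral_prod_mul (fun u => c * c * E1 * E2 * F u) (fun _ => (1 : ℂ)),
      Measure.restrict_univ, integral_const_mul, c2]
    have hI : ∫ _ in Set.Icc (0 : ℝ) (2 * π), (1 : ℂ) = ((2 * π : ℝ) : ℂ) := by
      rw [setIntegral_const]
      simp [pi_pos.le]
    have hd1 := dd (Q.map (starRingEnd ℂ) * P⁻¹) z z
    have hd2 : ∑ i, ∑ j, (starRingEnd ℂ) (w i) * P⁻¹ i j * z j = _ := dd P⁻¹ (star w) z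
    have hd3 : ∑ i, ∑ j, (starRingEnd ℂ) (w i) * (P⁻¹ * Q) i j * (starRingEnd ℂ) (w j) = _ :=
      dd (P⁻¹ * Q) (star w) (star w)
    rw [hI, hd1, hd2, hd3]
    set X := Complex.exp _
    have hsc : (2 ^ m / (2 * π)) * ((k / (2 * π)) ^ m * (k / (2 * π)) ^ m *
        (π ^ m * (k ^ m * ‖P.det‖)⁻¹)) * (2 * π) = (k / (2 * π)) ^ m * ‖P.det‖⁻¹ := by
      have := pi_pos
      have hk' : k ^ m ≠ 0 := by positivity
      have h3 : ‖P.det‖ ≠ 0 := norm_ne_zero_iff.2 (detP_ne h1)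
      rw [div_pow, mul_pow]
      field_simp
    rw [← hsc, hc]
    push_cast
    ring
end
end
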